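/- There are absolute constants C' > 0 and C > 0 such that the following holds. Let G be a finite abelian group, M ≥ 1 and ε ∈ [0,1] with ε ≤ exp(−C'·M), and let f : G → ℂ be ε-almost integer-valued with ‖f‖_{A(G)} ≤ M. Then there is a function z : W(G) → ℤ such that f_ℤ = ∑_{W ∈ W(G)} z(W)·1_W and ∑_{W ∈ W(G)} |z(W)| ≤ exp(C·M⁴·log⁸(2M)). -/

import Mathlib

open scoped BigOperators Pointwise ENNReal ENat
open Real

namespace Paper

noncomputable section

/-- For `z` on the unit circle, `circNorm z = min {|θ| : z = exp(2πiθ)}`. -/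
def circNorm (z : ℂ) : ℝ := |z.arg| / (2 * Real.pi)

variable {G : Type} [AddCommGroup G]

/-- The (generalised) Bohr set with frequency set `Γ` and width function `δ`. -/
def bohrSet (Γ : Set (AddChar G ℂ)) (δ : AddChar G ℂ → ℝ) : Set G :=
  {x | ∀ γ ∈ Γ, circNorm (γ x) < δ γ}

/-- `(Γ, δ)` generates the family of sets `F` as a Bohr system. -/
def IsBohrGen (Γ : Set (AddChar G ℂ)) (δ : AddChar G ℂ → ℝ) (F : ℝ → Set G) : Prop :=
  (∀ γ ∈ Γ, 0 < δ γ) ∧ ∀ η : ℝ, 0 < η → η ≤ 1 → F η = bohrSet Γ (fun γ => η * δ γ)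

/-- A Bohr system: a family `(B_η)_{η ∈ (0,1]}` of subsets of `G` of the form
`B_η = Bohr(Γ, ηδ)` for some generating pair `(Γ, δ)`. -/
structure BohrSystem (G : Type) [AddCommGroup G] where
  sets : ℝ → Set G
  exists_gen : ∃ Γ δ, IsBohrGen Γ δ sets

/-- The covering number `C(S;T) = min {|X| : S ⊆ X + T}`, valued in `ℕ∞`. -/
def coveringNumber {H : Type} [AddCommGroup H] (S T : Set H) : ℕ∞ :=
  sInf {n : ℕ∞ | ∃ X : Finset H, (X.card : ℕ∞) = n ∧ S ⊆ (X : Set H) + T}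

/-- Auxiliary quantity for the difference covering number, for a fixed target group `H`. -/
def dCovAux (S T : Set G) (H : Type) [AddCommGroup H] : ℕ∞ :=
  ⨅ (φ : G →+ H) (U : Set H) (V : Set H) (_ : S ⊆ φ ⁻¹' U) (_ : φ ⁻¹' (V - V) ⊆ T),
    coveringNumber U V

/-- The difference covering number `C^Δ(S;T)`: the infimum of `C_H(U;V)` over all abelian
groups `H`, homomorphisms `φ : G → H` and sets `U, V ⊆ H` with `S ⊆ φ⁻¹(U)` and
`φ⁻¹(V − V) ⊆ T`. -/
def dCoveringNumber (S T : Set G) : ℕ∞ :=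
  ⨅ (H : Type) (inst : AddCommGroup H), @dCovAux G _ S T H inst

/-- Interpret an extended natural number as a real number. -/
def enatReal (n : ℕ∞) : ℝ := (n.toNat : ℝ)

/-- The dimension of a family of sets: `sup {log₂ C^Δ(F_η; F_{η/2}) : η ∈ (0,1]}`. -/
def dimOfSets (F : ℝ → Set G) : ℝ :=
  sSup {r : ℝ | ∃ η : ℝ, 0 < η ∧ η ≤ 1 ∧
    r = Real.logb 2 (enatReal (dCoveringNumber (F η) (F (η / 2))))}

/-- The dimension `dim B` of a Bohr system. -/
def BohrSystem.dim (B : BohrSystem G) : ℝ := dimOfSets B.sets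

/-- The doubling dimension of a family of sets:
`sup {log₂ C(F_η; F_{η/2}) : η ∈ (0,1]}`. -/
def dimStarOfSets (F : ℝ → Set G) : ℝ :=
  sSup {r : ℝ | ∃ η : ℝ, 0 < η ∧ η ≤ 1 ∧
    r = Real.logb 2 (enatReal (coveringNumber (F η) (F (η / 2))))}

/-- The doubling dimension `dim* B` of a Bohr system. -/
def BohrSystem.dimStar (B : BohrSystem G) : ℝ := dimStarOfSets B.sets

/-- `B' ≤ B` for Bohr systems, i.e. `B' ∧ B = B'`, i.e. `B'_η ⊆ B_η` for all `η ∈ (0,1]`. -/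
def BohrSystem.le (B' B : BohrSystem G) : Prop :=
  ∀ η : ℝ, 0 < η → η ≤ 1 → B'.sets η ⊆ B.sets η

/-- The width of a Bohr system: `inf {‖δ‖_{ℓ∞(Γ)} : (Γ,δ) generates B}`. -/
def BohrSystem.width (B : BohrSystem G) : ℝ :=
  sInf {r : ℝ | ∃ Γ δ, IsBohrGen Γ δ B.sets ∧ r = sSup (δ '' Γ)}

/-- The `n`-fold sumset `nS = S + ⋯ + S`. -/
def iterSum : ℕ → Set G → Set G
  | 0, _ => {0}
  | n + 1, S => S + iterSum n S

/-- The set of all cosets of subgroups of `G`. -/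
def cosets (G : Type) [AddCommGroup G] : Set (Set G) :=
  {W | ∃ (H : AddSubgroup G) (x : G), W = (fun h => x + h) '' (H : Set G)}

/-- The set of cosets of a fixed subgroup `H` of `G`. -/
def cosetsOf (H : AddSubgroup G) : Set (Set G) :=
  {W | ∃ x : G, W = (fun h => x + h) '' (H : Set G)}

/-- `f` is `ε`-almost integer-valued, with integer part `fZ`. -/
def AlmostInt (ε : ℝ) (f : G → ℂ) (fZ : G → ℤ) : Prop :=
  ∀ x, ‖f x - (fZ x : ℂ)‖ ≤ ε

/-- The `ρ`-approximate annihilator `N(S,ρ)` of a set `S ⊆ G`. -/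
def annihilator (S : Set G) (ρ : ℝ) : Set (AddChar G ℂ) :=
  {γ | ∀ x ∈ S, ‖(1 : ℂ) - γ x‖ < ρ}

/-- `A` is `(m,l)`-arithmetically connected. -/
def ArithConnected (m l : ℕ) (A : Set G) : Prop :=
  ∀ x : Fin m → G, (∀ i, x i ∈ A) →
    ∃ σ : Fin m → ℤ, (∑ i, (σ i).natAbs) ≤ l ∧
      (∃ i j, i ≠ j ∧ (σ i).natAbs = 1 ∧ (σ j).natAbs = 1) ∧
      (∑ i, σ i • x i) ∈ A

variable [Fintype G]

/-- The Haar probability measure of a subset of the finite group `G`. -/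
def haar (S : Set G) : ℝ := (Nat.card S : ℝ) / (Fintype.card G : ℝ)

/-- A probability measure on the finite group `G`, given by its weight function. -/
def IsProb (w : G → ℝ) : Prop := (∀ x, 0 ≤ w x) ∧ ∑ x, w x = 1

/-- The measure of `S` under the weight function `w`. -/
def wMeasure (w : G → ℝ) (S : Set G) : ℝ := ∑ x, S.indicator w x

/-- The probability measure `μ_S`: `μ` restricted to `S` and normalised. -/
def restrictProb (w : G → ℝ) (S : Set G) : G → ℝ :=
  fun x => S.indicator w x / wMeasure w S

/-- The probability measure `w` is `F`-approximately invariant: for every `η ∈ (0,1]` there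
are probability measures `w⁺, w⁻` with `(1−η)·w⁻ ≤ τ_x(w) ≤ (1+η)·w⁺` for all `x ∈ F η`. -/
def ApproxInvariant (F : ℝ → Set G) (w : G → ℝ) : Prop :=
  ∀ η : ℝ, 0 < η → η ≤ 1 → ∃ wp wm : G → ℝ, IsProb wp ∧ IsProb wm ∧
    ∀ x ∈ F η, ∀ y : G, (1 - η) * wm y ≤ w (y - x) ∧ w (y - x) ≤ (1 + η) * wp y

/-- The Fourier coefficient `f̂(γ) = (1/|G|) ∑_x f(x) conj(γ(x))`. -/
def fourierCoeff (f : G → ℂ) (γ : AddChar G ℂ) : ℂ :=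
  (Fintype.card G : ℂ)⁻¹ * ∑ x, f x * (starRingEnd ℂ) (γ x)

/-- The Wiener norm `‖f‖_{A(G)} = ∑_γ |f̂(γ)|`. -/
def wienerNorm (f : G → ℂ) : ℝ := ∑ᶠ γ : AddChar G ℂ, ‖fourierCoeff f γ‖

/-- The Fourier transform `μ̂(γ) = ∫ conj(γ(x)) dμ(x)` of a measure with weight `w`. -/
def fourierWeight (w : G → ℝ) (γ : AddChar G ℂ) : ℂ :=
  ∑ x, (starRingEnd ℂ) (γ x) * (w x : ℂ)

/-- Convolution `f ∗ μ (x) = ∫ f(x−y) dμ(y)` of a complex function with a measure. -/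
def convC (f : G → ℂ) (w : G → ℝ) (x : G) : ℂ := ∑ y, f (x - y) * (w y : ℂ)

/-- Convolution `f ∗ μ (x) = ∫ f(x−y) dμ(y)` of a real function with a measure. -/
def convR (f : G → ℝ) (w : G → ℝ) (x : G) : ℝ := ∑ y, f (x - y) * w y

/-- Convolution of functions w.r.t. Haar measure: `f ∗ g (x) = (1/|G|) ∑_y f(y) g(x−y)`. -/
def convFun (f g : G → ℝ) (x : G) : ℝ := (Fintype.card G : ℝ)⁻¹ * ∑ y, f y * g (x - y)

/-- The `L_p` norm `(∫ |f|^p dν)^{1/p}` w.r.t. the measure with weight `w`. -/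
def LpW (p : ℝ) (w : G → ℝ) (f : G → ℂ) : ℝ := (∑ y, w y * ‖f y‖ ^ p) ^ (1 / p)

/-- `X` has relative polynomial growth of order `d`. -/
def HasRPG (X : Set G) (d : ℝ) : Prop :=
  ∀ n : ℕ, 1 ≤ n → haar (iterSum n X) ≤ (n : ℝ) ^ d * haar X

end

set_option linter.unusedSectionVars false

section Part1

variable {G : Type} [AddCommGroup G] [DecidableEq G]

/-- iterated sumset -/
def ms : ℕ → Finset G → Finset G
  | 0, _ => {0}
  | k + 1, B => B + ms k B

theorem ms_zero (B : Finset G) : ms 0 B = {0} := rfl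
theorem ms_succ (k : ℕ) (B : Finset G) : ms (k + 1) B = B + ms k B := rfl
theorem ms_one (B : Finset G) : ms 1 B = B := by
  rw [ms_succ, ms_zero, Finset.add_singleton]; simp

theorem ms_add (a b : ℕ) (B : Finset G) : ms (a + b) B = ms a B + ms b B := by
  induction a with
  | zero => rw [ms_zero, Nat.zero_add, Finset.singleton_add]; simp
  | succ a ih => rw [show a + 1 + b = (a + b) + 1 by ring, ms_succ, ih, ms_succ, add_assoc]

theorem ms_mul (a b : ℕ) (B : Finset G) : ms (a * b) B = ms a (ms b B) := by
  induction a with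
  | zero => rw [Nat.zero_mul, ms_zero, ms_zero]
  | succ a ih => rw [show (a + 1) * b = b + a * b by ring, ms_add, ih, ms_succ]

theorem zero_mem_ms {B : Finset G} (h : (0 : G) ∈ B) (k : ℕ) : (0 : G) ∈ ms k B := by
  induction k with
  | zero => simp [ms_zero]
  | succ k ih => rw [ms_succ]; simpa using Finset.add_mem_add h ih

theorem ms_mono {B B' : Finset G} (h : B ⊆ B') (k : ℕ) : ms k B ⊆ ms k B' := by
  induction k with
  | zero => simp [ms_zero]
  | succ k ih => rw [ms_succ, ms_succ]; exact Finset.add_subset_add h ih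

theorem subset_add_of_zero {X B : Finset G} (h : (0 : G) ∈ B) : X ⊆ X + B := by
  intro x hx
  simpa using Finset.add_mem_add hx h

theorem ms_mono_left {B : Finset G} (h : (0 : G) ∈ B) {a b : ℕ} (hab : a ≤ b) :
    ms a B ⊆ ms b B := by
  obtain ⟨c, rfl⟩ := Nat.exists_eq_add_of_le hab
  rw [ms_add]
  exact subset_add_of_zero (zero_mem_ms h c)

theorem subset_ms {B : Finset G} (h : (0 : G) ∈ B) {k : ℕ} (hk : 1 ≤ k) : B ⊆ ms k B := by
  have := ms_mono_left h hk
  rwa [ms_one] at this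

/-- symmetric set containing zero -/
def Sym0 (B : Finset G) : Prop := (0 : G) ∈ B ∧ ∀ x ∈ B, -x ∈ B

theorem Sym0.ms {B : Finset G} (h : Sym0 B) (k : ℕ) : Sym0 (ms k B) := by
  refine ⟨zero_mem_ms h.1 k, ?_⟩
  induction k with
  | zero => simp [ms_zero]
  | succ k ih =>
    intro x hx
    rw [ms_succ] at hx ⊢
    obtain ⟨a, ha, b, hb, rfl⟩ := Finset.mem_add.1 hx
    rw [neg_add]
    exact Finset.add_mem_add (h.2 a ha) (ih b hb)

theorem sym0_sub {S : Finset G} (h : S.Nonempty) : Sym0 (S - S) := by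
  refine ⟨?_, ?_⟩
  · obtain ⟨s, hs⟩ := h
    simpa using Finset.sub_mem_sub hs hs
  · intro x hx
    obtain ⟨a, ha, b, hb, rfl⟩ := Finset.mem_sub.1 hx
    rw [neg_sub]
    exact Finset.sub_mem_sub hb ha

variable [Fintype G]

theorem char_add_bound (γ : AddChar G ℂ) (u v : G) :
    ‖1 - γ (u + v)‖ ≤ ‖1 - γ u‖ + ‖1 - γ v‖ := by
  have : 1 - γ (u + v) = (1 - γ u) + γ u * (1 - γ v) := by
    rw [AddChar.map_add_eq_mul]; ring
  rw [this]
  refine (norm_add_le _ _).trans ?_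
  rw [norm_mul, AddChar.norm_apply, one_mul]

theorem char_neg_bound (γ : AddChar G ℂ) (u : G) : ‖1 - γ (-u)‖ = ‖1 - γ u‖ := by
  have h0 : γ u * γ (-u) = 1 := by
    rw [← AddChar.map_add_eq_mul]; simp
  have h : 1 - γ u = - (γ u * (1 - γ (-u))) := by
    rw [mul_sub, h0]; ring
  rw [h, norm_neg, norm_mul, AddChar.norm_apply, one_mul]

theorem char_ms_bound (γ : AddChar G ℂ) {B : Finset G} {η : ℝ}
    (h : ∀ u ∈ B, ‖1 - γ u‖ ≤ η) (k : ℕ) : ∀ u ∈ ms k B, ‖1 - γ u‖ ≤ k * η := by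
  induction k with
  | zero => simp [ms_zero]
  | succ k ih =>
    intro x hx
    rw [ms_succ] at hx
    obtain ⟨a, ha, b, hb, rfl⟩ := Finset.mem_add.1 hx
    have := char_add_bound γ a b
    have h1 := h a ha
    have h2 := ih b hb
    push_cast
    linarith

/-! ### Cells -/

/-- Lemma B: a large subset of `S` on which all the given characters are nearly constant. -/
theorem cells {ι : Type} [Fintype ι] [DecidableEq ι] (γ : ι → AddChar G ℂ) (L : ℕ) (hL : 1 ≤ L)
    (S : Finset G) :
    ∃ S' ⊆ S, S.card ≤ ((4 * L + 1) ^ 2) ^ (Fintype.card ι) * S'.card ∧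
      ∀ s ∈ S', ∀ s' ∈ S', ∀ i, ‖1 - γ i (s - s')‖ ≤ 1 / L := by
  classical
  set R : Finset (ι → ℤ × ℤ) := Fintype.piFinset
    (fun _ => (Finset.Icc (-(2 * L : ℤ)) (2 * L)) ×ˢ (Finset.Icc (-(2 * L : ℤ)) (2 * L))) with hR
  let φ : G → (ι → ℤ × ℤ) := fun x i =>
    (⌊2 * (L : ℝ) * (γ i x).re⌋, ⌊2 * (L : ℝ) * (γ i x).im⌋)
  have hLr : (1 : ℝ) ≤ L := by exact_mod_cast hL
  have key : ∀ r : ℝ, |r| ≤ 1 → ⌊2 * (L : ℝ) * r⌋ ∈ Finset.Icc (-(2 * L : ℤ)) (2 * L) := by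
    intro r hr
    rw [abs_le] at hr
    rw [Finset.mem_Icc]
    constructor
    · rw [Int.le_floor]; push_cast; nlinarith
    · have : (⌊2 * (L : ℝ) * r⌋ : ℝ) ≤ ((2 * L : ℤ) : ℝ) := by
        refine (Int.floor_le _).trans ?_
        push_cast; nlinarith
      exact_mod_cast this
  have hmap : ∀ x ∈ S, φ x ∈ R := by
    intro x _
    rw [hR, Fintype.mem_piFinset]
    intro i
    rw [Finset.mem_product]
    have hn := AddChar.norm_apply (γ i) x
    exact ⟨key _ (hn ▸ Complex.abs_re_le_norm _), key _ (hn ▸ Complex.abs_im_le_norm _)⟩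
  have hRc : R.card = ((4 * L + 1) ^ 2) ^ (Fintype.card ι) := by
    rw [hR, Fintype.card_piFinset]
    simp only [Finset.card_product, Int.card_Icc, Finset.prod_const, Finset.card_univ]
    congr 1
    rw [show (2 * (L : ℤ) + 1 - -(2 * L)).toNat = 4 * L + 1 by omega]; ring
  have hRne : R.Nonempty := by
    rw [← Finset.card_pos, hRc]; positivity
  have : ∃ y ∈ R, S.card ≤ R.card * (S.filter (fun x => φ x = y)).card := by
    by_contra! hcon
    have h1 : S.card = ∑ y ∈ R, (S.filter (fun x => φ x = y)).card :=
      Finset.card_eq_sum_card_fiberwise hmap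
    have h2 : ∑ y ∈ R, R.card * (S.filter (fun x => φ x = y)).card < ∑ y ∈ R, S.card :=
      Finset.sum_lt_sum_of_nonempty hRne hcon
    rw [← Finset.mul_sum, ← h1, Finset.sum_const, smul_eq_mul] at h2
    exact lt_irrefl _ h2
  obtain ⟨y, _, hy⟩ := this
  refine ⟨S.filter (fun x => φ x = y), Finset.filter_subset _ _, hRc ▸ hy, ?_⟩
  intro s hs s' hs' i
  have e1 := (Finset.mem_filter.1 hs).2
  have e2 := (Finset.mem_filter.1 hs').2
  have e : φ s i = φ s' i := by rw [e1, e2]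
  simp only [φ, Prod.mk.injEq] at e
  have hd : ∀ a b : ℝ, ⌊2 * (L : ℝ) * a⌋ = ⌊2 * (L : ℝ) * b⌋ → |a - b| ≤ 1 / (2 * L) := by
    intro a b hab
    have := (Int.abs_sub_lt_one_of_floor_eq_floor hab).le
    rw [← mul_sub, abs_mul, abs_of_nonneg (by positivity : (0:ℝ) ≤ 2 * L)] at this
    rw [le_div_iff₀ (by positivity)]; linarith
  have h1 := hd _ _ e.1
  have h2 := hd _ _ e.2
  have h3 : ‖1 - γ i (s - s')‖ = ‖γ i s - γ i s'‖ := by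
    have h0 : γ i s' * γ i (s - s') = γ i s := by
      rw [← AddChar.map_add_eq_mul]; simp
    have : γ i s - γ i s' = - (γ i s' * (1 - γ i (s - s'))) := by
      rw [mul_sub, h0]; ring
    rw [this, norm_neg, norm_mul, AddChar.norm_apply, one_mul]
  rw [h3]
  have h4 := Complex.norm_le_abs_re_add_abs_im (γ i s - γ i s')
  rw [Complex.sub_re, Complex.sub_im] at h4
  have : (1 : ℝ) / L = 1 / (2 * L) + 1 / (2 * L) := by field_simp; ring
  linarith

end Part1

section Part2

/-- the four directions -/
def th : Fin 4 → ℂ := ![1, -1, Complex.I, -Complex.I]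

theorem th_norm (i : Fin 4) : ‖th i‖ = 1 := by
  fin_cases i <;> simp [th]

theorem th_dir (z : ℂ) (r : ℝ) (h : 2 * r < ‖z‖) : ∃ i, r ≤ (th i * z).re := by
  by_contra! hcon
  have h0 := hcon 0
  have h1 := hcon 1
  have h2 := hcon 2
  have h3 := hcon 3
  simp [th] at h0 h1 h2 h3
  have := Complex.norm_le_abs_re_add_abs_im z
  have a1 : |z.re| ≤ r := abs_le.2 ⟨by linarith, h0.le⟩
  have a2 : |z.im| ≤ r := abs_le.2 ⟨by linarith, by linarith⟩
  linarith

theorem exp_le_quad {x : ℝ} (hx : |x| ≤ 1) : Real.exp x ≤ 1 + x + x ^ 2 := by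
  have := (abs_le.1 (Real.abs_exp_sub_one_sub_id_le hx)).2
  linarith

theorem sampling_abs {Y ι : Type} [Fintype ι] (YY : Finset Y) (w : ι → ℝ) (hw : ∀ o, 0 ≤ w o)
    (hw1 : ∑ o, w o = 1) (n : ℝ) (v : ι → Y → ℂ) (hv : ∀ o y, ‖v o y‖ ≤ n)
    (l : ℝ) (hl : 0 ≤ l) (hln : l * (2 * n) ≤ 1) (k : ℕ) :
    ∃ g : Fin k → ι, ∑ y ∈ YY, ∑ t, Real.exp (l * (th t * ∑ i, ((∑ o, w o * v o y) - v (g i) y)).re)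
      ≤ 4 * YY.card * Real.exp (k * (l * (2 * n)) ^ 2) := by
  induction k with
  | zero =>
    refine ⟨Fin.elim0, ?_⟩
    simp; linarith
  | succ k ih =>
    obtain ⟨g, hg⟩ := ih
    set f : Y → ℂ := fun y => ∑ o, w o * v o y with hf
    have hfn : ∀ y, ‖f y‖ ≤ n := by
      intro y
      calc ‖f y‖ ≤ ∑ o, ‖(w o : ℂ) * v o y‖ := norm_sum_le _ _
        _ ≤ ∑ o, w o * n := by
          apply Finset.sum_le_sum
          intro o _
          rw [norm_mul, Complex.norm_real, Real.norm_eq_abs, abs_of_nonneg (hw o)]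
          exact mul_le_mul_of_nonneg_left (hv o y) (hw o)
        _ = n := by rw [← Finset.sum_mul, hw1, one_mul]
    set E : Y → Fin 4 → ℝ := fun y t => Real.exp (l * (th t * ∑ i, (f y - v (g i) y)).re) with hE
    have hone : ∀ y t, ∑ o, w o * Real.exp (l * (th t * (f y - v o y)).re) ≤
        Real.exp ((l * (2 * n)) ^ 2) := by
      intro y t
      have hb : ∀ o, |l * (th t * (f y - v o y)).re| ≤ l * (2 * n) := by
        intro o
        rw [abs_mul, abs_of_nonneg hl]
        apply mul_le_mul_of_nonneg_left _ hl
        refine (Complex.abs_re_le_norm _).trans ?_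
        rw [norm_mul, th_norm, one_mul]
        refine (norm_sub_le _ _).trans ?_
        linarith [hfn y, hv o y]
      have h0 : ∑ o, w o * (l * (th t * (f y - v o y)).re) = 0 := by
        have : ∑ o, (w o : ℂ) * (th t * (f y - v o y)) = 0 := by
          have h1 : ∑ o, (w o : ℂ) = 1 := by exact_mod_cast hw1
          calc ∑ o, (w o : ℂ) * (th t * (f y - v o y))
              = ∑ o, (th t * f y * w o - th t * (w o * v o y)) := by
                apply Finset.sum_congr rfl; intro o _; ring
            _ = 0 := by
                rw [Finset.sum_sub_distrib, ← Finset.mul_sum, ← Finset.mul_sum, h1]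
                simp [hf]
        have h2 := congrArg Complex.re this
        rw [Complex.re_sum] at h2
        simp only [Complex.re_ofReal_mul, Complex.zero_re] at h2
        calc _ = l * ∑ o, w o * (th t * (f y - v o y)).re := by
              rw [Finset.mul_sum]; apply Finset.sum_congr rfl; intro o _; ring
          _ = 0 := by rw [h2, mul_zero]
      calc _ ≤ ∑ o, (w o * (1 + (l * (2 * n)) ^ 2) + w o * (l * (th t * (f y - v o y)).re)) := by
            apply Finset.sum_le_sum
            intro o _
            rw [← mul_add]
            apply mul_le_mul_of_nonneg_left _ (hw o)
            have := exp_le_quad ((hb o).trans hln)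
            have h3 := sq_le_sq' (by linarith [abs_le.1 (hb o)]) (abs_le.1 (hb o)).2
            linarith
        _ = 1 + (l * (2 * n)) ^ 2 := by
            rw [Finset.sum_add_distrib, h0, ← Finset.sum_mul, hw1]; ring
        _ ≤ _ := by linarith [Real.add_one_le_exp ((l * (2 * n)) ^ 2)]
    set B := 4 * (YY.card : ℝ) * Real.exp (k * (l * (2 * n)) ^ 2) * Real.exp ((l * (2 * n)) ^ 2)
      with hB
    have havg : ∑ o, w o * ∑ y ∈ YY, ∑ t, E y t * Real.exp (l * (th t * (f y - v o y)).re) ≤ B := by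
      calc _ = ∑ y ∈ YY, ∑ t, E y t * ∑ o, w o * Real.exp (l * (th t * (f y - v o y)).re) := by
            simp only [Finset.mul_sum]
            rw [Finset.sum_comm]
            apply Finset.sum_congr rfl; intro y _
            rw [Finset.sum_comm]
            apply Finset.sum_congr rfl; intro t _
            apply Finset.sum_congr rfl; intro o _
            ring
        _ ≤ ∑ y ∈ YY, ∑ t, E y t * Real.exp ((l * (2 * n)) ^ 2) := by
            apply Finset.sum_le_sum; intro y _
            apply Finset.sum_le_sum; intro t _
            exact mul_le_mul_of_nonneg_left (hone y t) (Real.exp_pos _).le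
        _ ≤ B := by
            simp only [← Finset.sum_mul]
            exact mul_le_mul_of_nonneg_right hg (Real.exp_pos _).le
    obtain ⟨o, ho⟩ : ∃ o, ∑ y ∈ YY, ∑ t, E y t * Real.exp (l * (th t * (f y - v o y)).re) ≤ B := by
      by_contra! hcon
      obtain ⟨o0, ho0⟩ : ∃ o, 0 < w o := by
        by_contra! h
        have : ∑ o, w o ≤ 0 := Finset.sum_nonpos (fun o _ => h o)
        linarith
      have : ∑ o, w o * B < ∑ o, w o * ∑ y ∈ YY, ∑ t, E y t * Real.exp (l * (th t * (f y - v o y)).re) := by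
        apply Finset.sum_lt_sum
        · intro o _; exact mul_le_mul_of_nonneg_left (hcon o).le (hw o)
        · exact ⟨o0, Finset.mem_univ _, mul_lt_mul_of_pos_left (hcon o0) ho0⟩
      rw [← Finset.sum_mul, hw1] at this
      linarith
    refine ⟨Fin.cons o g, ?_⟩
    have e1 : B = 4 * YY.card * Real.exp ((k + 1 : ℕ) * (l * (2 * n)) ^ 2) := by
      rw [hB, mul_assoc, ← Real.exp_add]; congr 2; push_cast; ring
    rw [← e1]
    refine le_of_eq_of_le ?_ ho
    apply Finset.sum_congr rfl; intro y _
    apply Finset.sum_congr rfl; intro t _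
    rw [hE, ← Real.exp_add, Fin.sum_univ_succ]
    simp only [Fin.cons_zero, Fin.cons_succ]
    rw [mul_add, Complex.add_re]
    congr 1
    ring

variable {G : Type} [AddCommGroup G] [DecidableEq G] [Fintype G]

/-- Fourier series with coefficients `c`. -/
noncomputable def fs (c : AddChar G ℂ → ℂ) (x : G) : ℂ := ∑ γ, c γ * γ x

theorem phase_exists (z : ℂ) : ∃ p : ℂ, ‖p‖ = 1 ∧ z = ‖z‖ * p := by
  by_cases h : z = 0
  · exact ⟨1, by simp, by simp [h]⟩
  · have : (‖z‖ : ℂ) ≠ 0 := by simpa using h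
    refine ⟨z / ‖z‖, ?_, ?_⟩
    · rw [norm_div]; simp [h]
    · field_simp

/-- Lemma A -/
theorem sampling (c : AddChar G ℂ → ℂ) (n : ℝ) (hn : 1 ≤ n) (hc : ∑ γ, ‖c γ‖ ≤ n)
    (Y : Finset G) (k : ℕ) (hk : 1 ≤ k) :
    ∃ (g : Fin k → AddChar G ℂ) (ω : Fin k → ℂ) (Bad : Finset G), (∀ i, ‖ω i‖ ≤ n) ∧ Bad ⊆ Y ∧
      (Bad.card : ℝ) ≤ 4 * Real.exp (-(k / (6400 * n ^ 2))) * Y.card ∧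
      ∀ y ∈ Y, y ∉ Bad → ‖fs c y - (1 / k) * ∑ i, ω i * g i y‖ ≤ 1 / 10 := by
  classical
  choose ph hph1 hph2 using fun γ => phase_exists (c γ)
  let w : Option (AddChar G ℂ) → ℝ := fun o => o.elim (1 - (∑ γ, ‖c γ‖) / n) (fun γ => ‖c γ‖ / n)
  let om : Option (AddChar G ℂ) → ℂ := fun o => o.elim 0 (fun γ => n * ph γ)
  let ch : Option (AddChar G ℂ) → AddChar G ℂ := fun o => o.elim 1 id
  have hn0 : (0 : ℝ) < n := by linarith
  have hom : ∀ o, ‖om o‖ ≤ n := by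
    rintro (_ | γ)
    · simp [om]; linarith
    · simp [om, hph1, abs_of_pos hn0]
  obtain ⟨g, hg⟩ := sampling_abs Y w
    (by
      rintro (_ | γ)
      · simp only [w, Option.elim]
        rw [sub_nonneg, div_le_one hn0]; exact hc
      · simp only [w, Option.elim]; positivity)
    (by
      rw [Fintype.sum_option]
      simp only [w, Option.elim]
      rw [← Finset.sum_div]; ring)
    n (fun o y => om o * ch o y)
    (by
      intro o y
      rw [norm_mul, AddChar.norm_apply, mul_one]; exact hom o)
    (1 / (160 * n ^ 2)) (by positivity)
    (by
      rw [div_mul_eq_mul_div, div_le_one (by positivity)]; nlinarith) k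
  have hf : ∀ y, ∑ o, (w o : ℂ) * (om o * ch o y) = fs c y := by
    intro y
    rw [Fintype.sum_option, fs]
    simp only [w, om, ch, Option.elim, zero_mul, mul_zero, zero_add, id]
    apply Finset.sum_congr rfl
    intro γ _
    have hnc : (n : ℂ) ≠ 0 := by exact_mod_cast hn0.ne'
    conv_rhs => rw [hph2 γ]
    push_cast
    field_simp
  simp only [hf] at hg
  let P : G → Prop := fun y => 1 / 10 < ‖fs c y - (1 / k) * ∑ i, om (g i) * ch (g i) y‖
  have hk0 : (0 : ℝ) < k := by exact_mod_cast hk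
  refine ⟨fun i => ch (g i), fun i => om (g i), Y.filter P, fun i => hom _,
    Finset.filter_subset _ _, ?_, ?_⟩
  · have h1 : ((Y.filter P).card : ℝ) * Real.exp (k / (3200 * n ^ 2)) ≤
        ∑ y ∈ Y, ∑ t, Real.exp (1 / (160 * n ^ 2) *
          (th t * ∑ i, (fs c y - om (g i) * ch (g i) y)).re) := by
      calc _ = ∑ y ∈ Y.filter P, Real.exp (k / (3200 * n ^ 2)) := by
            rw [Finset.sum_const, nsmul_eq_mul]
        _ ≤ ∑ y ∈ Y.filter P, ∑ t, Real.exp (1 / (160 * n ^ 2) *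
          (th t * ∑ i, (fs c y - om (g i) * ch (g i) y)).re) := by
            apply Finset.sum_le_sum
            intro y hy
            have hy2 : 1 / 10 < ‖fs c y - (1 / k) * ∑ i, om (g i) * ch (g i) y‖ :=
              (Finset.mem_filter.1 hy).2
            have e : ∑ i, (fs c y - om (g i) * ch (g i) y) =
                k * (fs c y - (1 / k) * ∑ i, om (g i) * ch (g i) y) := by
              have hkc : (k : ℂ) ≠ 0 := by exact_mod_cast hk0.ne'
              rw [Finset.sum_sub_distrib, Finset.sum_const]
              simp only [Finset.card_univ, Fintype.card_fin, nsmul_eq_mul]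
              field_simp
            obtain ⟨t, ht⟩ := th_dir (∑ i, (fs c y - om (g i) * ch (g i) y)) (k / 20) (by
              rw [e, norm_mul, Complex.norm_natCast]
              nlinarith)
            refine le_trans ?_ (Finset.single_le_sum (f := fun t => Real.exp (1 / (160 * n ^ 2) *
              (th t * ∑ i, (fs c y - om (g i) * ch (g i) y)).re))
              (fun t _ => (Real.exp_pos _).le) (Finset.mem_univ t))
            apply Real.exp_le_exp.2
            calc (k : ℝ) / (3200 * n ^ 2) = 1 / (160 * n ^ 2) * (k / 20) := by field_simp; norm_num
              _ ≤ _ := mul_le_mul_of_nonneg_left ht (by positivity)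
        _ ≤ _ := by
            apply Finset.sum_le_sum_of_subset_of_nonneg (Finset.filter_subset _ _)
            intro y _ _
            exact Finset.sum_nonneg (fun t _ => (Real.exp_pos _).le)
    have h2 := h1.trans hg
    have e2 : (k : ℝ) * (1 / (160 * n ^ 2) * (2 * n)) ^ 2 = k / (6400 * n ^ 2) := by
      field_simp; norm_num
    rw [e2] at h2
    have e3 : Real.exp ((k : ℝ) / (3200 * n ^ 2)) =
        Real.exp (k / (6400 * n ^ 2)) * Real.exp (k / (6400 * n ^ 2)) := by
      rw [← Real.exp_add]; congr 1; field_simp; norm_num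
    rw [e3, ← mul_assoc] at h2
    have h3 := le_of_mul_le_mul_right h2 (Real.exp_pos _)
    rw [Real.exp_neg]
    have hE := Real.exp_pos ((k : ℝ) / (6400 * n ^ 2))
    calc _ = ((Y.filter P).card : ℝ) * Real.exp (k / (6400 * n ^ 2)) *
            (Real.exp (k / (6400 * n ^ 2)))⁻¹ := by
              rw [mul_assoc, mul_inv_cancel₀ hE.ne', mul_one]
      _ ≤ 4 * Y.card * (Real.exp (k / (6400 * n ^ 2)))⁻¹ :=
          mul_le_mul_of_nonneg_right h3 (by positivity)
      _ = _ := by ring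
  · intro y hy hyb
    by_contra! h
    exact hyb (Finset.mem_filter.2 ⟨hy, h⟩)

end Part2

section Part3

variable {G : Type} [AddCommGroup G] [DecidableEq G]

theorem petridis (S B : Finset G) (hS : S.Nonempty) (K : ℝ)
    (hK : ((S + B).card : ℝ) ≤ K * S.card) :
    ∃ R ⊆ S, R.Nonempty ∧ ∀ j, ((R + ms j B).card : ℝ) ≤ K ^ j * R.card := by
  obtain ⟨R, hR, hmin⟩ := Finset.exists_min_image (S.powerset.erase ∅)
    (fun R => ((R + B).card : ℝ) / R.card) ⟨S, by simp [hS.ne_empty]⟩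
  rw [Finset.mem_erase, Finset.mem_powerset] at hR
  have hRne : R.Nonempty := Finset.nonempty_iff_ne_empty.2 hR.1
  have hRc : (0 : ℝ) < R.card := by exact_mod_cast hRne.card_pos
  have hSc : (0 : ℝ) < S.card := by exact_mod_cast hS.card_pos
  have hR1 : ((R + B).card : ℝ) / R.card ≤ K := by
    refine (hmin S (by simp [hS.ne_empty])).trans ?_
    rwa [div_le_iff₀ hSc]
  have hA : ∀ A' ⊆ R, (R + B).card * A'.card ≤ (A' + B).card * R.card := by
    intro A' hA'
    rcases A'.eq_empty_or_nonempty with rfl | hne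
    · simp
    · have h := hmin A' (by
        rw [Finset.mem_erase, Finset.mem_powerset]
        exact ⟨hne.ne_empty, hA'.trans hR.2⟩)
      have hc : (0 : ℝ) < A'.card := by exact_mod_cast hne.card_pos
      rw [div_le_div_iff₀ hRc hc] at h
      exact_mod_cast h
  refine ⟨R, hR.2, hRne, ?_⟩
  have hK0 : 0 ≤ K := le_trans (by positivity) hR1
  intro j
  induction j with
  | zero => rw [ms_zero]; simp
  | succ j ih =>
    have h := Finset.pluennecke_petridis_inequality_add (ms j B) hA
    have h' : ((R + ms (j + 1) B).card : ℝ) * R.card ≤ (R + B).card * (R + ms j B).card := by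
      have e : R + ms (j + 1) B = ms j B + R + B := by
        rw [ms_succ]; rw [add_comm B, ← add_assoc, add_comm R]
      rw [e, add_comm R (ms j B)]
      exact_mod_cast h
    rw [div_le_iff₀ hRc] at hR1
    have h2 : ((R + B).card : ℝ) * (R + ms j B).card ≤ (K * R.card) * (K ^ j * R.card) :=
      mul_le_mul hR1 ih (by positivity) (by positivity)
    have h3 : ((R + ms (j + 1) B).card : ℝ) * R.card ≤ (K ^ (j + 1) * R.card) * R.card := by
      refine h'.trans (h2.trans (le_of_eq ?_)); ring
    exact le_of_mul_le_mul_right h3 hRc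

/-- Lemma C -/
theorem plunnecke_removal (X B : Finset G) (K : ℝ) (hK0 : 0 ≤ K)
    (hK : ((X + B).card : ℝ) ≤ K * X.card) :
    ∃ R ⊆ X, X.card ≤ 2 * R.card ∧ ∀ j, ((R + ms j B).card : ℝ) ≤ (2 * K) ^ j * R.card := by
  classical
  obtain ⟨R, hR, hmax⟩ := Finset.exists_max_image
    (X.powerset.filter (fun R => ∀ j, ((R + ms j B).card : ℝ) ≤ (2 * K) ^ j * R.card))
    Finset.card ⟨∅, by simp⟩
  rw [Finset.mem_filter, Finset.mem_powerset] at hR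
  refine ⟨R, hR.1, ?_, hR.2⟩
  by_contra! hcon
  have hsd : (X \ R).card + R.card = X.card := Finset.card_sdiff_add_card_eq_card hR.1
  have hne : (X \ R).Nonempty := by rw [← Finset.card_pos]; omega
  obtain ⟨T, hT, hTne, hTj⟩ := petridis (X \ R) B hne (2 * K) (by
    have h1 : ((X \ R + B).card : ℝ) ≤ (X + B).card := by
      exact_mod_cast Finset.card_le_card (Finset.add_subset_add_right Finset.sdiff_subset)
    have h2 : (X.card : ℝ) ≤ 2 * (X \ R).card := by
      have : X.card ≤ 2 * (X \ R).card := by omega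
      exact_mod_cast this
    nlinarith)
  have hdis : Disjoint R T := by
    rw [Finset.disjoint_left]
    intro a ha hat
    exact (Finset.mem_sdiff.1 (hT hat)).2 ha
  have := hmax (R ∪ T) (by
    rw [Finset.mem_filter, Finset.mem_powerset]
    refine ⟨Finset.union_subset hR.1 (hT.trans Finset.sdiff_subset), ?_⟩
    intro j
    rw [Finset.union_add, Finset.card_union_of_disjoint hdis]
    have h1 : (((R + ms j B) ∪ (T + ms j B)).card : ℝ) ≤ (R + ms j B).card + (T + ms j B).card := by
      exact_mod_cast Finset.card_union_le _ _
    have h2 := hR.2 j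
    have h3 := hTj j
    push_cast
    linarith)
  rw [Finset.card_union_of_disjoint hdis] at this
  have := hTne.card_pos
  omega

end Part3

section Part4

variable {G : Type} [AddCommGroup G] [DecidableEq G] [Fintype G]

theorem int_eq_of_close {a b : ℤ} (h : ‖(a : ℂ) - b‖ < 1) : a = b := by
  have : ‖((a - b : ℤ) : ℂ)‖ < 1 := by push_cast; exact h
  rw [Complex.norm_intCast] at this
  have h2 : |a - b| < 1 := by exact_mod_cast this
  have := Int.abs_lt_one_iff.1 h2
  omega

theorem sample_shift {k : ℕ} (hk : 1 ≤ k) (g : Fin k → AddChar G ℂ) (ω : Fin k → ℂ) (n : ℝ)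
    (hn : 1 ≤ n)
    (hω : ∀ i, ‖ω i‖ ≤ n) (y u : G) (hu : ∀ i, ‖1 - g i u‖ ≤ 1 / (10 * n)) :
    ‖(1 / (k : ℂ)) * ∑ i, ω i * g i (y + u) - (1 / (k : ℂ)) * ∑ i, ω i * g i y‖ ≤ 1 / 10 := by
  have hk0 : (0 : ℝ) < k := by exact_mod_cast hk
  rw [← mul_sub, ← Finset.sum_sub_distrib, norm_mul]
  have h1 : ‖∑ i, (ω i * g i (y + u) - ω i * g i y)‖ ≤ ∑ i : Fin k, (1 / 10 : ℝ) := by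
    refine (norm_sum_le _ _).trans (Finset.sum_le_sum ?_)
    intro i _
    have : ω i * g i (y + u) - ω i * g i y = - (ω i * g i y * (1 - g i u)) := by
      rw [AddChar.map_add_eq_mul]; ring
    rw [this, norm_neg, norm_mul, norm_mul, AddChar.norm_apply, mul_one]
    calc ‖ω i‖ * ‖1 - g i u‖ ≤ n * (1 / (10 * n)) :=
          mul_le_mul (hω i) (hu i) (norm_nonneg _) (by linarith)
      _ = 1 / 10 := by field_simp
  rw [Finset.sum_const, Finset.card_univ, Fintype.card_fin, nsmul_eq_mul] at h1
  rw [norm_div, norm_one, Complex.norm_natCast]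
  calc 1 / (k : ℝ) * _ ≤ 1 / (k : ℝ) * (k * (1 / 10)) :=
        mul_le_mul_of_nonneg_left h1 (by positivity)
    _ = 1 / 10 := by field_simp

set_option maxHeartbeats 1000000 in
/-- Lemma D, one level -/
theorem level (c : AddChar G ℂ → ℂ) (n : ℕ) (hn : 1 ≤ n) (hc : ∑ γ, ‖c γ‖ ≤ n)
    (fZ : G → ℤ) (hf : ∀ x, ‖fs c x - fZ x‖ ≤ 1 / 10) (A : Finset G)
    (hA : ∀ x, x ∈ A ↔ fZ x ≠ 0) (X Q : Finset G) (hXA : X ⊆ A) (hX : X.Nonempty) (hQ : Sym0 Q)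
    (N : ℕ) (hN : 1 ≤ N) (K : ℝ) (hK1 : 1 ≤ K) (hK : ((X + ms N Q).card : ℝ) ≤ K * X.card) :
    ∃ (J : ℕ) (X' T : Finset G), X' ⊆ A ∧ Sym0 T ∧
      ((X' + ms (2 * N) T).card : ℝ) ≤ 5 * X'.card ∧
      2 ^ J * (X.card : ℝ) ≤ 4 * X'.card ∧
      (Q.card : ℝ) ≤ Real.exp (2 * 6400 * n ^ 2 * (J + 1) * (16 * Real.log (2 * K) + 4)
        * Real.log (81 * n * N)) * T.card := by
  classical
  set B := ms N Q with hB
  have hBs : Sym0 B := hQ.ms N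
  obtain ⟨R, hRX, hRc, hRj⟩ := plunnecke_removal X B K (by linarith) hK
  have hXc := hX.card_pos
  have hRpos : 0 < R.card := by omega
  have hRr : (0 : ℝ) < R.card := by exact_mod_cast hRpos
  let P : ℕ → Prop := fun J => ∃ Z ⊆ A, Z ⊆ R + ms (8 * J) B ∧ 2 ^ J * R.card ≤ Z.card
  have hPb : ∀ J, P J → J ≤ Fintype.card G := by
    rintro J ⟨Z, _, _, hZ⟩
    have h1 : Z.card ≤ Fintype.card G := Finset.card_le_univ Z
    have h2 : J < 2 ^ J := Nat.lt_two_pow_self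
    nlinarith
  have hP0 : P 0 := ⟨R, hRX.trans hXA, by simpa using subset_add_of_zero (zero_mem_ms hBs.1 0), by simp⟩
  set J := Nat.findGreatest P (Fintype.card G) with hJ
  have hPJ : P J := Nat.findGreatest_spec (P := P) (Nat.zero_le _) hP0
  have hmax : ∀ J', J < J' → ¬ P J' := by
    intro J' hJ' hPJ'
    have := Nat.le_findGreatest (P := P) (hPb J' hPJ') hPJ'
    omega
  obtain ⟨Z, hZA, hZR, hZc⟩ := hPJ
  set Y := R + ms (16 * J + 8) B with hY
  set p : ℝ := (16 * J + 8) * Real.log (2 * K) + 3 with hp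
  have hlog : 0 ≤ Real.log (2 * K) := Real.log_nonneg (by linarith)
  have hp3 : 3 ≤ p := by
    have : 0 ≤ (16 * (J : ℝ) + 8) * Real.log (2 * K) := by positivity
    linarith
  have hnr : (1 : ℝ) ≤ n := by exact_mod_cast hn
  set k := ⌈6400 * (n : ℝ) ^ 2 * p⌉₊ with hk
  have hkp : 6400 * (n : ℝ) ^ 2 * p ≤ k := Nat.le_ceil _
  have hkp2 : (k : ℝ) < 6400 * (n : ℝ) ^ 2 * p + 1 := Nat.ceil_lt_add_one (by positivity)
  have hk1 : 1 ≤ k := by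
    have : (0 : ℝ) < k := lt_of_lt_of_le (by positivity) hkp
    exact_mod_cast this
  obtain ⟨g, ω, Bad, hω, hBadY, hBadc, hgood⟩ := sampling c n hnr hc Y k hk1
  have hBad : (Bad.card : ℝ) ≤ R.card / 2 := by
    have h1 : (Y.card : ℝ) ≤ Real.exp (p - 3) * R.card := by
      refine (hRj _).trans (le_of_eq ?_)
      congr 1
      rw [hp, add_sub_cancel_right, ← Real.exp_log (show 0 < 2 * K by linarith), ← Real.exp_nat_mul,
        Real.exp_log (show 0 < 2 * K by linarith)]
      push_cast; ring_nf
    have h2 : Real.exp (-(k / (6400 * (n : ℝ) ^ 2))) ≤ Real.exp (-p) := by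
      apply Real.exp_le_exp.2
      rw [neg_le_neg_iff, le_div_iff₀ (by positivity)]; linarith
    have h3 : Real.exp (-p) * Real.exp (p - 3) ≤ 1 / 8 := by
      rw [← Real.exp_add, show -p + (p - 3) = -3 by ring, Real.exp_neg, ← one_div]
      apply one_div_le_one_div_of_le (by norm_num)
      have := Real.exp_one_gt_d9
      have e : Real.exp 3 = Real.exp 1 ^ 3 := by rw [← Real.exp_nat_mul]; norm_num
      rw [e]
      calc (8 : ℝ) = 2 ^ 3 := by norm_num
        _ ≤ _ := pow_le_pow_left₀ (by norm_num) (by linarith) 3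
    calc (Bad.card : ℝ) ≤ 4 * Real.exp (-(k / (6400 * (n : ℝ) ^ 2))) * Y.card := hBadc
      _ ≤ 4 * Real.exp (-p) * (Real.exp (p - 3) * R.card) := by gcongr
      _ = 4 * (Real.exp (-p) * Real.exp (p - 3)) * R.card := by ring
      _ ≤ 4 * (1 / 8) * R.card := by gcongr
      _ = _ := by ring
  -- cells
  set L := 20 * n * N with hL
  have hn0 : 0 < n := hn
  have hN0 : 0 < N := hN
  have hL1 : 1 ≤ L := Nat.succ_le_of_lt (by rw [hL]; positivity)
  obtain ⟨S', hS'Q, hS'c, hS'g⟩ := cells g L hL1 Q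
  have hQpos : 0 < Q.card := Finset.card_pos.2 ⟨0, hQ.1⟩
  have hS'ne : S'.Nonempty := by
    rw [← Finset.card_pos]
    by_contra! h
    have : S'.card = 0 := by omega
    rw [this] at hS'c; omega
  set T := S' - S' with hT
  have hTs : Sym0 T := sym0_sub hS'ne
  have hTQ : T ⊆ ms 2 Q := by
    intro x hx
    obtain ⟨a, ha, b, hb, rfl⟩ := Finset.mem_sub.1 hx
    rw [show 2 = 1 + 1 from rfl, ms_add, ms_one, sub_eq_add_neg]
    exact Finset.add_mem_add (hS'Q ha) (hQ.2 _ (hS'Q hb))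
  set B' := ms (2 * N) T with hB'
  have hB's : Sym0 B' := hTs.ms _
  have hB'B : B' ⊆ ms 4 B := by
    refine (ms_mono hTQ _).trans ?_
    rw [← ms_mul, hB, ← ms_mul, show 2 * N * 2 = 4 * N by ring]
  have hB'g : ∀ u ∈ B', ∀ i, ‖1 - g i u‖ ≤ 1 / (10 * n) := by
    intro u hu i
    have h1 : ∀ t ∈ T, ‖1 - g i t‖ ≤ 1 / L := by
      intro t ht
      obtain ⟨a, ha, b, hb, rfl⟩ := Finset.mem_sub.1 ht
      exact hS'g a ha b hb i
    refine (char_ms_bound (g i) h1 _ u hu).trans (le_of_eq ?_)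
    rw [hL]
    have : (0 : ℝ) < N := by exact_mod_cast hN
    push_cast
    field_simp; norm_num
  let W : ℕ → Finset G := fun i => ((Z + ms i B') ∩ A) \ Bad
  have hWmono : ∀ i, W 0 ⊆ W i := by
    intro i
    apply Finset.sdiff_subset_sdiff _ le_rfl
    apply Finset.inter_subset_inter_right
    exact Finset.add_subset_add_left (ms_mono_left hB's.1 (Nat.zero_le _))
  have hW0 : 2 ^ J * (R.card : ℝ) - R.card / 2 ≤ (W 0).card := by
    have h1 : Z \ Bad ⊆ W 0 := by
      apply Finset.sdiff_subset_sdiff _ le_rfl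
      apply Finset.subset_inter _ hZA
      exact subset_add_of_zero (zero_mem_ms hB's.1 0)
    have h2 := Finset.card_le_card h1
    have h3 := Finset.le_card_sdiff Bad Z
    have h4 : (Z.card : ℝ) - Bad.card ≤ (W 0).card := by
      have : Z.card ≤ (W 0).card + Bad.card := by omega
      have : (Z.card : ℝ) ≤ (W 0).card + Bad.card := by exact_mod_cast this
      linarith
    have h5 : (2 : ℝ) ^ J * R.card ≤ Z.card := by exact_mod_cast hZc
    linarith
  have hpow : (1 : ℝ) ≤ 2 ^ J := one_le_pow₀ (by norm_num)
  have hRR : (R.card : ℝ) ≤ 2 ^ J * R.card := le_mul_of_one_le_left hRr.le hpow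
  have hW0b : 2 ^ J * (R.card : ℝ) ≤ 2 * (W 0).card := by linarith
  have hW0c : (R.card : ℝ) / 2 ≤ (W 0).card := by linarith
  have hWsub : ∀ i, W i ⊆ R + ms (8 * J + 4 * i) B := by
    intro i x hx
    have h1 : x ∈ Z + ms i B' := Finset.inter_subset_left (Finset.sdiff_subset hx)
    rw [ms_add, ← add_assoc]
    refine Finset.add_subset_add hZR ?_ h1
    refine (ms_mono hB'B i).trans ?_
    rw [← ms_mul, mul_comm]
  have hstep : ∀ i, i ≤ J → W i + B' ⊆ W (i + 1) ∪ Bad := by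
    intro i hi x hx
    obtain ⟨z, hz, u, hu, rfl⟩ := Finset.mem_add.1 hx
    by_cases hb : z + u ∈ Bad
    · exact Finset.mem_union_right _ hb
    apply Finset.mem_union_left
    have hzW := hWsub i hz
    have hzY : z ∈ Y := by
      refine Finset.add_subset_add_left (ms_mono_left hBs.1 ?_) hzW
      omega
    have hzuY : z + u ∈ Y := by
      have h1 : z + u ∈ R + ms (8 * J + 4 * i + 4) B := by
        rw [ms_add _ 4, ← add_assoc]
        exact Finset.add_mem_add hzW (hB'B hu)
      refine Finset.add_subset_add_left (ms_mono_left hBs.1 ?_) h1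
      omega
    have hzb : z ∉ Bad := (Finset.mem_sdiff.1 hz).2
    have hzA : z ∈ A := (Finset.mem_inter.1 (Finset.mem_sdiff.1 hz).1).2
    have hzZ : z ∈ Z + ms i B' := (Finset.mem_inter.1 (Finset.mem_sdiff.1 hz).1).1
    have e1 := hgood z hzY hzb
    have e2 := hgood (z + u) hzuY hb
    have e3 := sample_shift hk1 g ω n hnr hω z u (hB'g u hu)
    have e4 := hf z
    have e5 := hf (z + u)
    have heq : fZ (z + u) = fZ z := by
      apply int_eq_of_close
      set F1 := (1 / (k : ℂ)) * ∑ i, ω i * g i (z + u)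
      set F0 := (1 / (k : ℂ)) * ∑ i, ω i * g i z
      have : (fZ (z + u) : ℂ) - fZ z = -(fs c (z + u) - fZ (z + u)) + (fs c (z + u) - F1) + (F1 - F0)
        + -(fs c z - F0) + (fs c z - fZ z) := by ring
      rw [this]
      calc _ ≤ ‖-(fs c (z + u) - fZ (z + u))‖ + ‖fs c (z + u) - F1‖ + ‖F1 - F0‖ + ‖-(fs c z - F0)‖
            + ‖fs c z - fZ z‖ := by
            refine (norm_add_le _ _).trans ?_; gcongr
            refine (norm_add_le _ _).trans ?_; gcongr
            refine (norm_add_le _ _).trans ?_; gcongr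
            exact norm_add_le _ _
        _ < 1 := by rw [norm_neg, norm_neg]; linarith
    show z + u ∈ ((Z + ms (i + 1) B') ∩ A) \ Bad
    rw [Finset.mem_sdiff, Finset.mem_inter]
    refine ⟨⟨?_, ?_⟩, hb⟩
    · rw [ms_add, ms_one, ← add_assoc]
      exact Finset.add_mem_add hzZ hu
    · rw [hA, heq, ← hA]; exact hzA
  have hex : ∃ i, i ≤ J ∧ (W (i + 1)).card ≤ 4 * (W i).card := by
    by_contra! hcon
    have hgrow : ∀ i, i ≤ J + 1 → 4 ^ i * (W 0).card ≤ (W i).card := by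
      intro i
      induction i with
      | zero => intro _; simp
      | succ i ih =>
        intro hi
        have h1 := ih (by omega)
        have h2 := hcon i (by omega)
        rw [pow_succ]; linarith
    have h1 := hgrow (J + 1) le_rfl
    apply hmax (2 * J + 1) (by omega)
    refine ⟨W (J + 1), ?_, ?_, ?_⟩
    · exact fun x hx => (Finset.mem_inter.1 (Finset.mem_sdiff.1 hx).1).2
    · refine (hWsub (J + 1)).trans (Finset.add_subset_add_left (ms_mono_left hBs.1 ?_))
      omega
    · have h2 : 2 ^ J * R.card ≤ 2 * (W 0).card := by exact_mod_cast hW0b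
      have h3 : 4 ^ (J + 1) = 2 * 2 ^ (2 * J + 1) := by
        rw [show 4 = 2 ^ 2 by norm_num, ← pow_mul]; ring
      rw [h3] at h1
      have h5 : 1 ≤ 2 ^ J := Nat.one_le_two_pow
      have h6 : R.card ≤ 2 * (W 0).card := le_trans (Nat.le_mul_of_pos_left _ (by positivity)) h2
      calc 2 ^ (2 * J + 1) * R.card ≤ 2 ^ (2 * J + 1) * (2 * (W 0).card) := by gcongr
        _ = 2 * 2 ^ (2 * J + 1) * (W 0).card := by ring
        _ ≤ _ := h1
  obtain ⟨i, hiJ, hi⟩ := hex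
  have hWi : ((W 0).card : ℝ) ≤ (W i).card := by exact_mod_cast Finset.card_le_card (hWmono i)
  refine ⟨J, W i, T, ?_, hTs, ?_, ?_, ?_⟩
  · exact fun x hx => (Finset.mem_inter.1 (Finset.mem_sdiff.1 hx).1).2
  · have h1 := (Finset.card_le_card (hstep i hiJ)).trans (Finset.card_union_le _ _)
    have h2 : ((W i + B').card : ℝ) ≤ (W (i + 1)).card + Bad.card := by exact_mod_cast h1
    have h3 : ((W (i + 1)).card : ℝ) ≤ 4 * (W i).card := by exact_mod_cast hi
    linarith
  · have : (X.card : ℝ) ≤ 2 * R.card := by exact_mod_cast hRc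
    have h7 : (2 : ℝ) ^ J * X.card ≤ 2 ^ J * (2 * R.card) :=
      mul_le_mul_of_nonneg_left this (by linarith)
    linarith
  · have hST : (S'.card : ℝ) ≤ T.card := by
      exact_mod_cast Finset.card_le_card_sub_right hS'ne
    have hNr : (1 : ℝ) ≤ N := by exact_mod_cast hN
    have hnN : (1 : ℝ) ≤ n * N := one_le_mul_of_one_le_of_one_le hnr hNr
    have h1 : (Q.card : ℝ) ≤ ((4 * L + 1 : ℝ) ^ 2) ^ k * S'.card := by
      rw [Fintype.card_fin] at hS'c
      exact_mod_cast hS'c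
    have h2 : ((4 * L + 1 : ℝ) ^ 2) ^ k ≤ Real.exp (2 * k * Real.log (81 * n * N)) := by
      rw [← pow_mul, show 2 * (k : ℝ) * Real.log (81 * n * N) = ((2 * k : ℕ) : ℝ) * Real.log (81 * n * N) by
        push_cast; ring, Real.exp_nat_mul, Real.exp_log (by positivity)]
      apply pow_le_pow_left₀ (by positivity)
      rw [hL]; push_cast; linarith
    have hk2 : (k : ℝ) ≤ 6400 * n ^ 2 * (J + 1) * (16 * Real.log (2 * K) + 4) := by
      have hn2 : (1 : ℝ) ≤ (n : ℝ) ^ 2 := one_le_pow₀ hnr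
      have hJ0 : (0 : ℝ) ≤ J := by positivity
      have h3 : p + 1 ≤ (J + 1) * (16 * Real.log (2 * K) + 4) := by
        rw [hp]
        have := mul_nonneg hJ0 hlog
        linarith
      calc (k : ℝ) ≤ 6400 * (n : ℝ) ^ 2 * p + 1 := hkp2.le
        _ ≤ 6400 * (n : ℝ) ^ 2 * (p + 1) := by linarith
        _ ≤ 6400 * (n : ℝ) ^ 2 * ((J + 1) * (16 * Real.log (2 * K) + 4)) := by gcongr
        _ = _ := by ring
    have hlg : 0 ≤ Real.log (81 * n * N) := Real.log_nonneg (by linarith)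
    calc (Q.card : ℝ) ≤ ((4 * L + 1 : ℝ) ^ 2) ^ k * S'.card := h1
      _ ≤ Real.exp (2 * k * Real.log (81 * n * N)) * T.card := by gcongr
      _ ≤ _ := by
        apply mul_le_mul_of_nonneg_right _ (Nat.cast_nonneg _)
        apply Real.exp_le_exp.2
        apply mul_le_mul_of_nonneg_right _ hlg
        calc 2 * (k : ℝ) ≤ 2 * (6400 * n ^ 2 * (J + 1) * (16 * Real.log (2 * K) + 4)) := by linarith
          _ = _ := by ring

end Part4

section Part5

variable {G : Type} [AddCommGroup G] [DecidableEq G] [Fintype G]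

theorem log_ten_bound : 16 * Real.log (2 * 5) + 4 ≤ 44 := by
  have : Real.log (2 * 5) ≤ (5 / 2) := by
    rw [Real.log_le_iff_le_exp (by norm_num)]
    have h := Real.exp_one_gt_d9
    have e : Real.exp (5 / 2) ^ 2 = Real.exp 1 ^ 5 := by
      rw [← Real.exp_nat_mul, ← Real.exp_nat_mul]; norm_num
    have h2 : (2.718 : ℝ) ^ 5 ≤ Real.exp 1 ^ 5 := pow_le_pow_left₀ (by norm_num) (by linarith) 5
    have h3 : (100 : ℝ) ≤ Real.exp (5 / 2) ^ 2 := by rw [e]; refine le_trans ?_ h2; norm_num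
    have h4 := Real.exp_pos (5 / 2)
    by_contra! h5
    have : Real.exp (5 / 2) ^ 2 < 10 ^ 2 := pow_lt_pow_left₀ (by linarith) h4.le (by norm_num)
    linarith
  norm_num at this ⊢
  linarith

theorem pow_two_le_log {S : ℕ} {x : ℝ} (hx : 1 ≤ x) (h : (2 : ℝ) ^ S ≤ x) :
    (S : ℝ) ≤ 2 * Real.log x := by
  have h1 := Real.log_le_log (by positivity) h
  rw [Real.log_pow] at h1
  have := Real.log_two_gt_d9
  have : (S : ℝ) * (1 / 2) ≤ S * Real.log 2 := by gcongr; linarith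
  linarith

theorem levels_aux (c : AddChar G ℂ → ℂ) (n : ℕ) (hn : 1 ≤ n) (hc : ∑ γ, ‖c γ‖ ≤ n)
    (fZ : G → ℤ) (hf : ∀ x, ‖fs c x - fZ x‖ ≤ 1 / 10) (A : Finset G)
    (hA : ∀ x, x ∈ A ↔ fZ x ≠ 0) (X Q : Finset G) (hXA : X ⊆ A) (hX : X.Nonempty) (hQ : Sym0 Q)
    (hK : ((X + ms 2 Q).card : ℝ) ≤ 5 * X.card) (Lv : ℕ) :
    ∀ i, 1 ≤ i → i ≤ Lv → ∃ (S : ℕ) (X' T : Finset G), X' ⊆ A ∧ X'.Nonempty ∧ Sym0 T ∧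
      ((X' + ms (2 ^ i) T).card : ℝ) ≤ 5 * X'.card ∧
      2 ^ S * (X.card : ℝ) ≤ 8 ^ i * X'.card ∧
      (Q.card : ℝ) ≤ Real.exp (2 * 6400 * n ^ 2 * S * 44
        * Real.log (81 * n * 2 ^ Lv)) * T.card := by
  intro i hi
  induction i, hi using Nat.le_induction with
  | base =>
    intro _
    refine ⟨0, X, Q, hXA, hX, hQ, by simpa using hK, ?_, ?_⟩
    · have : (0 : ℝ) ≤ X.card := by positivity
      simp; linarith
    · simp
  | succ i hi ih =>
    intro hiL
    obtain ⟨S, X1, T, hX1A, hX1, hT, h1, h2, h3⟩ := ih (by omega)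
    obtain ⟨J, X', T', hX'A, hT', h1', h2', h3'⟩ :=
      level c n hn hc fZ hf A hA X1 T hX1A hX1 hT (2 ^ i) Nat.one_le_two_pow 5 (by norm_num) h1
    have hX1c : (0 : ℝ) < X1.card := by exact_mod_cast hX1.card_pos
    refine ⟨S + J + 1, X', T', hX'A, ?_, hT', ?_, ?_, ?_⟩
    · rw [← Finset.card_pos]
      have : (0 : ℝ) < X'.card := by
        have : (0 : ℝ) < 2 ^ J * X1.card := by positivity
        linarith
      exact_mod_cast this
    · rw [pow_succ, mul_comm]; exact h1'
    · calc (2 : ℝ) ^ (S + J + 1) * X.card = 2 ^ (J + 1) * (2 ^ S * X.card) := by ring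
        _ ≤ 2 ^ (J + 1) * (8 ^ i * X1.card) := by gcongr
        _ = 2 * 8 ^ i * (2 ^ J * X1.card) := by ring
        _ ≤ 2 * 8 ^ i * (4 * X'.card) := by gcongr
        _ = _ := by ring
    · have hnr : (1 : ℝ) ≤ n := by exact_mod_cast hn
      have hpos : (0 : ℝ) < n := by linarith
      have hlog : Real.log (81 * n * (2 ^ i : ℕ)) ≤ Real.log (81 * n * 2 ^ Lv) := by
        push_cast
        apply Real.log_le_log (by positivity)
        gcongr
        · norm_num
        · omega
      have hlog0 : 0 ≤ Real.log (81 * n * (2 ^ i : ℕ)) := by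
        apply Real.log_nonneg
        push_cast
        have : (1 : ℝ) ≤ 2 ^ i := one_le_pow₀ (by norm_num)
        nlinarith
      calc (Q.card : ℝ) ≤ Real.exp (2 * 6400 * n ^ 2 * S * 44
            * Real.log (81 * n * 2 ^ Lv)) * T.card := h3
        _ ≤ Real.exp (2 * 6400 * n ^ 2 * S * 44 * Real.log (81 * n * 2 ^ Lv)) *
            (Real.exp (2 * 6400 * n ^ 2 * (J + 1) * (16 * Real.log (2 * 5) + 4)
            * Real.log (81 * n * (2 ^ i : ℕ))) * T'.card) := by gcongr
        _ ≤ Real.exp (2 * 6400 * n ^ 2 * S * 44 * Real.log (81 * n * 2 ^ Lv)) *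
            (Real.exp (2 * 6400 * n ^ 2 * (J + 1) * 44
            * Real.log (81 * n * 2 ^ Lv)) * T'.card) := by
            gcongr
            exact log_ten_bound
        _ = _ := by
            rw [← mul_assoc, ← Real.exp_add]
            congr 2
            push_cast
            ring

/-- exponent in the output of the levels -/
noncomputable def Dlev (n : ℕ) (lK : ℝ) (Lv : ℕ) : ℝ :=
  lK + 768000 * n ^ 2 * lK ^ 2 * Real.log (81 * n)
    + 4000000 * n ^ 2 * (Lv + lK) * Real.log (81 * n * 2 ^ Lv)

theorem levels (c : AddChar G ℂ → ℂ) (n : ℕ) (hn : 1 ≤ n) (hc : ∑ γ, ‖c γ‖ ≤ n)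
    (fZ : G → ℤ) (hf : ∀ x, ‖fs c x - fZ x‖ ≤ 1 / 10) (A : Finset G)
    (hA : ∀ x, x ∈ A ↔ fZ x ≠ 0) (X Q : Finset G) (hXA : X ⊆ A) (hX : X.Nonempty) (hQ : Sym0 Q)
    (K : ℝ) (hK1 : 1 ≤ K) (hK : ((X + Q).card : ℝ) ≤ K * X.card)
    (hAX : (A.card : ℝ) ≤ K * X.card) (hAQ : (A.card : ℝ) ≤ K * Q.card) (Lv : ℕ) (hLv : 1 ≤ Lv) :
    ∃ (X' T : Finset G), X' ⊆ A ∧ X'.Nonempty ∧ Sym0 T ∧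
      ((X' + ms (2 ^ Lv) T).card : ℝ) ≤ 5 * X'.card ∧
      (A.card : ℝ) ≤ Real.exp (Dlev n (Real.log (4 * K)) Lv) * T.card := by
  obtain ⟨J, X1, Q1, hX1A, hQ1, h1, h2, h3⟩ :=
      level c n hn hc fZ hf A hA X Q hXA hX hQ 1 le_rfl K hK1 (by rw [ms_one]; exact hK)
  have hXc : (0 : ℝ) < X.card := by exact_mod_cast hX.card_pos
  have hnr : (1 : ℝ) ≤ n := by exact_mod_cast hn
  have hpos : (0 : ℝ) < n := by linarith
  have hX1 : X1.Nonempty := by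
    rw [← Finset.card_pos]
    have : (0 : ℝ) < X1.card := by
      have : (0 : ℝ) < 2 ^ J * X.card := by positivity
      linarith
    exact_mod_cast this
  have hX1c : (0 : ℝ) < X1.card := by exact_mod_cast hX1.card_pos
  obtain ⟨S, X', T, hX'A, hX', hT, g1, g2, g3⟩ :=
    levels_aux c n hn hc fZ hf A hA X1 Q1 hX1A hX1 hQ1 (by simpa using h1) Lv Lv hLv le_rfl
  have c1 : (X1.card : ℝ) ≤ A.card := by exact_mod_cast Finset.card_le_card hX1A
  have c2 : (X'.card : ℝ) ≤ A.card := by exact_mod_cast Finset.card_le_card hX'A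
  set lK := Real.log (4 * K) with hlK
  have hlK1 : 1 ≤ lK := by
    rw [hlK, Real.le_log_iff_exp_le (by linarith)]
    have := Real.exp_one_lt_d9
    linarith
  have hJ : (J : ℝ) ≤ 2 * lK := by
    apply pow_two_le_log (by linarith)
    have : 2 ^ J * (X.card : ℝ) ≤ 4 * K * X.card := by linarith
    exact le_of_mul_le_mul_right this hXc
  have h4 : (1 : ℝ) ≤ 2 ^ J := one_le_pow₀ (by norm_num)
  have h5 : (X.card : ℝ) ≤ 4 * X1.card := le_trans (le_mul_of_one_le_left hXc.le h4) h2
  have hS : (S : ℝ) ≤ 6 * Lv + 2 * lK := by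
    have : (2 : ℝ) ^ S ≤ 8 ^ Lv * (4 * K) := by
      have h6 : 2 ^ S * (X1.card : ℝ) ≤ 8 ^ Lv * (4 * K) * X1.card := by
        calc _ ≤ (8 : ℝ) ^ Lv * X'.card := g2
          _ ≤ 8 ^ Lv * (K * X.card) := by gcongr; linarith
          _ ≤ 8 ^ Lv * (K * (4 * X1.card)) := by gcongr
          _ = _ := by ring
      exact le_of_mul_le_mul_right h6 hX1c
    have h8 : (1 : ℝ) ≤ 8 ^ Lv := one_le_pow₀ (by norm_num)
    have h7 := pow_two_le_log (by nlinarith) this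
    rw [Real.log_mul (by positivity) (by linarith), Real.log_pow] at h7
    have h9 : Real.log 8 ≤ 3 := by
      rw [show (8 : ℝ) = 2 ^ 3 by norm_num, Real.log_pow]
      have := Real.log_two_lt_d9
      push_cast; linarith
    have : (Lv : ℝ) * Real.log 8 ≤ Lv * 3 := by gcongr
    linarith
  refine ⟨X', T, hX'A, hX', hT, g1, ?_⟩
  have hl81 : 0 ≤ Real.log (81 * n) := Real.log_nonneg (by linarith)
  have hl81' : 0 ≤ Real.log (81 * n * 2 ^ Lv) := by
    apply Real.log_nonneg
    have : (1 : ℝ) ≤ 2 ^ Lv := one_le_pow₀ (by norm_num)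
    nlinarith
  have hl2K : Real.log (2 * K) ≤ lK := Real.log_le_log (by linarith) (by linarith)
  have hl2K0 : 0 ≤ Real.log (2 * K) := Real.log_nonneg (by linarith)
  have hKe : K ≤ Real.exp lK := by rw [hlK, Real.exp_log (by linarith)]; linarith
  have hprod : ((J : ℝ) + 1) * (16 * Real.log (2 * K) + 4) ≤ 60 * lK ^ 2 := by
    calc ((J : ℝ) + 1) * (16 * Real.log (2 * K) + 4) ≤ (3 * lK) * (20 * lK) := by
          apply mul_le_mul
          · linarith
          · linarith
          · positivity
          · linarith
      _ = _ := by ring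
  calc (A.card : ℝ) ≤ K * Q.card := hAQ
    _ ≤ Real.exp lK * (Real.exp (2 * 6400 * n ^ 2 * (J + 1) * (16 * Real.log (2 * K) + 4)
        * Real.log (81 * n * (1 : ℕ))) * (Real.exp (2 * 6400 * n ^ 2 * S * 44
        * Real.log (81 * n * 2 ^ Lv)) * T.card)) := by
        refine (mul_le_mul_of_nonneg_right hKe (by positivity)).trans ?_
        apply mul_le_mul_of_nonneg_left _ (Real.exp_pos _).le
        refine h3.trans ?_
        apply mul_le_mul_of_nonneg_left g3 (Real.exp_pos _).le
    _ = Real.exp (lK + 2 * 6400 * n ^ 2 * ((J + 1) * (16 * Real.log (2 * K) + 4))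
        * Real.log (81 * n) + 2 * 6400 * n ^ 2 * S * 44
        * Real.log (81 * n * 2 ^ Lv)) * T.card := by
        rw [Real.exp_add, Real.exp_add]; push_cast; rw [mul_one]; ring_nf
    _ ≤ Real.exp (lK + 2 * 6400 * n ^ 2 * (60 * lK ^ 2)
        * Real.log (81 * n) + 2 * 6400 * n ^ 2 * (6 * Lv + 2 * lK) * 44
        * Real.log (81 * n * 2 ^ Lv)) * T.card := by
        apply mul_le_mul_of_nonneg_right _ (Nat.cast_nonneg _)
        apply Real.exp_le_exp.2
        gcongr
    _ ≤ _ := by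
        gcongr
        rw [Dlev]
        have h0 : 0 ≤ (n : ℝ) ^ 2 * lK * Real.log (81 * n * 2 ^ Lv) := by positivity
        have h0' : 0 ≤ (n : ℝ) ^ 2 * Lv * Real.log (81 * n * 2 ^ Lv) := by positivity
        have e : 2 * 6400 * (n : ℝ) ^ 2 * (6 * Lv + 2 * lK) * 44 * Real.log (81 * n * 2 ^ Lv) =
          3379200 * ((n : ℝ) ^ 2 * Lv * Real.log (81 * n * 2 ^ Lv)) +
          1126400 * ((n : ℝ) ^ 2 * lK * Real.log (81 * n * 2 ^ Lv)) := by ring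
        linarith

end Part5

section Part6

/-- sign vectors -/
def sg (ι : Type) [Fintype ι] [DecidableEq ι] : Finset (ι → ℤ) :=
  Fintype.piFinset (fun _ => ({-1, 0, 1} : Finset ℤ))

variable {ι : Type} [Fintype ι] [DecidableEq ι]

theorem mem_sg {σ : ι → ℤ} : σ ∈ sg ι ↔ ∀ i, σ i = -1 ∨ σ i = 0 ∨ σ i = 1 := by
  rw [sg, Fintype.mem_piFinset]
  simp

/-- support -/
def sp (σ : ι → ℤ) : Finset ι := Finset.univ.filter (fun i => σ i ≠ 0)

theorem sum_sg {R : Type} [CommSemiring R] (a : ι → ℤ → R) :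
    ∑ σ ∈ sg ι, ∏ j, a j (σ j) = ∏ j, (a j (-1) + a j 0 + a j 1) := by
  rw [sg, ← Finset.prod_univ_sum]
  apply Finset.prod_congr rfl
  intro j _
  rw [Finset.sum_insert (by decide), Finset.sum_insert (by decide), Finset.sum_singleton, add_assoc]

theorem prod_wt (b : ℝ) (σ : ι → ℤ) :
    ∏ j, (if σ j = 0 then (1 : ℝ) else b) = b ^ (sp σ).card := by
  rw [Finset.prod_ite, Finset.prod_const_one, one_mul, Finset.prod_const]; rfl

theorem sum_sg_pow (b : ℝ) : ∑ σ ∈ sg ι, b ^ (sp σ).card = (1 + 2 * b) ^ (Fintype.card ι) := by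
  have := sum_sg (ι := ι) (fun _ s => if s = 0 then (1 : ℝ) else b)
  simp only [prod_wt] at this
  rw [this]
  simp [Finset.prod_const]
  congr 1; ring

variable {G : Type} [AddCommGroup G] [DecidableEq G] [Fintype G]

theorem char_zsmul_sum (γ : AddChar G ℂ) (x : ι → G) (σ : ι → ℤ) :
    γ (∑ j, σ j • x j) = ∏ j, γ (σ j • x j) :=
  map_sum γ.toAddMonoidHom _ _ |>.trans (by rfl)

theorem riesz_expand (c : AddChar G ℂ → ℂ) (x : ι → G) (a : ι → ℤ → ℂ) :
    ∑ γ, c γ * ∏ j, (a j (-1) * γ (-(x j)) + a j 0 + a j 1 * γ (x j)) =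
      ∑ σ ∈ sg ι, (∏ j, a j (σ j)) * fs c (∑ j, σ j • x j) := by
  simp only [fs, Finset.mul_sum]
  rw [Finset.sum_comm]
  apply Finset.sum_congr rfl
  intro γ _
  have h := sum_sg (fun j s => a j s * γ (s • x j))
  simp only [neg_smul, one_smul, zero_smul, AddChar.map_zero_eq_one, mul_one] at h
  rw [← h, Finset.mul_sum]
  apply Finset.sum_congr rfl
  intro σ _
  rw [Finset.prod_mul_distrib, char_zsmul_sum]
  ring

theorem sum_single (F : (ι → ℤ) → ℂ) :
    ∑ σ ∈ (sg ι).filter (fun σ => (sp σ).card = 1), F σ =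
      ∑ j, (F (Pi.single j 1) + F (Pi.single j (-1))) := by
  have h1 : (sg ι).filter (fun σ => (sp σ).card = 1) =
      ((Finset.univ : Finset ι) ×ˢ ({1, -1} : Finset ℤ)).image (fun p => Pi.single p.1 p.2) := by
    ext σ
    rw [Finset.mem_filter, Finset.mem_image, mem_sg]
    constructor
    · rintro ⟨hσ, hc⟩
      obtain ⟨j, hj⟩ := Finset.card_eq_one.1 hc
      have hjm : j ∈ sp σ := by rw [hj]; simp
      have hjn : σ j ≠ 0 := (Finset.mem_filter.1 hjm).2
      refine ⟨(j, σ j), ?_, ?_⟩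
      · simp only [Finset.mem_product, Finset.mem_univ, true_and, Finset.mem_insert,
          Finset.mem_singleton]
        rcases hσ j with h | h | h
        · right; exact h
        · exact absurd h hjn
        · left; exact h
      · funext i
        by_cases hij : i = j
        · subst hij; simp
        · rw [Pi.single_eq_of_ne hij]
          by_contra hne
          have : i ∈ sp σ := Finset.mem_filter.2 ⟨Finset.mem_univ _, fun h => hne h.symm⟩
          rw [hj, Finset.mem_singleton] at this
          exact hij this
    · rintro ⟨⟨j, s⟩, hp, rfl⟩
      simp only [Finset.mem_product, Finset.mem_univ, true_and, Finset.mem_insert,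
          Finset.mem_singleton] at hp
      refine ⟨?_, ?_⟩
      · intro i
        by_cases hij : i = j
        · subst hij; simp; omega
        · simp [Pi.single_eq_of_ne hij]
      · rw [Finset.card_eq_one]
        refine ⟨j, ?_⟩
        ext i
        rw [sp, Finset.mem_filter, Finset.mem_singleton]
        by_cases hij : i = j
        · subst hij; simp; omega
        · simp [hij]
  rw [h1, Finset.sum_image, Finset.sum_product]
  · apply Finset.sum_congr rfl
    intro j _
    rw [Finset.sum_insert (by decide), Finset.sum_singleton]
  · rintro ⟨j, s⟩ hp ⟨j', s'⟩ hp' h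
    simp only [Finset.coe_product, Set.mem_prod, Finset.mem_coe, Finset.mem_univ, true_and,
      Finset.mem_insert, Finset.mem_singleton] at hp hp'
    simp only at h
    have hs : s ≠ 0 := by omega
    have h2 := congrFun h j
    rw [Pi.single_eq_same] at h2
    by_cases hj : j = j'
    · subst hj
      rw [Pi.single_eq_same] at h2
      rw [h2]
    · rw [Pi.single_eq_of_ne hj] at h2
      exact absurd h2 hs

theorem unit_dir (s : ℤ) (hs : s = 1 ∨ s = -1) : ∃ u : ℂ, ‖u‖ = 1 ∧
    ∀ γ : AddChar G ℂ, ∀ x : G, ∃ r : ℝ, |r| ≤ 1 ∧ u * (γ x + s * γ (-x)) = 2 * Complex.I * r := by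
  have hconj : ∀ γ : AddChar G ℂ, ∀ x : G, γ (-x) = (starRingEnd ℂ) (γ x) := by
    intro γ x
    exact AddChar.map_neg_eq_conj γ x
  rcases hs with rfl | rfl
  · refine ⟨Complex.I, by simp, ?_⟩
    intro γ x
    refine ⟨(γ x).re, ?_, ?_⟩
    · exact (Complex.abs_re_le_norm _).trans (AddChar.norm_apply γ x).le
    · rw [hconj]
      apply Complex.ext <;> simp
      ring
  · refine ⟨1, by simp, ?_⟩
    intro γ x
    refine ⟨(γ x).im, ?_, ?_⟩
    · exact (Complex.abs_im_le_norm _).trans (AddChar.norm_apply γ x).le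
    · rw [hconj]
      apply Complex.ext <;> simp
      ring

theorem norm_one_add_I (y : ℝ) : ‖1 + Complex.I * y‖ ≤ Real.exp (y ^ 2 / 2) := by
  have h : ‖1 + Complex.I * y‖ ^ 2 = 1 + y ^ 2 := by
    rw [← Complex.normSq_eq_norm_sq, Complex.normSq_apply]; simp; ring
  have h2 : Real.exp (y ^ 2 / 2) ^ 2 = Real.exp (y ^ 2) := by
    rw [← Real.exp_nat_mul]; congr 1; push_cast; ring
  have h3 := Real.add_one_le_exp (y ^ 2)
  apply le_of_sq_le_sq _ (Real.exp_pos _).le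
  rw [h, h2]; linarith

theorem fs_norm (c : AddChar G ℂ → ℂ) (n : ℝ) (hc : ∑ γ, ‖c γ‖ ≤ n) (x : G) : ‖fs c x‖ ≤ n := by
  refine le_trans ?_ hc
  refine (norm_sum_le _ _).trans (Finset.sum_le_sum ?_)
  intro γ _
  rw [norm_mul, AddChar.norm_apply, mul_one]

end Part6

section Part7

variable {G : Type} [AddCommGroup G] [DecidableEq G] [Fintype G]

theorem sum_three_case {ι : Type} [Fintype ι] [DecidableEq ι] (F : (ι → ℤ) → ℂ) (b : ℝ) (hb : 0 ≤ b)
    (f0 ε n l E : ℝ) (hε : 0 ≤ ε) (hn : 0 ≤ n)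
    (h0 : ‖F 0‖ ≤ f0)
    (h2 : ∀ σ ∈ sg ι, 2 ≤ (sp σ).card → ((sp σ).card : ℝ) ≤ l → ‖F σ‖ ≤ b ^ (sp σ).card * ε)
    (h3 : ∀ σ ∈ sg ι, l < (sp σ).card → ‖F σ‖ ≤ b ^ (sp σ).card * n)
    (hE : ε * (1 + 2 * b) ^ (Fintype.card ι) +
      n * Real.exp (-l) * (1 + 2 * (Real.exp 1 * b)) ^ (Fintype.card ι) ≤ E) :
    ‖∑ σ ∈ sg ι, F σ - ∑ j, (F (Pi.single j 1) + F (Pi.single j (-1)))‖ ≤ f0 + E := by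
  classical
  have hf0 : 0 ≤ f0 := (norm_nonneg _).trans h0
  rw [← sum_single, ← Finset.sum_filter_add_sum_filter_not (sg ι) (fun σ => (sp σ).card = 1) F,
    add_sub_cancel_left]
  have hbd : ∀ σ ∈ sg ι, (sp σ).card ≠ 1 → ‖F σ‖ ≤ (if σ = 0 then f0 else 0) +
      (ε * b ^ (sp σ).card + n * Real.exp (-l) * (Real.exp 1 * b) ^ (sp σ).card) := by
    intro σ hσ h1
    have p1 : 0 ≤ ε * b ^ (sp σ).card := by positivity
    have p2 : 0 ≤ n * Real.exp (-l) * (Real.exp 1 * b) ^ (sp σ).card := by positivity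
    have p3 : 0 ≤ (if σ = 0 then f0 else 0) := by split_ifs <;> simp [hf0]
    by_cases hz : σ = 0
    · rw [if_pos hz]; subst hz; linarith
    · have hc : (sp σ).card ≠ 0 := by
        intro h
        apply hz
        rw [Finset.card_eq_zero] at h
        funext j
        by_contra hj
        have : j ∈ sp σ := Finset.mem_filter.2 ⟨Finset.mem_univ _, hj⟩
        rw [h] at this
        simp at this
      by_cases hl : ((sp σ).card : ℝ) ≤ l
      · have := h2 σ hσ (by omega) hl
        linarith
      · push Not at hl
        have h4 := h3 σ hσ hl
        have h5 : b ^ (sp σ).card * n ≤ n * Real.exp (-l) * (Real.exp 1 * b) ^ (sp σ).card := by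
          rw [mul_pow, ← Real.exp_nat_mul, mul_one]
          have : 1 ≤ Real.exp (-l) * Real.exp ((sp σ).card : ℝ) := by
            rw [← Real.exp_add]
            apply Real.one_le_exp; linarith
          calc b ^ (sp σ).card * n = n * b ^ (sp σ).card * 1 := by ring
            _ ≤ n * b ^ (sp σ).card * (Real.exp (-l) * Real.exp ((sp σ).card : ℝ)) := by gcongr
            _ = _ := by ring
        linarith
  calc _ ≤ ∑ σ ∈ (sg ι).filter (fun σ => ¬ (sp σ).card = 1), ‖F σ‖ := norm_sum_le _ _
    _ ≤ ∑ σ ∈ (sg ι).filter (fun σ => ¬ (sp σ).card = 1), ((if σ = 0 then f0 else 0) +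
      (ε * b ^ (sp σ).card + n * Real.exp (-l) * (Real.exp 1 * b) ^ (sp σ).card)) := by
        apply Finset.sum_le_sum
        intro σ hσ
        rw [Finset.mem_filter] at hσ
        exact hbd σ hσ.1 hσ.2
    _ ≤ ∑ σ ∈ sg ι, ((if σ = 0 then f0 else 0) +
      (ε * b ^ (sp σ).card + n * Real.exp (-l) * (Real.exp 1 * b) ^ (sp σ).card)) := by
        apply Finset.sum_le_sum_of_subset_of_nonneg (Finset.filter_subset _ _)
        intro σ _ _
        have p3 : 0 ≤ (if σ = 0 then f0 else 0) := by split_ifs <;> simp [hf0]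
        positivity
    _ ≤ f0 + E := by
        rw [Finset.sum_add_distrib, Finset.sum_add_distrib, ← Finset.mul_sum, ← Finset.mul_sum,
          sum_sg_pow, sum_sg_pow]
        have : ∑ σ ∈ sg ι, (if σ = 0 then f0 else 0) ≤ f0 := by
          rw [Finset.sum_ite_eq']; split_ifs <;> simp [hf0]
        linarith

theorem one_add_pow_le_exp {y : ℝ} (hy : 0 ≤ y) (m : ℕ) : (1 + y) ^ m ≤ Real.exp (m * y) := by
  rw [Real.exp_nat_mul]
  apply pow_le_pow_left₀ (by linarith)
  linarith [Real.add_one_le_exp y]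

theorem connectivity (c : AddChar G ℂ → ℂ) (n : ℕ) (hn : 1 ≤ n) (hc : ∑ γ, ‖c γ‖ ≤ n)
    (fZ : G → ℤ) (ε : ℝ) (hε : ε ≤ Real.exp (-(20 * n))) (hf : ∀ x, ‖fs c x - fZ x‖ ≤ ε)
    (A : Finset G) (hA : ∀ x, x ∈ A ↔ fZ x ≠ 0) (s : ℤ) (hs : s = 1 ∨ s = -1)
    (m : ℕ) (hm : m = 400 * n ^ 2)
    (x : Fin m → G) (hx : ∀ j, fZ (x j) + s * fZ (-(x j)) ≠ 0) :
    ∃ σ ∈ sg (Fin m), 2 ≤ (sp σ).card ∧ (sp σ).card ≤ 80 * n ∧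
      ∑ j, σ j • x j ∈ A := by
  by_contra! hcon
  have hnr : (1 : ℝ) ≤ n := by exact_mod_cast hn
  have hn0 : (0 : ℝ) < n := by linarith
  have hε0 : 0 ≤ ε := (norm_nonneg _).trans (hf 0)
  have hε1 : ε ≤ 1 / 100 := by
    refine hε.trans ?_
    rw [Real.exp_neg, ← one_div]
    apply one_div_le_one_div_of_le (by norm_num)
    calc (100 : ℝ) ≤ 2 ^ 20 := by norm_num
      _ ≤ Real.exp 1 ^ 20 := by
        apply pow_le_pow_left₀ (by norm_num); linarith [Real.exp_one_gt_d9]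
      _ = Real.exp 20 := by rw [← Real.exp_nat_mul]; norm_num
      _ ≤ _ := by apply Real.exp_le_exp.2; linarith
  obtain ⟨u, hu1, hu⟩ := unit_dir (G := G) s hs
  set b : ℝ := 1 / (40 * n) with hb
  have hb0 : 0 ≤ b := by positivity
  have hmb : (m : ℝ) * b = 10 * n := by
    rw [hm, hb]; push_cast; field_simp; norm_num
  have hmb2 : (m : ℝ) * b ^ 2 = 1 / 4 := by
    rw [hm, hb]; push_cast; field_simp; norm_num
  set e : Fin m → ℝ := fun j => SignType.sign (fZ (x j) + s * fZ (-(x j)) : ℝ) with he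
  have hd0 : ∀ j, (1 : ℝ) ≤ |(fZ (x j) + s * fZ (-(x j)) : ℝ)| := by
    intro j
    have := Int.one_le_abs (hx j)
    exact_mod_cast this
  have hee : ∀ j, |e j| = 1 := by
    intro j
    have h1 := hd0 j
    have h2 : (fZ (x j) + s * fZ (-(x j)) : ℝ) ≠ 0 := by
      intro h; rw [h, abs_zero] at h1; linarith
    rw [he]
    rcases lt_or_gt_of_ne h2 with h | h
    · simp [sign_neg h]
    · simp [sign_pos h]
  let a : Fin m → ℤ → ℂ := fun j t =>
    if t = 0 then 1 else if t = 1 then u * e j * b else u * e j * b * s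
  have a0 : ∀ j, a j 0 = 1 := by intro j; simp [a]
  have a1 : ∀ j, a j 1 = u * e j * b := by intro j; simp [a]
  have am : ∀ j, a j (-1) = u * e j * b * s := by intro j; simp [a]
  have ha : ∀ j t, t ≠ 0 → ‖a j t‖ = b := by
    intro j t ht
    have hsn : ‖(s : ℂ)‖ = 1 := by rcases hs with rfl | rfl <;> simp
    have h1 : ‖(e j : ℂ)‖ = 1 := by rw [Complex.norm_real, Real.norm_eq_abs]; exact hee j
    have h2 : ‖(b : ℂ)‖ = b := by rw [Complex.norm_real, Real.norm_eq_abs, abs_of_nonneg hb0]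
    simp only [a, if_neg ht]
    split_ifs
    · rw [norm_mul, norm_mul, hu1, h1, h2]; ring
    · rw [norm_mul, norm_mul, norm_mul, hu1, h1, h2, hsn]; ring
  have haσ : ∀ σ : Fin m → ℤ, ‖∏ j, a j (σ j)‖ = b ^ (sp σ).card := by
    intro σ
    rw [norm_prod, ← prod_wt]
    apply Finset.prod_congr rfl
    intro j _
    split_ifs with h
    · simp [a, h]
    · exact ha j _ h
  set F : (Fin m → ℤ) → ℂ := fun σ => (∏ j, a j (σ j)) * fs c (∑ j, σ j • x j) with hF
  have hfn := fs_norm c n hc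
  have key := sum_three_case F b hb0 n ε n (80 * n) (1 + n) hε0 hn0.le
    (by
      simp only [hF, norm_mul, haσ]
      have : sp (0 : Fin m → ℤ) = ∅ := by simp [sp]
      rw [this, Finset.card_empty, pow_zero, one_mul]
      exact hfn _)
    (by
      intro σ hσ h2 hl
      simp only [hF, norm_mul, haσ]
      apply mul_le_mul_of_nonneg_left _ (by positivity)
      have h3 := hcon σ hσ h2 (by exact_mod_cast hl)
      rw [hA, not_not] at h3
      have h4 := hf (∑ j, σ j • x j)
      rw [h3] at h4
      simpa using h4)
    (by
      intro σ hσ hl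
      simp only [hF, norm_mul, haσ]
      apply mul_le_mul_of_nonneg_left (hfn _) (by positivity))
    (by
      rw [Fintype.card_fin]
      have h1 := one_add_pow_le_exp (y := 2 * b) (by positivity) m
      have h2 := one_add_pow_le_exp (y := 2 * (Real.exp 1 * b)) (by positivity) m
      have e1 : (m : ℝ) * (2 * b) = 20 * n := by linarith
      have e2 : (m : ℝ) * (2 * (Real.exp 1 * b)) ≤ 80 * n := by
        have : (m : ℝ) * (2 * (Real.exp 1 * b)) = 2 * Real.exp 1 * (m * b) := by ring
        rw [this, hmb]
        have := Real.exp_one_lt_d9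
        nlinarith
      rw [e1] at h1
      have a1 : ε * (1 + 2 * b) ^ m ≤ 1 := by
        calc _ ≤ Real.exp (-(20 * n)) * Real.exp (20 * n) := by gcongr
          _ = 1 := by rw [← Real.exp_add]; simp
      have a2 : Real.exp (-(80 * n)) * (1 + 2 * (Real.exp 1 * b)) ^ m ≤ 1 := by
        calc _ ≤ Real.exp (-(80 * n)) * Real.exp (80 * n) := by
              gcongr
              exact h2.trans (Real.exp_le_exp.2 e2)
          _ = 1 := by rw [← Real.exp_add]; simp
      have a3 : (n : ℝ) * Real.exp (-(80 * n)) * (1 + 2 * (Real.exp 1 * b)) ^ m ≤ n := by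
        rw [mul_assoc]
        exact mul_le_of_le_one_right hn0.le a2
      linarith)
  have hR : ‖∑ σ ∈ sg (Fin m), F σ‖ ≤ 2 * n := by
    rw [hF, ← riesz_expand]
    calc _ ≤ ∑ γ, ‖c γ * ∏ j, (a j (-1) * γ (-(x j)) + a j 0 + a j 1 * γ (x j))‖ := norm_sum_le _ _
      _ ≤ ∑ γ, ‖c γ‖ * 2 := by
        apply Finset.sum_le_sum
        intro γ _
        rw [norm_mul, norm_prod]
        apply mul_le_mul_of_nonneg_left _ (norm_nonneg _)
        calc _ ≤ ∏ j : Fin m, Real.exp ((2 * b) ^ 2 / 2) := by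
              apply Finset.prod_le_prod
              · intro j _; exact norm_nonneg _
              · intro j _
                obtain ⟨r, hr, hur⟩ := hu γ (x j)
                have h1 : a j (-1) * γ (-(x j)) + a j 0 + a j 1 * γ (x j) =
                    1 + Complex.I * ((2 * b * (e j * r) : ℝ) : ℂ) := by
                  rw [a0, a1, am]
                  push_cast
                  linear_combination (b * e j : ℂ) * hur
                rw [h1]
                refine (norm_one_add_I _).trans (Real.exp_le_exp.2 ?_)
                have h2 : (2 * b * (e j * r)) ^ 2 = (2 * b) ^ 2 * r ^ 2 := by
                  have : (e j) ^ 2 = 1 := by rw [← sq_abs, hee]; norm_num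
                  rw [mul_pow, mul_pow (e j), this]; ring
                rw [h2]
                have h3 : r ^ 2 ≤ 1 := by rw [← sq_abs]; exact pow_le_one₀ (abs_nonneg _) hr
                have : (2 * b) ^ 2 * r ^ 2 ≤ (2 * b) ^ 2 := mul_le_of_le_one_right (by positivity) h3
                linarith
          _ = Real.exp (m * b ^ 2 * 2) := by
              rw [Finset.prod_const, Finset.card_univ, Fintype.card_fin, ← Real.exp_nat_mul]
              congr 1; ring
          _ ≤ 2 := by
              rw [hmb2]
              have h1 : Real.exp (1 / 4 * 2) ^ 2 = Real.exp 1 := by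
                rw [← Real.exp_nat_mul]; norm_num
              have h2 := Real.exp_one_lt_d9
              apply le_of_sq_le_sq _ (by norm_num)
              rw [h1]; linarith
      _ ≤ 2 * n := by rw [← Finset.sum_mul]; linarith
  have hlin : 9 * n ≤ ‖∑ j, (F (Pi.single j 1) + F (Pi.single j (-1)))‖ := by
    have h1 : ∀ j, F (Pi.single j 1) + F (Pi.single j (-1)) =
        u * (b * (e j * (fs c (x j) + s * fs c (-(x j))))) := by
      intro j
      have p : ∀ t : ℤ, ∏ i, a i ((Pi.single j t : Fin m → ℤ) i) = a j t := by
        intro t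
        rw [Finset.prod_eq_single j]
        · simp
        · intro i _ hij; simp [Pi.single_eq_of_ne hij, a]
        · simp
      have q : ∀ t : ℤ, ∑ i, (Pi.single j t : Fin m → ℤ) i • x i = t • x j := by
        intro t
        rw [Finset.sum_eq_single j]
        · simp
        · intro i _ hij; simp [Pi.single_eq_of_ne hij]
        · simp
      simp only [hF, p, q, neg_smul, one_smul]
      rw [a1, am]
      ring
    simp only [h1]
    rw [← Finset.mul_sum, ← Finset.mul_sum, norm_mul, norm_mul, hu1, one_mul, Complex.norm_real,
      Real.norm_eq_abs, abs_of_nonneg hb0]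
    have h2 : ∀ j, (1 - 2 * ε : ℝ) ≤ ((e j * (fs c (x j) + s * fs c (-(x j))) : ℂ)).re := by
      intro j
      set d : ℂ := (fs c (x j) - fZ (x j)) + s * (fs c (-(x j)) - fZ (-(x j))) with hd
      have hdn : ‖d‖ ≤ 2 * ε := by
        have hsn : ‖(s : ℂ)‖ = 1 := by rcases hs with rfl | rfl <;> simp
        calc ‖d‖ ≤ _ := norm_add_le _ _
          _ ≤ ε + ε := by
            rw [norm_mul, hsn, one_mul]; exact add_le_add (hf _) (hf _)
          _ = _ := by ring
      have e1 : (e j * (fs c (x j) + s * fs c (-(x j))) : ℂ) =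
          ((e j * (fZ (x j) + s * fZ (-(x j))) : ℝ) : ℂ) + e j * d := by
        rw [hd]; push_cast; ring
      rw [e1, Complex.add_re, Complex.ofReal_re]
      have e2 : e j * (fZ (x j) + s * fZ (-(x j))) = |(fZ (x j) + s * fZ (-(x j)) : ℝ)| := by
        simp only [he]
        exact sign_mul_self _
      rw [e2]
      have e3 : |(e j * d).re| ≤ 2 * ε := by
        refine (Complex.abs_re_le_norm _).trans ?_
        rw [norm_mul, Complex.norm_real, Real.norm_eq_abs, hee, one_mul]; exact hdn
      have := (abs_le.1 e3).1
      linarith [hd0 j]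
    have h3 : (m : ℝ) * (1 - 2 * ε) ≤ ‖∑ j, (e j * (fs c (x j) + s * fs c (-(x j))) : ℂ)‖ := by
      refine le_trans ?_ (Complex.re_le_norm _)
      rw [Complex.re_sum]
      calc (m : ℝ) * (1 - 2 * ε) = ∑ j : Fin m, (1 - 2 * ε) := by simp; ring
        _ ≤ _ := Finset.sum_le_sum (fun j _ => h2 j)
    calc (9 * n : ℝ) ≤ (m * b) * (1 - 2 * ε) := by rw [hmb]; nlinarith
      _ = b * (m * (1 - 2 * ε)) := by ring
      _ ≤ _ := mul_le_mul_of_nonneg_left h3 hb0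
  have htri := norm_sub_norm_le (∑ j, (F (Pi.single j 1) + F (Pi.single j (-1)))) (∑ σ ∈ sg (Fin m), F σ)
  rw [norm_sub_rev] at htri
  linarith

end Part7

section Part8

variable {G : Type} [AddCommGroup G] [DecidableEq G] [Fintype G]

/-- The counting step of Balog-Szemeredi-Gowers. -/
theorem bsg_count (A A' D Q : Finset G) (t : ℝ) (ht : 0 ≤ t)
    (good : G → G → Prop) (hgs : ∀ a b, good a b → good b a)
    (hgood : ∀ a b, good a b → t ≤ ((Q.filter (fun q => a + q ∈ A ∧ b + q ∈ A)).card : ℝ))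
    (hA' : ∀ a ∈ A', ∃ B ⊆ D, (∀ b ∈ D, b ∉ B → good a b) ∧ 4 * (B.card : ℝ) ≤ D.card) :
    ((A' - A').card : ℝ) * (D.card / 2 * (t * t)) ≤ (A.card : ℝ) ^ 4 := by
  classical
  set Z : Finset (G × G × G × G) := A ×ˢ A ×ˢ A ×ˢ A with hZ
  let F : G × G × G × G → G := fun z => z.1 - z.2.1 + z.2.2.1 - z.2.2.2
  have hfib : ∀ d ∈ A' - A', (D.card / 2 * (t * t) : ℝ) ≤ ((Z.filter (fun z => F z = d)).card : ℝ) := by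
    intro d hd
    obtain ⟨a, ha, a2, ha2, rfl⟩ := Finset.mem_sub.1 hd
    obtain ⟨B1, hB1, hg1, hc1⟩ := hA' a ha
    obtain ⟨B2, hB2, hg2, hc2⟩ := hA' a2 ha2
    set D' := D \ (B1 ∪ B2) with hD'
    have hD'c : (D.card / 2 : ℝ) ≤ D'.card := by
      have h1 : D.card ≤ D'.card + (B1 ∪ B2).card := by
        have := Finset.le_card_sdiff (B1 ∪ B2) D
        rw [← hD'] at this
        omega
      have h2 := Finset.card_union_le B1 B2
      have h3 : (D.card : ℝ) ≤ D'.card + (B1.card + B2.card) := by exact_mod_cast h1.trans (by omega)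
      linarith
    let T : Finset (Σ _ : G, G × G) := D'.sigma (fun a1 =>
      (Q.filter (fun q => a + q ∈ A ∧ a1 + q ∈ A)) ×ˢ (Q.filter (fun q => a1 + q ∈ A ∧ a2 + q ∈ A)))
    have hT : (D.card / 2 * (t * t) : ℝ) ≤ T.card := by
      rw [Finset.card_sigma]
      push_cast
      calc (D.card / 2 * (t * t) : ℝ) ≤ D'.card * (t * t) := by gcongr
        _ = ∑ a1 ∈ D', (t * t) := by simp
        _ ≤ _ := by
          apply Finset.sum_le_sum
          intro a1 ha1
          rw [hD', Finset.mem_sdiff, Finset.mem_union, not_or] at ha1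
          rw [Finset.card_product]
          push_cast
          apply mul_le_mul (hgood _ _ (hg1 a1 ha1.1 ha1.2.1)) (hgood _ _ (hgs _ _ (hg2 a1 ha1.1 ha1.2.2))) ht
          positivity
    refine hT.trans ?_
    norm_cast
    apply Finset.card_le_card_of_injOn (fun p => (a + p.2.1, p.1 + p.2.1, p.1 + p.2.2, a2 + p.2.2))
    · rintro ⟨a1, b1, b2⟩ hp
      simp only [T, Finset.coe_sigma, Set.mem_sigma_iff, Finset.mem_coe, Finset.mem_product,
        Finset.mem_filter] at hp
      simp only [Finset.coe_filter, Set.mem_ofPred_eq, hZ, Finset.mem_product, F]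
      refine ⟨⟨hp.2.1.2.1, hp.2.1.2.2, hp.2.2.2.1, hp.2.2.2.2⟩, by abel⟩
    · rintro ⟨a1, b1, b2⟩ _ ⟨a1', b1', b2'⟩ _ h
      simp only [Prod.mk.injEq] at h
      obtain ⟨h1, h2, h3, h4⟩ := h
      have e1 := add_left_cancel h1
      subst e1
      have e2 := add_left_cancel h4
      have e3 := add_right_cancel h2
      subst e2; subst e3; rfl
  have hcard : (Z.card : ℝ) = (A.card : ℝ) ^ 4 := by
    rw [hZ]; simp only [Finset.card_product]; push_cast; ring
  rw [← hcard]
  calc ((A' - A').card : ℝ) * (D.card / 2 * (t * t)) = ∑ d ∈ A' - A', (D.card / 2 * (t * t) : ℝ) := by simp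
    _ ≤ ∑ d ∈ A' - A', ((Z.filter (fun z => F z = d)).card : ℝ) := Finset.sum_le_sum hfib
    _ ≤ _ := by
      norm_cast
      rw [← Finset.card_biUnion]
      · apply Finset.card_le_card
        intro z hz
        simp only [Finset.mem_biUnion, Finset.mem_filter] at hz
        obtain ⟨_, _, h, _⟩ := hz
        exact h
      · intro d _ d' _ hdd
        rw [Function.onFun, Finset.disjoint_left]
        intro z h1 h2
        rw [Finset.mem_filter] at h1 h2
        exact hdd (h1.2.symm.trans h2.2)

theorem bsg (A P Q : Finset G) (hPQ : P.card = Q.card) (hP : P.Nonempty) (hAP : A.card ≤ 2 * P.card)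
    (K : ℝ) (hK : 1 ≤ K)
    (hE : (P.card : ℝ) ^ 2 ≤ K * (((P ×ˢ Q).filter (fun z => z.1 + z.2 ∈ A)).card : ℝ)) :
    ∃ A' ⊆ P, A'.Nonempty ∧ (P.card : ℝ) ≤ 4 * K * A'.card ∧
      ((A' - A').card : ℝ) ≤ 2 ^ 16 * K ^ 6 * A'.card := by
  classical
  obtain ⟨N, hN⟩ : ∃ N : ℝ, N = (P.card : ℝ) := ⟨_, rfl⟩
  rw [← hN] at hE ⊢
  have hN0 : 0 < N := by rw [hN]; exact_mod_cast hP.card_pos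
  have hQN : (Q.card : ℝ) = N := by rw [hN, hPQ]
  have hK0 : 0 < K := by linarith
  let Nb : G → Finset G := fun q => P.filter (fun p => p + q ∈ A)
  let co : G → G → Finset G := fun a b => Q.filter (fun q => a + q ∈ A ∧ b + q ∈ A)
  obtain ⟨t, ht⟩ : ∃ t : ℝ, t = N / (16 * K ^ 2) := ⟨_, rfl⟩
  have ht0 : 0 ≤ t := by rw [ht]; positivity
  let good : G → G → Prop := fun a b => t ≤ ((co a b).card : ℝ)
  have hsum : ∑ q ∈ Q, ((Nb q).card : ℝ) = (((P ×ˢ Q).filter (fun z => z.1 + z.2 ∈ A)).card : ℝ) := by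
    norm_cast
    rw [Finset.card_filter, Finset.sum_product_right]
    apply Finset.sum_congr rfl
    intro q _
    rw [Finset.card_filter]
  let Om : G → Finset (G × G) := fun q => (Nb q ×ˢ Nb q).filter (fun z => ¬ good z.1 z.2)
  have hOm : ∑ q ∈ Q, ((Om q).card : ℝ) ≤ N ^ 2 * t := by
    have h1 : ∑ q ∈ Q, ((Om q).card : ℝ) =
        ∑ z ∈ (P ×ˢ P).filter (fun z => ¬ good z.1 z.2), ((co z.1 z.2).card : ℝ) := by
      norm_cast
      have h2 : ∀ q, (Om q).card = ∑ z ∈ (P ×ˢ P).filter (fun z => ¬ good z.1 z.2),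
          if z.1 + q ∈ A ∧ z.2 + q ∈ A then 1 else 0 := by
        intro q
        rw [← Finset.card_filter]
        congr 1
        ext z
        simp only [Om, Nb, Finset.mem_filter, Finset.mem_product]
        tauto
      simp only [h2]
      rw [Finset.sum_comm]
      apply Finset.sum_congr rfl
      intro z _
      rw [← Finset.card_filter]
    rw [h1]
    calc _ ≤ ∑ z ∈ (P ×ˢ P).filter (fun z => ¬ good z.1 z.2), t := by
          apply Finset.sum_le_sum
          intro z hz
          exact (not_le.1 (Finset.mem_filter.1 hz).2).le
      _ ≤ ∑ z ∈ P ×ˢ P, t :=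
          Finset.sum_le_sum_of_subset_of_nonneg (Finset.filter_subset _ _) (fun _ _ _ => ht0)
      _ = N ^ 2 * t := by
          rw [Finset.sum_const, Finset.card_product, nsmul_eq_mul, hN]; push_cast; ring
  have hex : ∃ q ∈ Q, N ^ 2 / (2 * K ^ 2) ≤ ((Nb q).card : ℝ) ^ 2 - 8 * (Om q).card := by
    by_contra! hcon
    have hQne : Q.Nonempty := by rw [← Finset.card_pos, ← hPQ]; exact hP.card_pos
    have h1 := Finset.sum_lt_sum_of_nonempty hQne hcon
    rw [Finset.sum_sub_distrib, ← Finset.mul_sum, Finset.sum_const, nsmul_eq_mul, hQN] at h1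
    have h2 := sq_sum_le_card_mul_sum_sq (s := Q) (f := fun q => ((Nb q).card : ℝ))
    rw [hsum, hQN] at h2
    set e : ℝ := (((P ×ˢ Q).filter (fun z => z.1 + z.2 ∈ A)).card : ℝ)
    have h3 : N ^ 2 / K ≤ e := by rw [div_le_iff₀ hK0]; linarith
    have h4 : (N ^ 2 / K) ^ 2 ≤ e ^ 2 := pow_le_pow_left₀ (by positivity) h3 2
    have h5 : N ^ 3 / K ^ 2 ≤ ∑ q ∈ Q, ((Nb q).card : ℝ) ^ 2 := by
      have : N * (N ^ 3 / K ^ 2) ≤ N * ∑ q ∈ Q, ((Nb q).card : ℝ) ^ 2 := by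
        refine le_trans (le_of_eq ?_) (h4.trans h2)
        field_simp
      exact le_of_mul_le_mul_left this hN0
    have e1 : N * (N ^ 2 / (2 * K ^ 2)) = N ^ 3 / K ^ 2 - 8 * (N ^ 2 * t) := by
      rw [ht]; field_simp; norm_num
    linarith
  obtain ⟨q, hq, hq1⟩ := hex
  set D := Nb q with hD
  have hDN : N / (2 * K) ≤ D.card := by
    apply le_of_sq_le_sq _ (by positivity)
    have : (N / (2 * K)) ^ 2 ≤ N ^ 2 / (2 * K ^ 2) := by
      rw [div_pow, mul_pow]
      apply div_le_div_of_nonneg_left (by positivity) (by positivity)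
      have : 0 < K ^ 2 := by positivity
      linarith
    have : (0 : ℝ) ≤ (Om q).card := by positivity
    linarith
  have hD0 : (0 : ℝ) < D.card := lt_of_lt_of_le (by positivity) hDN
  have hOm2 : 8 * ((Om q).card : ℝ) ≤ (D.card : ℝ) ^ 2 := by
    have : 0 ≤ N ^ 2 / (2 * K ^ 2) := by positivity
    linarith
  let bd : G → Finset G := fun a => D.filter (fun b => ¬ good a b)
  set A' := D.filter (fun a => 4 * ((bd a).card : ℝ) ≤ D.card) with hA'
  have hA'D : (D.card : ℝ) / 2 ≤ A'.card := by
    have h1 : ((Om q).card : ℝ) = ∑ a ∈ D, ((bd a).card : ℝ) := by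
      norm_cast
      simp only [Om, bd, Finset.card_filter]
      rw [Finset.sum_product]
    have h2 : ∑ a ∈ D.filter (fun a => ¬ 4 * ((bd a).card : ℝ) ≤ D.card), (D.card / 4 : ℝ) ≤
        ∑ a ∈ D, ((bd a).card : ℝ) := by
      refine le_trans ?_ (Finset.sum_le_sum_of_subset_of_nonneg (Finset.filter_subset
        (fun a => ¬ 4 * ((bd a).card : ℝ) ≤ D.card) _) (fun _ _ _ => by positivity))
      apply Finset.sum_le_sum
      intro a ha
      have := (Finset.mem_filter.1 ha).2
      linarith
    rw [Finset.sum_const, nsmul_eq_mul] at h2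
    have h3 : (D.card : ℝ) = A'.card + (D.filter (fun a => ¬ 4 * ((bd a).card : ℝ) ≤ D.card)).card := by
      rw [← Nat.cast_add, hA', Finset.card_filter_add_card_filter_not]
    set y : ℝ := ((D.filter (fun a => ¬ 4 * ((bd a).card : ℝ) ≤ D.card)).card : ℝ)
    have h4 : y * D.card ≤ (D.card / 2) * D.card := by
      linarith [sq (D.card : ℝ)]
    have := le_of_mul_le_mul_right h4 hD0
    linarith
  have hA'N : N ≤ 4 * K * A'.card := by
    have : N / (2 * K) ≤ 2 * A'.card := by linarith
    rw [div_le_iff₀ (by positivity)] at this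
    linarith
  refine ⟨A', ?_, ?_, hA'N, ?_⟩
  · intro a ha
    exact (Finset.mem_filter.1 ((Finset.mem_filter.1 ha).1)).1
  · rw [← Finset.card_pos]
    have : (0 : ℝ) < A'.card := by linarith
    exact_mod_cast this
  · have hcnt := bsg_count A A' D Q t ht0 good
      (by
        intro a b h
        refine le_trans h (le_of_eq ?_)
        norm_cast
        congr 1
        ext q
        simp only [co, Finset.mem_filter]
        tauto)
      (fun a b h => h)
      (by
        intro a ha
        refine ⟨bd a, Finset.filter_subset _ _, ?_, (Finset.mem_filter.1 ha).2⟩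
        intro b hb hb2
        by_contra h
        exact hb2 (Finset.mem_filter.2 ⟨hb, h⟩))
    have hA4 : (A.card : ℝ) ^ 4 ≤ (2 * N) ^ 4 := by
      apply pow_le_pow_left₀ (by positivity)
      rw [hN]; exact_mod_cast hAP
    have h1 : N / (2 * K) / 2 * (t * t) ≤ D.card / 2 * (t * t) := by gcongr
    have h2 : ((A' - A').card : ℝ) * (N / (2 * K) / 2 * (t * t)) ≤ (2 * N) ^ 4 :=
      (mul_le_mul_of_nonneg_left h1 (by positivity)).trans (hcnt.trans hA4)
    have h3 : N / (2 * K) / 2 * (t * t) = N ^ 3 / (2 ^ 10 * K ^ 5) := by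
      rw [ht]; field_simp; norm_num
    rw [h3] at h2
    have h4 : ((A' - A').card : ℝ) ≤ 2 ^ 14 * K ^ 5 * N := by
      have h5 : ((A' - A').card : ℝ) * (N ^ 3 / (2 ^ 10 * K ^ 5)) ≤
          (2 ^ 14 * K ^ 5 * N) * (N ^ 3 / (2 ^ 10 * K ^ 5)) := by
        refine h2.trans (le_of_eq ?_)
        field_simp
      exact le_of_mul_le_mul_right h5 (by positivity)
    calc _ ≤ 2 ^ 14 * K ^ 5 * N := h4
      _ ≤ 2 ^ 14 * K ^ 5 * (4 * K * A'.card) := by gcongr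
      _ = _ := by ring

end Part8

section Part9

variable {G : Type} [AddCommGroup G] [DecidableEq G] [Fintype G]

theorem sg_count (m l : ℕ) (hm : 1 ≤ m) :
    (((sg (Fin m)).filter (fun σ => (sp σ).card ≤ l)).card : ℝ) ≤ 3 * (2 * m : ℝ) ^ l := by
  have hm1 : (1 : ℝ) ≤ m := by exact_mod_cast hm
  have hm0 : (0 : ℝ) < m := by linarith
  set b : ℝ := 1 / (2 * m) with hb
  have hb0 : 0 ≤ b := by positivity
  have hb1 : b ≤ 1 := by rw [hb, div_le_one (by positivity)]; linarith
  have h1 : (((sg (Fin m)).filter (fun σ => (sp σ).card ≤ l)).card : ℝ) * b ^ l ≤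
      (1 + 2 * b) ^ (Fintype.card (Fin m)) := by
    rw [← sum_sg_pow]
    calc _ = ∑ σ ∈ (sg (Fin m)).filter (fun σ => (sp σ).card ≤ l), b ^ l := by simp
      _ ≤ ∑ σ ∈ (sg (Fin m)).filter (fun σ => (sp σ).card ≤ l), b ^ (sp σ).card := by
        apply Finset.sum_le_sum
        intro σ hσ
        exact pow_le_pow_of_le_one hb0 hb1 (Finset.mem_filter.1 hσ).2
      _ ≤ _ := Finset.sum_le_sum_of_subset_of_nonneg (Finset.filter_subset _ _)
        (fun _ _ _ => by positivity)
  have h2 := one_add_pow_le_exp (y := 2 * b) (by positivity) m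
  have e1 : (m : ℝ) * (2 * b) = 1 := by rw [hb]; field_simp
  rw [e1] at h2
  rw [Fintype.card_fin] at h1
  have h3 := Real.exp_one_lt_d9
  have h4 : b ^ l * (2 * m : ℝ) ^ l = 1 := by
    rw [← mul_pow, hb]
    have : (1 / (2 * m) * (2 * m) : ℝ) = 1 := by field_simp
    rw [this, one_pow]
  calc _ = (((sg (Fin m)).filter (fun σ => (sp σ).card ≤ l)).card : ℝ) * (b ^ l * (2 * m : ℝ) ^ l) := by
        rw [h4, mul_one]
    _ = ((((sg (Fin m)).filter (fun σ => (sp σ).card ≤ l)).card : ℝ) * b ^ l) * (2 * m : ℝ) ^ l := by ring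
    _ ≤ 3 * (2 * m : ℝ) ^ l := by
      apply mul_le_mul_of_nonneg_right _ (by positivity)
      linarith

theorem fiber_pigeon (m : ℕ) (A A1 : Finset G) (hA1 : A1.Nonempty) (σ : Fin m → ℤ)
    (i j : Fin m) (hij : i ≠ j) (K : ℝ)
    (h : ((A1.card : ℝ)) ^ m ≤ K *
      ((Fintype.piFinset (fun _ : Fin m => A1)).filter (fun x => ∑ k, σ k • x k ∈ A)).card) :
    ∃ c : G, (A1.card : ℝ) ^ 2 ≤ K *
      ((A1 ×ˢ A1).filter (fun z => σ i • z.1 + (σ j • z.2 + c) ∈ A)).card := by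
  classical
  by_contra! hcon
  set Xs := (Fintype.piFinset (fun _ : Fin m => A1)).filter (fun x => ∑ k, σ k • x k ∈ A) with hXs
  set Y := Fintype.piFinset (fun k : Fin m => if k = i ∨ k = j then ({0} : Finset G) else A1) with hY
  let r : (Fin m → G) → (Fin m → G) := fun x k => if k = i ∨ k = j then 0 else x k
  have hr : ∀ x ∈ Xs, r x ∈ Y := by
    intro x hx
    rw [hXs, Finset.mem_filter, Fintype.mem_piFinset] at hx
    rw [hY, Fintype.mem_piFinset]
    intro k
    by_cases hk : k = i ∨ k = j
    · simp [r, hk]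
    · simp only [r, if_neg hk]; exact hx.1 k
  have hsum : ∀ x : Fin m → G, ∑ k, σ k • x k = σ i • x i + (σ j • x j + ∑ k, σ k • r x k) := by
    intro x
    have e : ∀ k, σ k • x k = (if k = i then σ i • x i else 0) + ((if k = j then σ j • x j else 0) +
        σ k • r x k) := by
      intro k
      by_cases h1 : k = i
      · subst h1; simp [r, hij]
      · by_cases h2 : k = j
        · subst h2; simp [r, h1]
        · simp [r, h1, h2]
    rw [Finset.sum_congr rfl (fun k _ => e k), Finset.sum_add_distrib, Finset.sum_add_distrib]
    simp
  have hfib : ∀ y ∈ Y, K * ((Xs.filter (fun x => r x = y)).card : ℝ) < (A1.card : ℝ) ^ 2 := by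
    intro y _
    refine lt_of_le_of_lt ?_ (hcon (∑ k, σ k • y k))
    have hK : 0 ≤ K := by
      by_contra hK
      push Not at hK
      have h0 : (0 : ℝ) < (A1.card : ℝ) ^ m := by
        exact pow_pos (by exact_mod_cast hA1.card_pos) m
      have := mul_nonpos_of_nonpos_of_nonneg hK.le (Nat.cast_nonneg (α := ℝ) Xs.card)
      linarith
    apply mul_le_mul_of_nonneg_left _ hK
    norm_cast
    apply Finset.card_le_card_of_injOn (fun x => (x i, x j))
    · intro x hx
      simp only [Finset.coe_filter, Set.mem_ofPred_eq] at hx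
      obtain ⟨hx1, hx2⟩ := hx
      rw [hXs, Finset.mem_filter, Fintype.mem_piFinset] at hx1
      simp only [Finset.coe_filter, Set.mem_ofPred_eq, Finset.mem_product]
      refine ⟨⟨hx1.1 i, hx1.1 j⟩, ?_⟩
      rw [← hx2, ← hsum]
      exact hx1.2
    · intro x hx x' hx' hxx
      simp only [Finset.coe_filter, Set.mem_ofPred_eq] at hx hx'
      simp only [Prod.mk.injEq] at hxx
      funext k
      by_cases h1 : k = i
      · rw [h1]; exact hxx.1
      · by_cases h2 : k = j
        · rw [h2]; exact hxx.2
        · have := congrFun (hx.2.trans hx'.2.symm) k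
          simpa [r, h1, h2] using this
  have hYne : Y.Nonempty := by
    rw [hY, Fintype.piFinset_nonempty]
    intro k
    split_ifs
    · simp
    · exact hA1
  have hYc : (Y.card : ℝ) * (A1.card : ℝ) ^ 2 = (A1.card : ℝ) ^ m := by
    norm_cast
    rw [hY, Fintype.card_piFinset]
    have : ∀ k, (if k = i ∨ k = j then ({0} : Finset G) else A1).card =
        if k = i ∨ k = j then 1 else A1.card := by
      intro k; split_ifs <;> simp
    simp only [this]
    rw [Finset.prod_ite, Finset.prod_const_one, one_mul, Finset.prod_const, ← pow_add]
    congr 1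
    have h1 := Finset.card_filter_add_card_filter_not (s := (Finset.univ : Finset (Fin m))) (fun k => k = i ∨ k = j)
    have h2 : (Finset.univ.filter (fun k : Fin m => k = i ∨ k = j)) = {i, j} := by
      ext k; simp
    rw [h2, Finset.card_pair hij, Finset.card_univ, Fintype.card_fin] at h1
    omega
  have htot := Finset.card_eq_sum_card_fiberwise (s := Xs) (t := Y) (f := r) hr
  have h1 := Finset.sum_lt_sum_of_nonempty hYne hfib
  rw [← Finset.mul_sum, Finset.sum_const, nsmul_eq_mul, hYc] at h1
  have h2 : (Xs.card : ℝ) = ∑ y ∈ Y, ((Xs.filter (fun x => r x = y)).card : ℝ) := by exact_mod_cast htot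
  rw [← h2] at h1
  linarith

/-- Lemma E. -/
theorem lemma_E (c : AddChar G ℂ → ℂ) (n : ℕ) (hn : 1 ≤ n) (hc : ∑ γ, ‖c γ‖ ≤ n)
    (fZ : G → ℤ) (ε : ℝ) (hε : ε ≤ Real.exp (-(20 * n))) (hf : ∀ x, ‖fs c x - fZ x‖ ≤ ε)
    (A : Finset G) (hA : ∀ x, x ∈ A ↔ fZ x ≠ 0) (hne : A.Nonempty) (K1 : ℝ)
    (hK1 : K1 = 3 * (800 * n ^ 2 : ℝ) ^ (80 * n)) :
    ∃ X ⊆ A, X.Nonempty ∧ (A.card : ℝ) ≤ 8 * K1 * X.card ∧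
      ((X - X).card : ℝ) ≤ 2 ^ 16 * K1 ^ 6 * X.card := by
  classical
  have hnr : (1 : ℝ) ≤ n := by exact_mod_cast hn
  have hK1' : 1 ≤ K1 := by
    rw [hK1]
    have h1 : (1 : ℝ) ≤ 800 * n ^ 2 := by
      have : (1 : ℝ) ≤ n ^ 2 := one_le_pow₀ hnr
      linarith
    have := one_le_pow₀ h1 (n := 80 * n)
    linarith
  obtain ⟨m, hm⟩ : ∃ m, m = 400 * n ^ 2 := ⟨_, rfl⟩
  have hm1 : 1 ≤ m := by rw [hm]; have := Nat.one_le_pow 2 n hn; omega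
  -- symmetric or antisymmetric part
  obtain ⟨s, hs, hA1c⟩ : ∃ s : ℤ, (s = 1 ∨ s = -1) ∧
      A.card ≤ 2 * (A.filter (fun x => fZ x + s * fZ (-x) ≠ 0)).card := by
    have hcov : A ⊆ A.filter (fun x => fZ x + 1 * fZ (-x) ≠ 0) ∪
        A.filter (fun x => fZ x + (-1) * fZ (-x) ≠ 0) := by
      intro x hx
      have := (hA x).1 hx
      rw [Finset.mem_union, Finset.mem_filter, Finset.mem_filter]
      by_contra h
      push Not at h
      have h1 := h.1 hx
      have h2 := h.2 hx
      omega
    have h1 := (Finset.card_le_card hcov).trans (Finset.card_union_le _ _)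
    by_cases h : A.card ≤ 2 * (A.filter (fun x => fZ x + 1 * fZ (-x) ≠ 0)).card
    · exact ⟨1, Or.inl rfl, h⟩
    · exact ⟨-1, Or.inr rfl, by omega⟩
  set A1 := A.filter (fun x => fZ x + s * fZ (-x) ≠ 0) with hA1
  have hA1ne : A1.Nonempty := by
    rw [← Finset.card_pos]; have := hne.card_pos; omega
  -- pigeonhole for the sign pattern
  set S := (sg (Fin m)).filter (fun σ => 2 ≤ (sp σ).card ∧ (sp σ).card ≤ 80 * n) with hS
  have hScard : (S.card : ℝ) ≤ K1 := by
    have h1 : S.card ≤ ((sg (Fin m)).filter (fun σ => (sp σ).card ≤ 80 * n)).card := by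
      apply Finset.card_le_card
      intro σ hσ
      rw [hS, Finset.mem_filter] at hσ
      exact Finset.mem_filter.2 ⟨hσ.1, hσ.2.2⟩
    have h2 := sg_count m (80 * n) hm1
    rw [hK1]
    have e : (2 * m : ℝ) = 800 * n ^ 2 := by rw [hm]; push_cast; ring
    rw [e] at h2
    exact le_trans (by exact_mod_cast h1) h2
  obtain ⟨σ, hσ, hσc⟩ : ∃ σ ∈ S, ((A1.card : ℝ)) ^ m ≤ K1 *
      ((Fintype.piFinset (fun _ : Fin m => A1)).filter (fun x => ∑ k, σ k • x k ∈ A)).card := by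
    by_contra! hcon
    have hcov : Fintype.piFinset (fun _ : Fin m => A1) ⊆ S.biUnion (fun σ =>
        (Fintype.piFinset (fun _ : Fin m => A1)).filter (fun x => ∑ k, σ k • x k ∈ A)) := by
      intro x hx
      have hx' := Fintype.mem_piFinset.1 hx
      obtain ⟨σ, h1, h2, h3, h4⟩ := connectivity c n hn hc fZ ε hε hf A hA s hs m hm x
        (fun j => (Finset.mem_filter.1 (hx' j)).2)
      rw [Finset.mem_biUnion]
      exact ⟨σ, Finset.mem_filter.2 ⟨h1, h2, h3⟩, Finset.mem_filter.2 ⟨hx, h4⟩⟩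
    have hcc := (Finset.card_le_card hcov).trans Finset.card_biUnion_le
    rw [Fintype.card_piFinset, Finset.prod_const, Finset.card_univ, Fintype.card_fin] at hcc
    have hcr : (A1.card : ℝ) ^ m ≤ ∑ σ ∈ S,
      (((Fintype.piFinset (fun _ : Fin m => A1)).filter (fun x => ∑ k, σ k • x k ∈ A)).card : ℝ) := by
      exact_mod_cast hcc
    have hpos : (0 : ℝ) < (A1.card : ℝ) ^ m := by have := hA1ne.card_pos; positivity
    have hSne : S.Nonempty := by
      rw [Finset.nonempty_iff_ne_empty]
      rintro h
      rw [h, Finset.sum_empty] at hcr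
      linarith
    have h1 := Finset.sum_lt_sum_of_nonempty hSne hcon
    rw [← Finset.mul_sum, Finset.sum_const, nsmul_eq_mul] at h1
    have h2 : (S.card : ℝ) * (A1.card : ℝ) ^ m ≤ K1 * (A1.card : ℝ) ^ m := by gcongr
    have h3 := mul_le_mul_of_nonneg_left hcr (by linarith : (0 : ℝ) ≤ K1)
    linarith
  rw [hS, Finset.mem_filter] at hσ
  obtain ⟨i, hi, j, hj, hij⟩ := Finset.one_lt_card.1 hσ.2.1
  obtain ⟨d, hd⟩ := fiber_pigeon m A A1 hA1ne σ i j hij K1 hσc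
  have hunit : ∀ k ∈ sp σ, σ k = 1 ∨ σ k = -1 := by
    intro k hk
    have h1 := mem_sg.1 hσ.1 k
    have h2 := (Finset.mem_filter.1 hk).2
    tauto
  have hinv : ∀ k ∈ sp σ, ∀ x : G, σ k • (σ k • x) = x := by
    intro k hk x
    rcases hunit k hk with h | h <;> simp [h]
  have hinji : Function.Injective (fun x : G => σ i • x) :=
    Function.LeftInverse.injective (g := fun x : G => σ i • x) (hinv i hi)
  have hinjj : Function.Injective (fun x : G => σ j • x + d) := by
    intro x y hxy
    have := add_right_cancel hxy
    exact Function.LeftInverse.injective (g := fun x : G => σ j • x) (hinv j hj) this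
  set P := A1.image (fun x => σ i • x) with hP
  set Q := A1.image (fun x => σ j • x + d) with hQ
  have hPc : P.card = A1.card := Finset.card_image_of_injective _ hinji
  have hQc : Q.card = A1.card := Finset.card_image_of_injective _ hinjj
  obtain ⟨A', hA'P, hA'ne, hA'1, hA'2⟩ := bsg A P Q (by rw [hPc, hQc]) (hA1ne.image _)
    (by rw [hPc]; exact hA1c) K1 hK1'
    (by
      rw [hPc]
      refine hd.trans ?_
      apply mul_le_mul_of_nonneg_left _ (by linarith)
      norm_cast
      apply Finset.card_le_card_of_injOn (fun z => (σ i • z.1, σ j • z.2 + d))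
      · intro z hz
        simp only [Finset.coe_filter, Set.mem_ofPred_eq, Finset.mem_product] at hz ⊢
        exact ⟨⟨Finset.mem_image_of_mem _ hz.1.1, Finset.mem_image_of_mem (fun x => σ j • x + d) hz.1.2⟩, hz.2⟩
      · intro z _ z' _ h
        simp only [Prod.mk.injEq] at h
        exact Prod.ext (hinji h.1) (hinjj h.2))
  set X := A'.image (fun x => σ i • x) with hX
  have hXc : X.card = A'.card := Finset.card_image_of_injective _ hinji
  refine ⟨X, ?_, hA'ne.image _, ?_, ?_⟩
  · intro x hx
    obtain ⟨y, hy, rfl⟩ := Finset.mem_image.1 hx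
    obtain ⟨w, hw, rfl⟩ := Finset.mem_image.1 (hA'P hy)
    simp only [hinv i hi]
    exact (Finset.mem_filter.1 hw).1
  · rw [hXc]
    rw [hPc] at hA'1
    have : (A.card : ℝ) ≤ 2 * A1.card := by exact_mod_cast hA1c
    linarith
  · rw [hXc]
    refine le_trans ?_ hA'2
    norm_cast
    have : X - X ⊆ (A' - A').image (fun x => σ i • x) := by
      intro z hz
      obtain ⟨x, hx, y, hy, rfl⟩ := Finset.mem_sub.1 hz
      obtain ⟨x', hx', rfl⟩ := Finset.mem_image.1 hx
      obtain ⟨y', hy', rfl⟩ := Finset.mem_image.1 hy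
      refine Finset.mem_image.2 ⟨x' - y', Finset.sub_mem_sub hx' hy', ?_⟩
      simp [smul_sub]
    exact (Finset.card_le_card this).trans Finset.card_image_le

end Part9

section Part10

variable {G : Type} [AddCommGroup G] [DecidableEq G] [Fintype G]

theorem exp_le_cosh_sinh (a y : ℝ) (hy : |y| ≤ 1) :
    Real.exp (a * y) ≤ Real.cosh a + y * Real.sinh a := by
  obtain ⟨h1, h2⟩ := abs_le.1 hy
  have h := convexOn_exp.2 (Set.mem_univ a) (Set.mem_univ (-a)) (by linarith : 0 ≤ (1 + y) / 2)
    (by linarith : 0 ≤ (1 - y) / 2) (by ring)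
  simp only [smul_eq_mul] at h
  have e : (1 + y) / 2 * a + (1 - y) / 2 * -a = a * y := by ring
  rw [e] at h
  rw [Real.cosh_eq, Real.sinh_eq]
  linarith

/-- `S` is dissociated relative to the weight `β`, with error `ξ`. -/
def Diss (β : G → ℝ) (ξ : ℝ) (S : Finset (AddChar G ℂ)) : Prop :=
  ∀ σ : AddChar G ℂ → ℤ, (∀ γ, σ γ = -1 ∨ σ γ = 0 ∨ σ γ = 1) → σ ≠ 0 → (∀ γ, σ γ ≠ 0 → γ ∈ S) →
    ‖∑ u, (β u : ℂ) * ∏ γ : AddChar G ℂ, γ (σ γ • u)‖ ≤ ξ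

theorem rudin (β : G → ℝ) (hβ : ∀ u, 0 ≤ β u) (hβ1 : ∑ u, β u = 1) (s : ℕ)
    (S : Finset (AddChar G ℂ)) (hS : Diss β ((1 / 2 : ℝ) ^ s) S) (hSs : S.card ≤ s)
    (ω : AddChar G ℂ → ℂ) (hω : ∀ γ, ‖ω γ‖ = 1) (a : ℝ) (ha : 0 ≤ a) :
    ∑ u, β u * Real.exp (a * (∑ γ ∈ S, ω γ * γ u).re) ≤ 2 * Real.exp (S.card * a ^ 2 / 2) := by
  classical
  set m := S.card with hm
  set ξ : ℝ := (1 / 2 : ℝ) ^ s with hξ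
  have hch0 : 0 < Real.cosh a := Real.cosh_pos a
  have hsh0 : 0 ≤ Real.sinh a := Real.sinh_nonneg_iff.2 ha
  let A : AddChar G ℂ → ℤ → ℂ := fun γ t =>
    if γ ∈ S then (if t = 0 then (Real.cosh a : ℂ) else if t = 1 then (Real.sinh a / 2 : ℝ) * ω γ
      else (Real.sinh a / 2 : ℝ) * (starRingEnd ℂ) (ω γ)) else (if t = 0 then 1 else 0)
  have A0 : ∀ γ ∈ S, A γ 0 = Real.cosh a := by intro γ h; simp [A, h]
  have A1 : ∀ γ ∈ S, A γ 1 = (Real.sinh a / 2 : ℝ) * ω γ := by intro γ h; simp [A, h]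
  have Am : ∀ γ ∈ S, A γ (-1) = (Real.sinh a / 2 : ℝ) * (starRingEnd ℂ) (ω γ) := by
    intro γ h; simp [A, h]
  have B0 : ∀ γ ∉ S, A γ 0 = 1 := by intro γ h; simp [A, h]
  have B1 : ∀ γ ∉ S, ∀ t ≠ 0, A γ t = 0 := by intro γ h t ht; simp [A, h, ht]
  -- pointwise bound
  have hpt : ∀ u, (Real.exp (a * (∑ γ ∈ S, ω γ * γ u).re) : ℝ) ≤
      (∑ σ ∈ sg (AddChar G ℂ), ∏ γ, (A γ (σ γ) * γ (σ γ • u))).re := by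
    intro u
    rw [sum_sg (fun (γ : AddChar G ℂ) t => A γ t * γ (t • u))]
    have hfac : ∀ γ ∈ S, A γ (-1) * γ ((-1 : ℤ) • u) + A γ 0 * γ ((0 : ℤ) • u) + A γ 1 * γ ((1 : ℤ) • u)
        = ((Real.cosh a + (ω γ * γ u).re * Real.sinh a : ℝ) : ℂ) := by
      intro γ hγ
      rw [A0 γ hγ, A1 γ hγ, Am γ hγ]
      simp only [neg_smul, one_smul, zero_smul, AddChar.map_zero_eq_one, mul_one]
      rw [AddChar.map_neg_eq_conj]
      have := Complex.add_conj (ω γ * γ u)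
      rw [map_mul] at this
      push_cast at this ⊢
      linear_combination ((Complex.sinh a) / 2) * this
    have hfac2 : ∀ γ ∉ S, A γ (-1) * γ ((-1 : ℤ) • u) + A γ 0 * γ ((0 : ℤ) • u) + A γ 1 * γ ((1 : ℤ) • u)
        = 1 := by
      intro γ hγ
      rw [B0 γ hγ, B1 γ hγ 1 (by norm_num), B1 γ hγ (-1) (by norm_num)]
      simp
    rw [← Finset.prod_subset (Finset.subset_univ S) (fun γ _ h => hfac2 γ h),
      Finset.prod_congr rfl hfac, ← Complex.ofReal_prod, Complex.ofReal_re, Complex.re_sum,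
      Finset.mul_sum, Real.exp_sum]
    apply Finset.prod_le_prod
    · intro γ _; positivity
    · intro γ _
      apply exp_le_cosh_sinh
      refine (Complex.abs_re_le_norm _).trans ?_
      rw [norm_mul, hω, AddChar.norm_apply, mul_one]
  -- sum of norms
  have hnorm : ∑ σ ∈ sg (AddChar G ℂ), ∏ γ, ‖A γ (σ γ)‖ = Real.exp (a * m) := by
    rw [sum_sg (fun γ t => ‖A γ t‖)]
    rw [← Finset.prod_subset (Finset.subset_univ S)]
    · rw [mul_comm, Real.exp_nat_mul, hm, ← Finset.prod_const]
      apply Finset.prod_congr rfl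
      intro γ hγ
      rw [A0 γ hγ, A1 γ hγ, Am γ hγ, norm_mul, norm_mul, RCLike.norm_conj, hω, Complex.norm_real,
        Complex.norm_real, Real.norm_eq_abs, Real.norm_eq_abs, abs_of_pos hch0,
        abs_of_nonneg (by positivity), ← Real.cosh_add_sinh]
      ring
    · intro γ _ hγ
      rw [B0 γ hγ, B1 γ hγ 1 (by norm_num), B1 γ hγ (-1) (by norm_num)]
      simp
  have hterm : ∀ σ ∈ sg (AddChar G ℂ), ‖∑ u, (β u : ℂ) * ∏ γ, (A γ (σ γ) * γ (σ γ • u))‖ ≤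
      (if σ = 0 then Real.cosh a ^ m else 0) + ξ * ∏ γ, ‖A γ (σ γ)‖ := by
    intro σ hσ
    have hp : 0 ≤ ξ * ∏ γ, ‖A γ (σ γ)‖ := by
      apply mul_nonneg (by positivity)
      exact Finset.prod_nonneg (fun _ _ => norm_nonneg _)
    have e : ∑ u, (β u : ℂ) * ∏ γ, (A γ (σ γ) * γ (σ γ • u)) =
        (∏ γ, A γ (σ γ)) * ∑ u, (β u : ℂ) * ∏ γ : AddChar G ℂ, γ (σ γ • u) := by
      rw [Finset.mul_sum]
      apply Finset.sum_congr rfl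
      intro u _
      rw [Finset.prod_mul_distrib]; ring
    rw [e, norm_mul, norm_prod]
    by_cases hz : σ = 0
    · rw [if_pos hz]
      subst hz
      have h1 : ∏ γ, ‖A γ ((0 : AddChar G ℂ → ℤ) γ)‖ = Real.cosh a ^ m := by
        rw [← Finset.prod_subset (Finset.subset_univ S)]
        · rw [hm, ← Finset.prod_const]
          apply Finset.prod_congr rfl
          intro γ hγ
          rw [Pi.zero_apply, A0 γ hγ, Complex.norm_real, Real.norm_eq_abs, abs_of_pos hch0]
        · intro γ _ hγ
          rw [Pi.zero_apply, B0 γ hγ]; simp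
      have h2 : ‖∑ u, (β u : ℂ) * ∏ γ : AddChar G ℂ, γ ((0 : AddChar G ℂ → ℤ) γ • u)‖ = 1 := by
        simp only [Pi.zero_apply, zero_smul, AddChar.map_zero_eq_one, Finset.prod_const_one, mul_one]
        rw [← Complex.ofReal_sum, hβ1]; simp
      rw [h2, mul_one]
      linarith
    · rw [if_neg hz, zero_add, mul_comm]
      by_cases hsup : ∀ γ, σ γ ≠ 0 → γ ∈ S
      · exact mul_le_mul_of_nonneg_right (hS σ (mem_sg.1 hσ) hz hsup)
          (Finset.prod_nonneg (fun _ _ => norm_nonneg _))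
      · push Not at hsup
        obtain ⟨γ, h1, h2⟩ := hsup
        have : ∏ γ, ‖A γ (σ γ)‖ = 0 := by
          apply Finset.prod_eq_zero (Finset.mem_univ γ)
          rw [B1 γ h2 _ h1]; simp
        rw [this]; simp
  have hmain : ∑ u, β u * Real.exp (a * (∑ γ ∈ S, ω γ * γ u).re) ≤
      Real.cosh a ^ m + ξ * Real.exp (a * m) := by
    calc _ ≤ ∑ u, β u * (∑ σ ∈ sg (AddChar G ℂ), ∏ γ, (A γ (σ γ) * γ (σ γ • u))).re :=
          Finset.sum_le_sum (fun u _ => mul_le_mul_of_nonneg_left (hpt u) (hβ u))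
      _ = (∑ σ ∈ sg (AddChar G ℂ), ∑ u, (β u : ℂ) * ∏ γ, (A γ (σ γ) * γ (σ γ • u))).re := by
          rw [Finset.sum_comm]
          simp only [← Finset.mul_sum]
          rw [Complex.re_sum]
          apply Finset.sum_congr rfl
          intro u _
          rw [Complex.re_ofReal_mul]
      _ ≤ ‖∑ σ ∈ sg (AddChar G ℂ), ∑ u, (β u : ℂ) * ∏ γ, (A γ (σ γ) * γ (σ γ • u))‖ :=
          Complex.re_le_norm _
      _ ≤ ∑ σ ∈ sg (AddChar G ℂ), ((if σ = 0 then Real.cosh a ^ m else 0) + ξ * ∏ γ, ‖A γ (σ γ)‖) :=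
          (norm_sum_le _ _).trans (Finset.sum_le_sum hterm)
      _ ≤ _ := by
          rw [Finset.sum_add_distrib, ← Finset.mul_sum, hnorm, Finset.sum_ite_eq']
          have : 0 ≤ Real.cosh a ^ m := by positivity
          split_ifs <;> linarith
  have h1 : Real.cosh a ^ m ≤ Real.exp (m * a ^ 2 / 2) := by
    rw [mul_div_assoc, Real.exp_nat_mul]
    exact pow_le_pow_left₀ hch0.le (Real.cosh_le_exp_half_sq a) _
  have h2 : ξ * Real.exp (a * m) ≤ Real.exp (m * a ^ 2 / 2) := by
    have e1 : ξ ≤ Real.exp (-(m / 2)) := by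
      calc ξ ≤ (1 / 2 : ℝ) ^ m := by
            rw [hξ]; exact pow_le_pow_of_le_one (by norm_num) (by norm_num) hSs
        _ ≤ (Real.exp (-(1 / 2))) ^ m := by
            apply pow_le_pow_left₀ (by norm_num)
            have := Real.add_one_le_exp (-(1 / 2) : ℝ)
            linarith
        _ = _ := by rw [← Real.exp_nat_mul]; congr 1; ring
    calc ξ * Real.exp (a * m) ≤ Real.exp (-(m / 2)) * Real.exp (a * m) := by gcongr
      _ = Real.exp (-(m / 2) + a * m) := (Real.exp_add _ _).symm
      _ ≤ _ := by
        apply Real.exp_le_exp.2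
        have : 0 ≤ (m : ℝ) * (a - 1) ^ 2 := mul_nonneg (Nat.cast_nonneg m) (sq_nonneg _)
        linarith
  linarith

/-- The class of subgaussian weights. -/
def Lc (β : G → ℝ) (m : ℕ) (v : AddChar G ℂ → ℝ) : Prop :=
  (∀ γ, 0 ≤ v γ) ∧ ∀ ω : AddChar G ℂ → ℂ, (∀ γ, ‖ω γ‖ = 1) → ∀ θ : ℝ, 0 ≤ θ →
    ∑ u, β u * Real.exp (θ * (∑ γ, v γ * (ω γ * γ u)).re) ≤
      2 * Real.exp (θ ^ 2 * (∑ γ, v γ) ^ 2 / (2 * m))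

theorem Lc_zero (β : G → ℝ) (hβ1 : ∑ u, β u = 1) (m : ℕ) : Lc β m 0 := by
  refine ⟨fun _ => le_rfl, fun ω _ θ _ => ?_⟩
  simp [hβ1]

theorem Lc_ind (β : G → ℝ) (hβ : ∀ u, 0 ≤ β u) (hβ1 : ∑ u, β u = 1) (s : ℕ)
    (S : Finset (AddChar G ℂ)) (hS : Diss β ((1 / 2 : ℝ) ^ s) S) (hSs : S.card ≤ s) (hS1 : 1 ≤ S.card)
    (t : ℝ) (ht : 0 ≤ t) [DecidableEq (AddChar G ℂ)] :
    Lc β S.card (fun γ => if γ ∈ S then t else 0) := by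
  refine ⟨fun γ => ?_, fun ω hω θ hθ => ?_⟩
  · dsimp only
    split_ifs <;> simp [ht]
  · have h := rudin β hβ hβ1 s S hS hSs ω hω (θ * t) (by positivity)
    have hS0 : (S.card : ℝ) ≠ 0 := by positivity
    have e1 : ∑ γ : AddChar G ℂ, (if γ ∈ S then t else 0) = S.card * t := by
      rw [Finset.sum_ite_mem]; simp
    have e2 : ∀ u, (∑ γ : AddChar G ℂ, ((if γ ∈ S then t else 0 : ℝ) : ℂ) * (ω γ * γ u)).re =
        t * (∑ γ ∈ S, ω γ * γ u).re := by
      intro u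
      have : ∀ γ : AddChar G ℂ, ((if γ ∈ S then t else 0 : ℝ) : ℂ) * (ω γ * γ u) =
          if γ ∈ S then (t : ℂ) * (ω γ * γ u) else 0 := by
        intro γ; split_ifs <;> simp
      simp only [this]
      rw [Finset.sum_ite_mem, Finset.univ_inter, ← Finset.mul_sum, Complex.re_ofReal_mul]
    have e3 : θ ^ 2 * ((S.card : ℝ) * t) ^ 2 / (2 * (S.card : ℝ)) = S.card * (θ * t) ^ 2 / 2 := by
      field_simp
    simp only [e1, e2, e3]
    simp only [← mul_assoc]
    exact h

theorem Lc_add (β : G → ℝ) (hβ : ∀ u, 0 ≤ β u) (m : ℕ) (v w : AddChar G ℂ → ℝ)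
    (hv : Lc β m v) (hw : Lc β m w) : Lc β m (v + w) := by
  have hz : ∀ v : AddChar G ℂ → ℝ, (∀ γ, 0 ≤ v γ) → ∑ γ, v γ = 0 → v = 0 := by
    intro v hv h
    funext γ
    exact (Finset.sum_eq_zero_iff_of_nonneg (fun γ _ => hv γ)).1 h γ (Finset.mem_univ _)
  by_cases h1 : ∑ γ, v γ = 0
  · rw [hz v hv.1 h1, zero_add]; exact hw
  by_cases h2 : ∑ γ, w γ = 0
  · rw [hz w hw.1 h2, add_zero]; exact hv
  refine ⟨fun γ => add_nonneg (hv.1 γ) (hw.1 γ), fun ω hω θ hθ => ?_⟩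
  obtain ⟨M1, hM1⟩ : ∃ M1, M1 = ∑ γ, v γ := ⟨_, rfl⟩
  obtain ⟨M2, hM2⟩ : ∃ M2, M2 = ∑ γ, w γ := ⟨_, rfl⟩
  have p1 : 0 < M1 := by
    rw [hM1]; exact lt_of_le_of_ne (Finset.sum_nonneg (fun γ _ => hv.1 γ)) (Ne.symm h1)
  have p2 : 0 < M2 := by
    rw [hM2]; exact lt_of_le_of_ne (Finset.sum_nonneg (fun γ _ => hw.1 γ)) (Ne.symm h2)
  have eM : ∑ γ, (v + w) γ = M1 + M2 := by
    simp only [Pi.add_apply]; rw [Finset.sum_add_distrib, hM1, hM2]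
  rw [eM]
  obtain ⟨l, hl⟩ : ∃ l, l = M1 / (M1 + M2) := ⟨_, rfl⟩
  have hl0 : 0 < l := by rw [hl]; positivity
  have hl1 : 1 - l = M2 / (M1 + M2) := by rw [hl]; field_simp; ring
  have hl2 : 0 < 1 - l := by rw [hl1]; positivity
  have b1 := hv.2 ω hω (θ / l) (by positivity)
  have b2 := hw.2 ω hω (θ / (1 - l)) (by positivity)
  rw [← hM1] at b1
  rw [← hM2] at b2
  have q1 : (θ / l) ^ 2 * M1 ^ 2 = θ ^ 2 * (M1 + M2) ^ 2 := by rw [hl]; field_simp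
  have q2 : (θ / (1 - l)) ^ 2 * M2 ^ 2 = θ ^ 2 * (M1 + M2) ^ 2 := by rw [hl1]; field_simp
  rw [q1] at b1
  rw [q2] at b2
  have hpt : ∀ u, Real.exp (θ * (∑ γ, ((v + w) γ : ℂ) * (ω γ * γ u)).re) ≤
      l * Real.exp (θ / l * (∑ γ, (v γ : ℂ) * (ω γ * γ u)).re) +
      (1 - l) * Real.exp (θ / (1 - l) * (∑ γ, (w γ : ℂ) * (ω γ * γ u)).re) := by
    intro u
    have h := convexOn_exp.2 (Set.mem_univ (θ / l * (∑ γ, (v γ : ℂ) * (ω γ * γ u)).re))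
      (Set.mem_univ (θ / (1 - l) * (∑ γ, (w γ : ℂ) * (ω γ * γ u)).re)) hl0.le hl2.le (by ring)
    simp only [smul_eq_mul] at h
    refine le_trans (le_of_eq ?_) h
    congr 1
    have : ∑ γ, ((v + w) γ : ℂ) * (ω γ * γ u) = ∑ γ, (v γ : ℂ) * (ω γ * γ u) +
        ∑ γ, (w γ : ℂ) * (ω γ * γ u) := by
      rw [← Finset.sum_add_distrib]
      apply Finset.sum_congr rfl
      intro γ _
      simp only [Pi.add_apply]; push_cast; ring
    rw [this, Complex.add_re]
    field_simp
  set E := 2 * Real.exp (θ ^ 2 * (M1 + M2) ^ 2 / (2 * m))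
  calc _ ≤ ∑ u, β u * (l * Real.exp (θ / l * (∑ γ, (v γ : ℂ) * (ω γ * γ u)).re) +
      (1 - l) * Real.exp (θ / (1 - l) * (∑ γ, (w γ : ℂ) * (ω γ * γ u)).re)) :=
        Finset.sum_le_sum (fun u _ => mul_le_mul_of_nonneg_left (hpt u) (hβ u))
    _ = l * ∑ u, β u * Real.exp (θ / l * (∑ γ, (v γ : ℂ) * (ω γ * γ u)).re) +
      (1 - l) * ∑ u, β u * Real.exp (θ / (1 - l) * (∑ γ, (w γ : ℂ) * (ω γ * γ u)).re) := by
        rw [Finset.mul_sum, Finset.mul_sum, ← Finset.sum_add_distrib]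
        apply Finset.sum_congr rfl
        intro u _; ring
    _ ≤ l * E + (1 - l) * E := by gcongr
    _ = E := by ring

theorem extraction (β : G → ℝ) (hβ : ∀ u, 0 ≤ β u) (hβ1 : ∑ u, β u = 1) (s m : ℕ) (hm : 1 ≤ m)
    (hms : m ≤ s) : ∀ (k : ℕ) (w : AddChar G ℂ → ℝ), (∀ γ, 0 ≤ w γ) →
      (Finset.univ.filter (fun γ => w γ ≠ 0)).card ≤ k →
      ∃ w' : AddChar G ℂ → ℝ, (∀ γ, 0 ≤ w' γ ∧ w' γ ≤ w γ) ∧ Lc β m (w - w') ∧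
        ∀ S : Finset (AddChar G ℂ), (∀ γ ∈ S, w' γ ≠ 0) → S.card = m → ¬ Diss β ((1 / 2 : ℝ) ^ s) S := by
  classical
  intro k
  induction k with
  | zero =>
    intro w hw hk
    refine ⟨w, fun γ => ⟨hw γ, le_rfl⟩, by rw [sub_self]; exact Lc_zero β hβ1 m, ?_⟩
    intro S hS hSm _
    obtain ⟨γ, hγ⟩ : S.Nonempty := by rw [← Finset.card_pos]; omega
    have h1 : γ ∈ Finset.univ.filter (fun γ => w γ ≠ 0) := Finset.mem_filter.2 ⟨Finset.mem_univ _, hS γ hγ⟩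
    have := Finset.card_pos.2 ⟨γ, h1⟩
    omega
  | succ k ih =>
    intro w hw hk
    by_cases hex : ∃ S : Finset (AddChar G ℂ), (∀ γ ∈ S, w γ ≠ 0) ∧ S.card = m ∧ Diss β ((1 / 2 : ℝ) ^ s) S
    · obtain ⟨S, hS1, hS2, hS3⟩ := hex
      have hSne : S.Nonempty := by rw [← Finset.card_pos]; omega
      obtain ⟨γ0, hγ0, hmin⟩ := Finset.exists_min_image S w hSne
      set t := w γ0 with ht
      have ht0 : 0 ≤ t := hw γ0
      let v : AddChar G ℂ → ℝ := fun γ => if γ ∈ S then t else 0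
      have hvL : Lc β m v := by
        have := Lc_ind β hβ hβ1 s S hS3 (by omega) (by omega) t ht0
        rw [hS2] at this
        exact this
      have hvw : ∀ γ, v γ ≤ w γ := by
        intro γ
        by_cases h : γ ∈ S
        · simp only [v, if_pos h]; exact hmin γ h
        · simp only [v, if_neg h]; exact hw γ
      obtain ⟨w', h1, h2, h3⟩ := ih (w - v) (fun γ => by simpa using hvw γ) (by
        have : Finset.univ.filter (fun γ => (w - v) γ ≠ 0) ⊂ Finset.univ.filter (fun γ => w γ ≠ 0) := by
          rw [Finset.ssubset_iff_of_subset]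
          · refine ⟨γ0, Finset.mem_filter.2 ⟨Finset.mem_univ _, hS1 γ0 hγ0⟩, ?_⟩
            simp [v, hγ0, ht]
          · intro γ hγ
            rw [Finset.mem_filter] at hγ ⊢
            refine ⟨Finset.mem_univ _, ?_⟩
            intro h0
            apply hγ.2
            have hnS : γ ∉ S := fun h => hS1 γ h h0
            simp [v, hnS, h0]
        have := Finset.card_lt_card this
        omega)
      refine ⟨w', fun γ => ⟨(h1 γ).1, ?_⟩, ?_, h3⟩
      · have := (h1 γ).2
        have h5 := hvL.1 γ
        simp only [Pi.sub_apply] at this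
        linarith
      · have e : w - w' = (w - v - w') + v := by abel
        rw [e]
        exact Lc_add β hβ m _ _ h2 hvL
    · refine ⟨w, fun γ => ⟨hw γ, le_rfl⟩, by rw [sub_self]; exact Lc_zero β hβ1 m, ?_⟩
      intro S hS hSm hD
      exact hex ⟨S, hS, hSm, hD⟩

theorem tail (β : G → ℝ) (hβ : ∀ u, 0 ≤ β u) (m : ℕ) (hm : 1 ≤ m) (v : AddChar G ℂ → ℝ)
    (hv : Lc β m v) (a : ℝ) (ha : 0 < a) (hva : ∑ γ, v γ ≤ a) (τ : ℝ) (hτ : 0 ≤ τ)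
    (ω : AddChar G ℂ → ℂ) (hω : ∀ γ, ‖ω γ‖ = 1) :
    ∑ u with τ < ‖∑ γ, (v γ : ℂ) * (ω γ * γ u)‖, β u ≤ 8 * Real.exp (-(τ ^ 2 * m / (8 * a ^ 2))) := by
  classical
  have hm0 : (0 : ℝ) < m := by exact_mod_cast hm
  obtain ⟨θ, hθ⟩ : ∃ θ : ℝ, θ = τ * m / (2 * a ^ 2) := ⟨_, rfl⟩
  have hθ0 : 0 ≤ θ := by rw [hθ]; positivity
  have hv0 : 0 ≤ ∑ γ, v γ := Finset.sum_nonneg (fun γ _ => hv.1 γ)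
  have hE : ∀ i, ∑ u, β u * Real.exp (θ * (th i * ∑ γ, (v γ : ℂ) * (ω γ * γ u)).re) ≤
      2 * Real.exp (θ ^ 2 * a ^ 2 / (2 * m)) := by
    intro i
    have h := hv.2 (fun γ => th i * ω γ) (fun γ => by rw [norm_mul, th_norm, hω, mul_one]) θ hθ0
    have e : ∀ u, ∑ γ, (v γ : ℂ) * (th i * ω γ * γ u) = th i * ∑ γ, (v γ : ℂ) * (ω γ * γ u) := by
      intro u; rw [Finset.mul_sum]; apply Finset.sum_congr rfl; intro γ _; ring
    simp only [e] at h
    refine h.trans ?_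
    gcongr
  have hpt : ∀ u, (if τ < ‖∑ γ, (v γ : ℂ) * (ω γ * γ u)‖ then (1 : ℝ) else 0) ≤
      ∑ i, Real.exp (-(θ * (τ / 2))) * Real.exp (θ * (th i * ∑ γ, (v γ : ℂ) * (ω γ * γ u)).re) := by
    intro u
    have hnn : ∀ i ∈ (Finset.univ : Finset (Fin 4)), 0 ≤ Real.exp (-(θ * (τ / 2))) *
      Real.exp (θ * (th i * ∑ γ, (v γ : ℂ) * (ω γ * γ u)).re) := fun i _ => by positivity
    split_ifs with h
    · obtain ⟨i, hi⟩ := th_dir _ (τ / 2) (by linarith : 2 * (τ / 2) < ‖∑ γ, (v γ : ℂ) * (ω γ * γ u)‖)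
      refine le_trans ?_ (Finset.single_le_sum hnn (Finset.mem_univ i))
      rw [← Real.exp_add]
      apply Real.one_le_exp
      have := mul_le_mul_of_nonneg_left hi hθ0
      linarith
    · exact Finset.sum_nonneg hnn
  calc _ = ∑ u, β u * (if τ < ‖∑ γ, (v γ : ℂ) * (ω γ * γ u)‖ then (1 : ℝ) else 0) := by
        rw [Finset.sum_filter]
        apply Finset.sum_congr rfl
        intro u _
        split_ifs <;> simp
    _ ≤ ∑ u, β u * ∑ i, Real.exp (-(θ * (τ / 2))) *
        Real.exp (θ * (th i * ∑ γ, (v γ : ℂ) * (ω γ * γ u)).re) :=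
        Finset.sum_le_sum (fun u _ => mul_le_mul_of_nonneg_left (hpt u) (hβ u))
    _ = ∑ i, Real.exp (-(θ * (τ / 2))) *
        ∑ u, β u * Real.exp (θ * (th i * ∑ γ, (v γ : ℂ) * (ω γ * γ u)).re) := by
        simp only [Finset.mul_sum]
        rw [Finset.sum_comm]
        apply Finset.sum_congr rfl; intro i _
        apply Finset.sum_congr rfl; intro u _
        ring
    _ ≤ ∑ i : Fin 4, Real.exp (-(θ * (τ / 2))) * (2 * Real.exp (θ ^ 2 * a ^ 2 / (2 * m))) := by
        apply Finset.sum_le_sum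
        intro i _
        exact mul_le_mul_of_nonneg_left (hE i) (by positivity)
    _ = 8 * (Real.exp (-(θ * (τ / 2))) * Real.exp (θ ^ 2 * a ^ 2 / (2 * m))) := by
        rw [Finset.sum_const, Finset.card_univ, Fintype.card_fin]; simp; ring
    _ = _ := by
        rw [← Real.exp_add]
        congr 2
        rw [hθ]; field_simp; ring

end Part10

section Part11

variable {G : Type} [AddCommGroup G] [DecidableEq G] [Fintype G]

theorem char_sum_fin {k : ℕ} (χ : AddChar G ℂ) (q : Fin k → G) : χ (∑ i, q i) = ∏ i, χ (q i) :=
  map_sum χ.toAddMonoidHom _ _ |>.trans (by rfl)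

theorem sum_mem_ms {k : ℕ} (P : Finset G) (q : Fin k → G) (hq : ∀ i, q i ∈ P) : ∑ i, q i ∈ ms k P := by
  induction k with
  | zero => simp [ms_zero]
  | succ k ih =>
    rw [Fin.sum_univ_succ, ms_succ]
    exact Finset.add_mem_add (hq 0) (ih _ (fun i => hq i.succ))

theorem almost_inv (V P : Finset G) (hV : Sym0 V) (hP : P.Nonempty) (κ : ℝ)
    (hκ : ((V + P).card : ℝ) ≤ (1 + κ) * P.card) (χ : AddChar G ℂ) (v : G) (hv : v ∈ V) :
    ‖1 - χ v‖ * ‖∑ x ∈ P, χ x‖ ≤ 2 * κ * P.card := by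
  classical
  have hPv : P ⊆ V + P := by
    rw [add_comm]; exact subset_add_of_zero hV.1
  set P2 := P.image (fun x => v + x) with hP2
  have hP2c : P2.card = P.card := Finset.card_image_of_injective _ (add_right_injective v)
  have hP2v : P2 ⊆ V + P := by
    intro y hy
    obtain ⟨x, hx, rfl⟩ := Finset.mem_image.1 hy
    exact Finset.add_mem_add hv hx
  have e1 : χ v * ∑ x ∈ P, χ x = ∑ x ∈ P2, χ x := by
    rw [hP2, Finset.sum_image (fun x _ y _ h => add_left_cancel h), Finset.mul_sum]
    apply Finset.sum_congr rfl
    intro x _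
    rw [AddChar.map_add_eq_mul]
  have hb : ∀ R : Finset G, R ⊆ V + P → R.card = P.card →
      ‖∑ x ∈ V + P, χ x - ∑ x ∈ R, χ x‖ ≤ κ * P.card := by
    intro R hR hRc
    rw [← Finset.sum_sdiff hR, add_sub_cancel_right]
    calc _ ≤ ∑ x ∈ (V + P) \ R, ‖χ x‖ := norm_sum_le _ _
      _ = (((V + P) \ R).card : ℝ) := by simp
      _ = ((V + P).card : ℝ) - R.card := by
        rw [Finset.card_sdiff_of_subset hR, Nat.cast_sub (Finset.card_le_card hR)]
      _ ≤ _ := by rw [hRc]; linarith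
  have b1 := hb P hPv rfl
  have b2 := hb P2 hP2v hP2c
  rw [← norm_mul]
  have e2 : (1 - χ v) * ∑ x ∈ P, χ x = (∑ x ∈ V + P, χ x - ∑ x ∈ P2, χ x) -
      (∑ x ∈ V + P, χ x - ∑ x ∈ P, χ x) := by rw [← e1]; ring
  rw [e2]
  refine (norm_sub_le _ _).trans ?_
  linarith

theorem beta_exists (V : Finset G) (hV : Sym0 V) (n0 : ℕ) (κ : ℝ)
    (hκ : ((V + ms n0 V).card : ℝ) ≤ (1 + κ) * (ms n0 V).card) (s : ℕ) :
    ∃ β : G → ℝ, (∀ u, 0 ≤ β u) ∧ ∑ u, β u = 1 ∧ (∀ u, β u ≠ 0 → u ∈ ms ((s + 1) * n0) V) ∧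
      ∀ χ : AddChar G ℂ, (1 / 2 : ℝ) ^ s < ‖∑ u, (β u : ℂ) * χ u‖ → ∀ v ∈ V, ‖1 - χ v‖ ≤ 4 * κ := by
  classical
  set P := ms n0 V with hP
  have hPne : P.Nonempty := ⟨0, zero_mem_ms hV.1 n0⟩
  have hPc : (0 : ℝ) < P.card := by exact_mod_cast hPne.card_pos
  have hPc' : (P.card : ℂ) ≠ 0 := by exact_mod_cast hPc.ne'
  set Ω := Fintype.piFinset (fun _ : Fin (s + 1) => P) with hΩ
  have hΩc : (Ω.card : ℝ) = (P.card : ℝ) ^ (s + 1) := by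
    rw [hΩ, Fintype.card_piFinset]; simp
  have hΩ0 : (0 : ℝ) < Ω.card := by rw [hΩc]; exact pow_pos hPc _
  let β : G → ℝ := fun u => ((Ω.filter (fun q => ∑ i, q i = u)).card : ℝ) / Ω.card
  have hintegral : ∀ F : G → ℂ, ∑ u, (β u : ℂ) * F u = (∑ q ∈ Ω, F (∑ i, q i)) / Ω.card := by
    intro F
    rw [← Finset.sum_fiberwise_of_maps_to (s := Ω) (t := Finset.univ) (g := fun q => ∑ i, q i)
      (fun _ _ => Finset.mem_univ _), Finset.sum_div]
    apply Finset.sum_congr rfl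
    intro u _
    have : ∑ q ∈ Ω with ∑ i, q i = u, F (∑ i, q i) = ((Ω.filter (fun q => ∑ i, q i = u)).card : ℂ) * F u := by
      rw [← nsmul_eq_mul, ← Finset.sum_const]
      apply Finset.sum_congr rfl
      intro q hq
      rw [(Finset.mem_filter.1 hq).2]
    rw [this]
    simp only [β]; push_cast; ring
  refine ⟨β, fun u => by simp only [β]; positivity, ?_, ?_, ?_⟩
  · have := hintegral (fun _ => 1)
    simp only [mul_one, Finset.sum_const, nsmul_eq_mul] at this
    rw [div_self (by exact_mod_cast hΩ0.ne')] at this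
    exact_mod_cast this
  · intro u hu
    have : (Ω.filter (fun q => ∑ i, q i = u)).Nonempty := by
      by_contra h
      rw [Finset.not_nonempty_iff_eq_empty] at h
      apply hu
      simp only [β, h]; simp
    obtain ⟨q, hq⟩ := this
    rw [Finset.mem_filter, hΩ, Fintype.mem_piFinset] at hq
    rw [← hq.2, ms_mul, ← hP]
    exact sum_mem_ms P q hq.1
  · intro χ hχ v hv
    rw [hintegral] at hχ
    have e : ∑ q ∈ Ω, χ (∑ i, q i) = (∑ x ∈ P, χ x) ^ (s + 1) := by
      simp only [char_sum_fin]
      rw [hΩ, ← Finset.prod_univ_sum]; simp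
    rw [e, norm_div, norm_pow] at hχ
    have e2 : ‖(Ω.card : ℂ)‖ = (P.card : ℝ) ^ (s + 1) := by rw [← hΩc]; simp
    rw [e2, ← div_pow] at hχ
    have h1 : (1 : ℝ) / 2 ≤ ‖∑ x ∈ P, χ x‖ / P.card := by
      by_contra h
      push Not at h
      have h2 := pow_le_pow_left₀ (by positivity) h.le (s + 1)
      have h3 : (1 / 2 : ℝ) ^ (s + 1) ≤ (1 / 2 : ℝ) ^ s :=
        pow_le_pow_of_le_one (by norm_num) (by norm_num) (by omega)
      linarith
    rw [le_div_iff₀ hPc] at h1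
    have h4 := almost_inv V P hV hPne κ hκ χ v hv
    have h5 := mul_le_mul_of_nonneg_left h1 (norm_nonneg (1 - χ v))
    have h6 : ‖1 - χ v‖ * P.card ≤ 4 * κ * P.card := by linarith
    exact le_of_mul_le_mul_right h6 hPc

theorem one_sub_prod_le {ι : Type} [DecidableEq ι] (T : Finset ι) (z : ι → ℂ) (hz : ∀ i, ‖z i‖ = 1) :
    ‖1 - ∏ i ∈ T, z i‖ ≤ ∑ i ∈ T, ‖1 - z i‖ := by
  induction T using Finset.induction_on with
  | empty => simp
  | insert a T ha ih =>
    rw [Finset.prod_insert ha, Finset.sum_insert ha]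
    have : 1 - z a * ∏ i ∈ T, z i = (1 - z a) + z a * (1 - ∏ i ∈ T, z i) := by ring
    rw [this]
    refine (norm_add_le _ _).trans ?_
    rw [norm_mul, hz, one_mul]
    linarith

theorem spectral (β : G → ℝ) (ξ κ : ℝ) (V : Finset G)
    (hβ : ∀ χ : AddChar G ℂ, ξ < ‖∑ u, (β u : ℂ) * χ u‖ → ∀ v ∈ V, ‖1 - χ v‖ ≤ 4 * κ)
    (S : Finset (AddChar G ℂ)) (hS : Diss β ξ S) (γ : AddChar G ℂ) [DecidableEq (AddChar G ℂ)]
    (hγ : ¬ Diss β ξ (insert γ S)) (v : G) (hv : v ∈ V) (η : ℝ) (hη : ∀ γ' ∈ S, ‖1 - γ' v‖ ≤ η) :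
    ‖1 - γ v‖ ≤ 4 * κ + S.card * η := by
  unfold Diss at hγ
  push Not at hγ
  obtain ⟨σ, h1, h2, h3, h4⟩ := hγ
  have hσγ : σ γ ≠ 0 := by
    intro h
    apply absurd (hS σ h1 h2 ?_) (not_le.2 h4)
    intro γ' hγ'
    rcases Finset.mem_insert.1 (h3 γ' hγ') with rfl | h'
    · exact absurd h hγ'
    · exact h'
  let χ : AddChar G ℂ :=
    { toFun := fun u => ∏ γ : AddChar G ℂ, γ (σ γ • u)
      map_zero_eq_one' := by simp
      map_add_eq_mul' := by
        intro a b
        simp only [smul_add, AddChar.map_add_eq_mul, Finset.prod_mul_distrib] }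
  have hχ : ∀ u, χ u = ∏ γ : AddChar G ℂ, γ (σ γ • u) := fun u => rfl
  have h5 := hβ χ (by simpa only [hχ] using h4) v hv
  rw [hχ, ← Finset.mul_prod_erase Finset.univ _ (Finset.mem_univ γ)] at h5
  set b := ∏ γ' ∈ Finset.univ.erase γ, (γ' : AddChar G ℂ) (σ γ' • v) with hb
  have hsgn : ∀ γ' : AddChar G ℂ, σ γ' ≠ 0 → ‖1 - γ' (σ γ' • v)‖ = ‖1 - γ' v‖ := by
    intro γ' h
    rcases h1 γ' with h' | h' | h'
    · rw [h', neg_smul, one_smul, char_neg_bound]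
    · exact absurd h' h
    · rw [h', one_smul]
  have hb1 : ‖1 - b‖ ≤ S.card * η := by
    refine (one_sub_prod_le _ _ (fun γ' => AddChar.norm_apply γ' _)).trans ?_
    calc _ ≤ ∑ γ' ∈ Finset.univ.erase γ, (if γ' ∈ S then ‖1 - γ' v‖ else 0) := by
          apply Finset.sum_le_sum
          intro γ' hγ'
          have hne := Finset.ne_of_mem_erase hγ'
          by_cases h : σ γ' = 0
          · rw [h, zero_smul, AddChar.map_zero_eq_one, sub_self, norm_zero]
            split_ifs <;> simp
          · have hm : γ' ∈ S := by
              rcases Finset.mem_insert.1 (h3 γ' h) with h' | h'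
              · exact absurd h' hne
              · exact h'
            rw [if_pos hm, hsgn γ' h]
      _ ≤ ∑ γ', (if γ' ∈ S then ‖1 - γ' v‖ else 0) := by
          apply Finset.sum_le_sum_of_subset_of_nonneg (Finset.erase_subset _ _)
          intro γ' _ _
          split_ifs <;> simp
      _ = ∑ γ' ∈ S, ‖1 - γ' v‖ := by rw [Finset.sum_ite_mem, Finset.univ_inter]
      _ ≤ ∑ γ' ∈ S, η := Finset.sum_le_sum hη
      _ = _ := by simp
  have e : 1 - γ (σ γ • v) = (1 - γ (σ γ • v) * b) - γ (σ γ • v) * (1 - b) := by ring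
  rw [← hsgn γ hσγ, e]
  refine (norm_sub_le _ _).trans ?_
  rw [norm_mul, AddChar.norm_apply, one_mul]
  linarith

/-- Iterated extraction: either some stage leaves a lot of mass which is poorly dissociated,
or all but a small mass is subgaussian. -/
theorem light (β : G → ℝ) (hβ : ∀ u, 0 ≤ β u) (hβ1 : ∑ u, β u = 1) (s h p : ℕ) (hp : 1 ≤ p)
    (hs : s = 32 * p * 4 ^ h) (w0 : AddChar G ℂ → ℝ) (hw0 : ∀ γ, 0 ≤ w0 γ)
    (hw0m : ∑ γ, w0 γ ≤ 2 ^ h / 20) (i : ℕ) (hi : i ≤ h) :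
    (∃ i < h, ∃ w' : AddChar G ℂ → ℝ, (∀ γ, 0 ≤ w' γ ∧ w' γ ≤ w0 γ) ∧
      (2 : ℝ) ^ h / (20 * 2 ^ (i + 1)) ≤ ∑ γ, w' γ ∧
      ∀ S : Finset (AddChar G ℂ), (∀ γ ∈ S, w' γ ≠ 0) → S.card = 32 * p * 2 ^ (2 * h - i) →
        ¬ Diss β ((1 / 2 : ℝ) ^ s) S) ∨
    (∃ w : AddChar G ℂ → ℝ, (∀ γ, 0 ≤ w γ ∧ w γ ≤ w0 γ) ∧ ∑ γ, w γ ≤ 2 ^ h / (20 * 2 ^ i) ∧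
      ∀ ω : AddChar G ℂ → ℂ, (∀ γ, ‖ω γ‖ = 1) →
        ∑ u with 1 / 10 * (1 - (3 / 4 : ℝ) ^ i) < ‖∑ γ, ((w0 - w) γ : ℂ) * (ω γ * γ u)‖, β u
          ≤ i * (8 * Real.exp (-p))) := by
  classical
  induction i with
  | zero =>
    right
    refine ⟨w0, fun γ => ⟨hw0 γ, le_rfl⟩, by simpa using hw0m, ?_⟩
    intro ω _
    simp
  | succ i ih =>
    rcases ih (by omega) with h1 | ⟨w, hw1, hw2, hw3⟩
    · exact Or.inl h1
    set m := 32 * p * 2 ^ (2 * h - i) with hm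
    have hm1 : 1 ≤ m := by
      rw [hm]
      have : 1 ≤ 2 ^ (2 * h - i) := Nat.one_le_two_pow
      have h2 : 1 ≤ 32 * p := by omega
      exact Nat.one_le_iff_ne_zero.2 (by positivity)
    have hms : m ≤ s := by
      rw [hm, hs]
      have : 2 ^ (2 * h - i) ≤ 4 ^ h := by
        rw [show 4 = 2 ^ 2 by norm_num, ← pow_mul]
        exact Nat.pow_le_pow_right (by norm_num) (by omega)
      exact Nat.mul_le_mul_left _ this
    obtain ⟨w', h1, h2, h3⟩ := extraction β hβ hβ1 s m hm1 hms _ w (fun γ => (hw1 γ).1) le_rfl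
    by_cases hmass : (2 : ℝ) ^ h / (20 * 2 ^ (i + 1)) ≤ ∑ γ, w' γ
    · left
      exact ⟨i, by omega, w', fun γ => ⟨(h1 γ).1, (h1 γ).2.trans (hw1 γ).2⟩, hmass, h3⟩
    · right
      push Not at hmass
      refine ⟨w', fun γ => ⟨(h1 γ).1, (h1 γ).2.trans (hw1 γ).2⟩, hmass.le, ?_⟩
      intro ω hω
      have ht := tail β hβ m hm1 (w - w') h2 (2 ^ h / (20 * 2 ^ i)) (by positivity)
        (by
          refine le_trans ?_ hw2
          apply Finset.sum_le_sum
          intro γ _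
          simp only [Pi.sub_apply]
          linarith [(h1 γ).1]) (1 / 40 * (3 / 4) ^ i) (by positivity) ω hω
      have hexp : Real.exp (-((1 / 40 * (3 / 4 : ℝ) ^ i) ^ 2 * m / (8 * (2 ^ h / (20 * 2 ^ i)) ^ 2))) ≤
          Real.exp (-p) := by
        apply Real.exp_le_exp.2
        apply neg_le_neg
        have hmr : (m : ℝ) = 32 * p * (4 ^ h / 2 ^ i) := by
          rw [hm]; push_cast
          congr 1
          rw [eq_div_iff (by positivity), ← pow_add, show 2 * h - i + i = 2 * h by omega, pow_mul]
          norm_num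
        have e : (1 / 40 * (3 / 4 : ℝ) ^ i) ^ 2 * m / (8 * (2 ^ h / (20 * 2 ^ i)) ^ 2) = p * (9 / 8) ^ i := by
          rw [hmr]
          have e1 : ((3 / 4 : ℝ) ^ i) ^ 2 = 9 ^ i / (4 ^ i * 4 ^ i) := by
            rw [← pow_mul, mul_comm i 2, pow_mul, ← mul_pow, ← div_pow]; norm_num
          have e2 : ((2 : ℝ) ^ h) ^ 2 = 4 ^ h := by
            rw [← pow_mul, mul_comm h 2, pow_mul]; norm_num
          have e3 : (8 : ℝ) ^ i = 2 ^ i * 4 ^ i := by rw [← mul_pow]; norm_num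
          have e4 : ((2 : ℝ) ^ i) ^ 2 = 4 ^ i := by
            rw [← pow_mul, mul_comm i 2, pow_mul]; norm_num
          have e5 : ((2 : ℝ) ^ h / (20 * 2 ^ i)) ^ 2 = 4 ^ h / (400 * 4 ^ i) := by
            rw [div_pow, mul_pow, e2, e4]; norm_num
          have e6 : (9 / 8 : ℝ) ^ i = 9 ^ i / (2 ^ i * 4 ^ i) := by rw [div_pow, e3]
          rw [mul_pow, e1, e5, e6]
          have q1 : (0 : ℝ) < 4 ^ i := by positivity
          have q2 : (0 : ℝ) < 4 ^ h := by positivity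
          have q3 : (0 : ℝ) < 2 ^ i := by positivity
          generalize (4 : ℝ) ^ i = a at *
          generalize (4 : ℝ) ^ h = b at *
          generalize (2 : ℝ) ^ i = c at *
          field_simp
          norm_num
        rw [e]
        exact le_mul_of_one_le_right (by positivity) (one_le_pow₀ (by norm_num))
      have hw := hw3 ω hω
      have hsub : (Finset.univ.filter (fun u : G => 1 / 10 * (1 - (3 / 4 : ℝ) ^ (i + 1)) <
          ‖∑ γ, ((w0 - w') γ : ℂ) * (ω γ * γ u)‖)) ⊆
          (Finset.univ.filter (fun u : G => 1 / 10 * (1 - (3 / 4 : ℝ) ^ i) <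
            ‖∑ γ, ((w0 - w) γ : ℂ) * (ω γ * γ u)‖)) ∪
          (Finset.univ.filter (fun u : G => 1 / 40 * (3 / 4 : ℝ) ^ i <
            ‖∑ γ, ((w - w') γ : ℂ) * (ω γ * γ u)‖)) := by
        intro u hu
        rw [Finset.mem_union, Finset.mem_filter, Finset.mem_filter]
        rw [Finset.mem_filter] at hu
        by_contra hcon
        push Not at hcon
        have c1 := hcon.1 (Finset.mem_univ _)
        have c2 := hcon.2 (Finset.mem_univ _)
        have e : ∑ γ, ((w0 - w') γ : ℂ) * (ω γ * γ u) = ∑ γ, ((w0 - w) γ : ℂ) * (ω γ * γ u) +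
            ∑ γ, ((w - w') γ : ℂ) * (ω γ * γ u) := by
          rw [← Finset.sum_add_distrib]
          apply Finset.sum_congr rfl
          intro γ _
          simp only [Pi.sub_apply]; push_cast; ring
        have c3 := hu.2
        rw [e] at c3
        have c4 := norm_add_le (∑ γ, ((w0 - w) γ : ℂ) * (ω γ * γ u)) (∑ γ, ((w - w') γ : ℂ) * (ω γ * γ u))
        rw [pow_succ] at c3
        linarith
      refine (Finset.sum_le_sum_of_subset_of_nonneg hsub (fun u _ _ => hβ u)).trans ?_
      have hui := Finset.sum_union_inter (f := β) (s₁ := Finset.univ.filter (fun u : G =>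
          1 / 10 * (1 - (3 / 4 : ℝ) ^ i) < ‖∑ γ, ((w0 - w) γ : ℂ) * (ω γ * γ u)‖))
          (s₂ := Finset.univ.filter (fun u : G => 1 / 40 * (3 / 4 : ℝ) ^ i <
            ‖∑ γ, ((w - w') γ : ℂ) * (ω γ * γ u)‖))
      have hin := Finset.sum_nonneg (s := (Finset.univ.filter (fun u : G =>
          1 / 10 * (1 - (3 / 4 : ℝ) ^ i) < ‖∑ γ, ((w0 - w) γ : ℂ) * (ω γ * γ u)‖)) ∩
          (Finset.univ.filter (fun u : G => 1 / 40 * (3 / 4 : ℝ) ^ i <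
            ‖∑ γ, ((w - w') γ : ℂ) * (ω γ * γ u)‖))) (fun u _ => hβ u)
      push_cast
      linarith

end Part11

section Part12

variable {G : Type} [AddCommGroup G] [DecidableEq G] [Fintype G]

open Classical in
/-- Elements of the dilate of `T` at stage `j` on which all characters of `Γ` are close to one. -/
noncomputable def Vs (T : Finset G) (N I j : ℕ) (Γ : Finset (AddChar G ℂ)) : Finset G :=
  (ms (N ^ (I - j)) T).filter (fun u => ∀ γ ∈ Γ, ‖1 - γ u‖ ≤ 1 / (N : ℝ) ^ j)

open Classical in
/-- Characters which are nearly trivial on `W`. -/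
noncomputable def Cap (ν : ℝ) (W : Finset G) : Finset (AddChar G ℂ) :=
  Finset.univ.filter (fun γ => ∀ u ∈ W, ‖1 - γ u‖ ≤ ν)

theorem mem_Cap {ν : ℝ} {W : Finset G} {γ : AddChar G ℂ} :
    γ ∈ Cap ν W ↔ ∀ u ∈ W, ‖1 - γ u‖ ≤ ν := by
  unfold Cap
  simp

theorem Cap_mono {ν : ℝ} {W W' : Finset G} (h : W' ⊆ W) : Cap ν W ⊆ Cap ν W' := by
  intro γ hγ
  rw [mem_Cap] at *
  exact fun u hu => hγ u (h hu)

theorem mem_Vs {T : Finset G} {N I j : ℕ} {Γ : Finset (AddChar G ℂ)} {u : G} :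
    u ∈ Vs T N I j Γ ↔ u ∈ ms (N ^ (I - j)) T ∧ ∀ γ ∈ Γ, ‖1 - γ u‖ ≤ 1 / (N : ℝ) ^ j := by
  unfold Vs
  rw [Finset.mem_filter]

theorem Vs_sym0 {T : Finset G} (hT : Sym0 T) (N I j : ℕ) (Γ : Finset (AddChar G ℂ)) :
    Sym0 (Vs T N I j Γ) := by
  have hm := Sym0.ms hT (N ^ (I - j))
  constructor
  · rw [mem_Vs]
    refine ⟨hm.1, fun γ _ => ?_⟩
    rw [AddChar.map_zero_eq_one]
    simp
  · intro x hx
    rw [mem_Vs] at *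
    refine ⟨hm.2 x hx.1, fun γ hγ => ?_⟩
    rw [char_neg_bound]
    exact hx.2 γ hγ

theorem Vs_anti {T : Finset G} {N I j : ℕ} {Γ Γ' : Finset (AddChar G ℂ)} (h : Γ ⊆ Γ') :
    Vs T N I j Γ' ⊆ Vs T N I j Γ := by
  intro x hx
  rw [mem_Vs] at *
  exact ⟨hx.1, fun γ hγ => hx.2 γ (h hγ)⟩

theorem ms_Vs {T : Finset G} {N I j : ℕ} (hN : 1 ≤ N) (hj : j + 1 ≤ I)
    (Γ : Finset (AddChar G ℂ)) : ms N (Vs T N I (j + 1) Γ) ⊆ Vs T N I j Γ := by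
  intro x hx
  rw [mem_Vs]
  constructor
  · have h1 : Vs T N I (j + 1) Γ ⊆ ms (N ^ (I - (j + 1))) T := by
      intro y hy; exact (mem_Vs.1 hy).1
    have h2 := ms_mono h1 N hx
    rw [← ms_mul, ← pow_succ', show I - (j + 1) + 1 = I - j by omega] at h2
    exact h2
  · intro γ hγ
    have h1 := char_ms_bound γ (B := Vs T N I (j + 1) Γ) (η := 1 / (N : ℝ) ^ (j + 1))
      (fun u hu => (mem_Vs.1 hu).2 γ hγ) N x hx
    refine h1.trans (le_of_eq ?_)
    have : (N : ℝ) ≠ 0 := by positivity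
    field_simp
    rw [pow_succ']

theorem Vs_succ_subset {T : Finset G} (hT : Sym0 T) {N I j : ℕ} (hN : 1 ≤ N) (hj : j + 1 ≤ I)
    (Γ : Finset (AddChar G ℂ)) : Vs T N I (j + 1) Γ ⊆ Vs T N I j Γ := by
  refine Finset.Subset.trans ?_ (ms_Vs hN hj Γ)
  have := ms_mono_left (Vs_sym0 hT N I (j + 1) Γ).1 hN
  rwa [ms_one] at this

theorem Vs_card {T : Finset G} (hT : Sym0 T) {N I j : ℕ} (hN : 2 ≤ N) (hj : j + 1 ≤ I)
    (Γ : Finset (AddChar G ℂ)) :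
    T.card ≤ ((4 * N ^ j + 1) ^ 2) ^ Γ.card * (Vs T N I j Γ).card := by
  classical
  obtain ⟨S', h1, h2, h3⟩ := cells (ι := {γ // γ ∈ Γ}) (fun γ => γ.1) (N ^ j)
    (Nat.one_le_pow _ _ (by omega)) T
  rw [Fintype.card_coe] at h2
  refine h2.trans (Nat.mul_le_mul_left _ ?_)
  rcases S'.eq_empty_or_nonempty with h | ⟨s, hs⟩
  · rw [h]; simp
  · have : S'.card = (S'.image (fun x => x - s)).card :=
      (Finset.card_image_of_injective _ (sub_left_injective)).symm
    rw [this]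
    apply Finset.card_le_card
    intro y hy
    obtain ⟨x, hx, rfl⟩ := Finset.mem_image.1 hy
    rw [mem_Vs]
    constructor
    · have h4 : x - s ∈ ms 2 T := by
        rw [show 2 = 1 + 1 by norm_num, ms_succ, ms_one, sub_eq_add_neg]
        exact Finset.add_mem_add (h1 hx) (hT.2 s (h1 hs))
      refine ms_mono_left hT.1 ?_ h4
      calc 2 ≤ N := hN
        _ = N ^ 1 := (pow_one _).symm
        _ ≤ _ := Nat.pow_le_pow_right (by omega) (by omega)
    · intro γ hγ
      have := h3 x hx s hs ⟨γ, hγ⟩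
      push_cast at this
      exact this

/-- Dichotomy at one round. -/
theorem round (c : AddChar G ℂ → ℂ) (n : ℕ) (hc : ∑ γ, ‖c γ‖ ≤ n)
    (T : Finset G) (hT : Sym0 T) (N I j : ℕ) (hN : 1 ≤ N) (hj : j + 1 ≤ I)
    (Γ : Finset (AddChar G ℂ)) (κ ν : ℝ) (hν : 0 ≤ ν) (n0 s h p : ℕ) (hp : 1 ≤ p)
    (hκ : ((Vs T N I (j + 1) Γ + ms n0 (Vs T N I (j + 1) Γ)).card : ℝ) ≤
      (1 + κ) * (ms n0 (Vs T N I (j + 1) Γ)).card)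
    (hs : s = 32 * p * 4 ^ h) (hnh : (n : ℝ) ≤ 2 ^ h / 20) (hsN : (s + 1) * n0 ≤ N)
    (hκν : 4 * κ + s / N ≤ ν) (hκ0 : 0 ≤ κ) :
    (∃ i < h, ∃ Γ' : Finset (AddChar G ℂ), Γ'.card ≤ Γ.card + 32 * p * 2 ^ (2 * h - i) ∧
      ∑ γ ∈ Cap ν (Vs T N I j Γ), ‖c γ‖ + 2 ^ h / (20 * 2 ^ (i + 1)) ≤
        ∑ γ ∈ Cap ν (Vs T N I (j + 1) Γ'), ‖c γ‖) ∨
    (∃ β : G → ℝ, (∀ u, 0 ≤ β u) ∧ ∑ u, β u = 1 ∧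
      (∀ u, β u ≠ 0 → u ∈ ms N (Vs T N I (j + 1) Γ)) ∧
      ∀ x, ∑ u with n * ν + 3 / 20 < ‖fs c (x + u) - ∑ γ ∈ Cap ν (Vs T N I j Γ), c γ * γ x‖, β u
        ≤ h * (8 * Real.exp (-p))) := by
  classical
  have hV' := Vs_sym0 hT N I (j + 1) Γ
  obtain ⟨β, hβ0, hβ1, hβs, hβ⟩ := beta_exists _ hV' n0 κ hκ s
  have hβsN : ∀ u, β u ≠ 0 → u ∈ ms N (Vs T N I (j + 1) Γ) :=
    fun u hu => ms_mono_left hV'.1 hsN (hβs u hu)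
  set cap := Cap ν (Vs T N I j Γ) with hcap
  set w0 : AddChar G ℂ → ℝ := fun γ => if γ ∈ cap then 0 else ‖c γ‖ with hw0
  have hw00 : ∀ γ, 0 ≤ w0 γ := by
    intro γ; rw [hw0]; dsimp only; split_ifs <;> simp
  have hw0c : ∀ γ, w0 γ ≤ ‖c γ‖ := by
    intro γ; rw [hw0]; dsimp only; split_ifs <;> simp
  have hw0m : ∑ γ, w0 γ ≤ 2 ^ h / 20 :=
    ((Finset.sum_le_sum fun γ _ => hw0c γ).trans hc).trans hnh
  rcases light β hβ0 hβ1 s h p hp hs w0 hw00 hw0m h le_rfl with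
    ⟨i, hi, w', hw1, hw2, hw3⟩ | ⟨w, hw1, hw2, hw3⟩
  · left
    set R := Finset.univ.filter (fun γ => w' γ ≠ 0) with hR
    set m := 32 * p * 2 ^ (2 * h - i) with hm
    -- a maximal dissociated subset
    have hDmono : ∀ S S' : Finset (AddChar G ℂ), S' ⊆ S → Diss β ((1 / 2 : ℝ) ^ s) S →
        Diss β ((1 / 2 : ℝ) ^ s) S' := by
      intro S S' hSS hS σ h1 h2 h3
      exact hS σ h1 h2 (fun γ hγ => hSS (h3 γ hγ))
    have hempty : Diss β ((1 / 2 : ℝ) ^ s) (∅ : Finset (AddChar G ℂ)) := by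
      intro σ h1 h2 h3
      exfalso
      apply h2
      ext γ
      by_contra hγ
      exact absurd (h3 γ hγ) (Finset.notMem_empty _)
    obtain ⟨S, hSmem, hSmax⟩ := Finset.exists_max_image
      (R.powerset.filter (fun S => Diss β ((1 / 2 : ℝ) ^ s) S)) Finset.card
      ⟨∅, by rw [Finset.mem_filter]; exact ⟨Finset.empty_mem_powerset _, hempty⟩⟩
    rw [Finset.mem_filter, Finset.mem_powerset] at hSmem
    obtain ⟨hSR, hSD⟩ := hSmem
    have hSm : S.card ≤ m := by
      by_contra hlt
      push Not at hlt
      obtain ⟨S', hS', hS'c⟩ := Finset.exists_subset_card_eq hlt.le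
      exact hw3 S' (fun γ hγ => (Finset.mem_filter.1 (hSR (hS' hγ))).2) hS'c
        (hDmono S S' hS' hSD)
    have hms : m ≤ s := by
      rw [hm, hs]
      have : 2 ^ (2 * h - i) ≤ 4 ^ h := by
        rw [show 4 = 2 ^ 2 by norm_num, ← pow_mul]
        exact Nat.pow_le_pow_right (by norm_num) (by omega)
      exact Nat.mul_le_mul_left _ this
    refine ⟨i, hi, Γ ∪ S, (Finset.card_union_le _ _).trans (by omega), ?_⟩
    have hNr : (1 : ℝ) ≤ N := by exact_mod_cast hN
    have hη : 1 / (N : ℝ) ^ (j + 1) ≤ 1 / N := by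
      apply one_div_le_one_div_of_le (by linarith)
      exact le_self_pow₀ hNr (by omega)
    have hSs : (S.card : ℝ) ≤ s := by exact_mod_cast hSm.trans hms
    have hs1 : (1 : ℝ) ≤ s := by
      have : 1 ≤ s := by
        rw [hs]; exact Nat.one_le_iff_ne_zero.2 (by positivity)
      exact_mod_cast this
    have hRcap : R ⊆ Cap ν (Vs T N I (j + 1) (Γ ∪ S)) := by
      intro γ hγ
      rw [mem_Cap]
      intro v hv
      have hvS : ∀ γ' ∈ S, ‖1 - γ' v‖ ≤ 1 / (N : ℝ) ^ (j + 1) :=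
        fun γ' hγ' => (mem_Vs.1 hv).2 γ' (Finset.mem_union_right _ hγ')
      by_cases hγS : γ ∈ S
      · refine ((hvS γ hγS).trans hη).trans ?_
        have : 1 / (N : ℝ) ≤ s / N := by gcongr
        linarith
      · have hnd : ¬ Diss β ((1 / 2 : ℝ) ^ s) (insert γ S) := by
          intro hD
          have := hSmax (insert γ S) (by
            rw [Finset.mem_filter, Finset.mem_powerset]
            exact ⟨Finset.insert_subset hγ hSR, hD⟩)
          rw [Finset.card_insert_of_notMem hγS] at this
          omega
        have := spectral β _ κ (Vs T N I (j + 1) Γ) hβ S hSD γ hnd v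
          (Vs_anti Finset.subset_union_left hv) _ hvS
        refine this.trans (le_trans ?_ hκν)
        have : (S.card : ℝ) * (1 / (N : ℝ) ^ (j + 1)) ≤ s * (1 / N) := by gcongr
        rw [mul_one_div (s : ℝ)] at this
        linarith
    have hcapsub : cap ⊆ Cap ν (Vs T N I (j + 1) (Γ ∪ S)) := by
      apply Cap_mono
      exact (Vs_anti Finset.subset_union_left).trans (Vs_succ_subset hT hN hj Γ)
    have hdisj : Disjoint cap R := by
      rw [Finset.disjoint_left]
      intro γ h1 h2
      have h3 := (Finset.mem_filter.1 h2).2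
      have h4 : w0 γ = 0 := by rw [hw0]; simp [h1]
      exact h3 (le_antisymm (h4 ▸ (hw1 γ).2) (hw1 γ).1)
    calc ∑ γ ∈ cap, ‖c γ‖ + 2 ^ h / (20 * 2 ^ (i + 1)) ≤ ∑ γ ∈ cap, ‖c γ‖ + ∑ γ ∈ R, ‖c γ‖ := by
          gcongr
          refine hw2.trans ?_
          rw [hR, Finset.sum_filter]
          apply Finset.sum_le_sum
          intro γ _
          split_ifs with h0
          · exact (hw1 γ).2.trans (hw0c γ)
          · push Not at h0; exact h0.le
      _ = ∑ γ ∈ cap ∪ R, ‖c γ‖ := (Finset.sum_union hdisj).symm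
      _ ≤ _ := Finset.sum_le_sum_of_subset_of_nonneg (Finset.union_subset hcapsub hRcap)
          (fun _ _ _ => norm_nonneg _)
  · right
    refine ⟨β, hβ0, hβ1, hβsN, ?_⟩
    intro x
    choose ph hph1 hph2 using fun γ => phase_exists (c γ)
    have hω : ∀ γ, ‖ph γ * γ x‖ = 1 := by
      intro γ; rw [norm_mul, hph1, AddChar.norm_apply, one_mul]
    refine le_trans ?_ (hw3 (fun γ => ph γ * γ x) hω)
    rw [Finset.sum_filter, Finset.sum_filter]
    apply Finset.sum_le_sum
    intro u _
    split_ifs with h1 h2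
    · exact le_rfl
    · by_contra hcon
      push Not at hcon
      have huV := ms_Vs hN hj Γ (hβsN u hcon.ne')
      apply h2
      have hwm : ∑ γ, w γ ≤ 1 / 20 := by
        refine hw2.trans (le_of_eq ?_)
        have : (2 : ℝ) ^ h ≠ 0 := by positivity
        field_simp
      have e1 : fs c (x + u) - ∑ γ ∈ cap, c γ * γ x =
          ∑ γ ∈ cap, c γ * γ x * (γ u - 1) + (∑ γ, ((w0 - w) γ : ℂ) * (ph γ * γ x * γ u) +
            ∑ γ, (w γ : ℂ) * (ph γ * γ x * γ u)) := by
        unfold fs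
        have e2 : ∑ γ, ((w0 - w) γ : ℂ) * (ph γ * γ x * γ u) +
            ∑ γ, (w γ : ℂ) * (ph γ * γ x * γ u) =
            ∑ γ, (if γ ∈ cap then 0 else c γ * γ x * γ u) := by
          rw [← Finset.sum_add_distrib]
          apply Finset.sum_congr rfl
          intro γ _
          have : ((w0 - w) γ : ℂ) + (w γ : ℂ) = (w0 γ : ℂ) := by
            simp only [Pi.sub_apply]; push_cast; ring
          rw [← add_mul, this, hw0]
          dsimp only
          split_ifs with hγ
          · simp
          · nth_rewrite 2 [hph2 γ]
            ring
        rw [e2]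
        have e3 : ∑ γ ∈ cap, c γ * γ x * (γ u - 1) = ∑ γ ∈ cap, c γ * γ x * γ u -
            ∑ γ ∈ cap, c γ * γ x := by
          rw [← Finset.sum_sub_distrib]
          apply Finset.sum_congr rfl
          intro γ _; ring
        have e4 : ∑ γ, c γ * γ (x + u) = ∑ γ ∈ cap, c γ * γ x * γ u +
            ∑ γ, (if γ ∈ cap then 0 else c γ * γ x * γ u) := by
          have e5 : ∑ γ ∈ cap, c γ * γ x * γ u = ∑ γ, (if γ ∈ cap then c γ * γ x * γ u else 0) := by
            rw [Finset.sum_ite_mem, Finset.univ_inter]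
          rw [e5, ← Finset.sum_add_distrib]
          apply Finset.sum_congr rfl
          intro γ _
          rw [AddChar.map_add_eq_mul]
          split_ifs <;> ring
        rw [e3, e4]
        ring
      have b1 : ‖∑ γ ∈ cap, c γ * γ x * (γ u - 1)‖ ≤ n * ν := by
        refine (norm_sum_le _ _).trans ?_
        calc ∑ γ ∈ cap, ‖c γ * γ x * (γ u - 1)‖ ≤ ∑ γ ∈ cap, ‖c γ‖ * ν := by
              apply Finset.sum_le_sum
              intro γ hγ
              rw [norm_mul, norm_mul, AddChar.norm_apply, mul_one, norm_sub_rev]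
              exact mul_le_mul_of_nonneg_left (mem_Cap.1 hγ u huV) (norm_nonneg _)
          _ = (∑ γ ∈ cap, ‖c γ‖) * ν := by rw [Finset.sum_mul]
          _ ≤ n * ν := by
              apply mul_le_mul_of_nonneg_right _ hν
              refine le_trans ?_ hc
              exact Finset.sum_le_sum_of_subset_of_nonneg (Finset.subset_univ _)
                (fun _ _ _ => norm_nonneg _)
      have b2 : ‖∑ γ, (w γ : ℂ) * (ph γ * γ x * γ u)‖ ≤ 1 / 20 := by
        refine (norm_sum_le _ _).trans (le_trans (le_of_eq ?_) hwm)
        apply Finset.sum_congr rfl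
        intro γ _
        rw [norm_mul, norm_mul, hω, AddChar.norm_apply, mul_one, mul_one, Complex.norm_real,
          Real.norm_of_nonneg (hw1 γ).1]
      rw [e1] at h1
      have t1 := norm_add_le (∑ γ ∈ cap, c γ * γ x * (γ u - 1))
        (∑ γ, ((w0 - w) γ : ℂ) * (ph γ * γ x * γ u) + ∑ γ, (w γ : ℂ) * (ph γ * γ x * γ u))
      have t2 := norm_add_le (∑ γ, ((w0 - w) γ : ℂ) * (ph γ * γ x * γ u))
        (∑ γ, (w γ : ℂ) * (ph γ * γ x * γ u))
      have t3 : (0 : ℝ) < (3 / 4) ^ h := by positivity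
      linarith
    · exact hβ0 u
    · exact le_rfl

end Part12

section Part13

variable {G : Type} [AddCommGroup G] [DecidableEq G] [Fintype G]

theorem growth (V U : Finset G) (N1 : ℕ) (κ : ℝ) (hκ : 0 ≤ κ)
    (hU : ms (N1 + 1) V ⊆ U) (hlt : (U.card : ℝ) < (1 + κ) ^ N1 * V.card) :
    ∃ n0 ≤ N1, ((V + ms n0 V).card : ℝ) ≤ (1 + κ) * (ms n0 V).card := by
  by_contra hcon
  push Not at hcon
  have key : ∀ k ≤ N1, (1 + κ) ^ k * V.card ≤ ((ms (k + 1) V).card : ℝ) := by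
    intro k hk
    induction k with
    | zero => simp [ms_one]
    | succ k ih =>
      have h1 := hcon (k + 1) hk
      rw [ms_succ, pow_succ]
      have h2 := ih (by omega)
      calc (1 + κ) ^ k * (1 + κ) * V.card = (1 + κ) * ((1 + κ) ^ k * V.card) := by ring
        _ ≤ (1 + κ) * (ms (k + 1) V).card := by gcongr
        _ ≤ _ := h1.le
  have h1 := key N1 le_rfl
  have h2 : ((ms (N1 + 1) V).card : ℝ) ≤ U.card := by exact_mod_cast Finset.card_le_card hU
  linarith

/-- Iterating the dichotomy until the good case occurs. -/
theorem iterate (c : AddChar G ℂ → ℂ) (n : ℕ) (hc : ∑ γ, ‖c γ‖ ≤ n)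
    (T : Finset G) (hT : Sym0 T) (N I : ℕ) (hN : 1 ≤ N) (hI : I = 20 * n + 5)
    (κ ν : ℝ) (hν : 0 ≤ ν) (s h p : ℕ) (hp : 1 ≤ p)
    (hs : s = 32 * p * 4 ^ h) (hnh : (n : ℝ) ≤ 2 ^ h / 20)
    (hκν : 4 * κ + s / N ≤ ν) (hκ0 : 0 ≤ κ) 
    (hgr : ∀ (j : ℕ) (Γ : Finset (AddChar G ℂ)), j ≤ 20 * n → Γ.card ≤ 1280 * p * 2 ^ h * n →
      ∃ n0, (s + 1) * n0 ≤ N ∧ ((Vs T N I (j + 1) Γ + ms n0 (Vs T N I (j + 1) Γ)).card : ℝ) ≤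
      (1 + κ) * (ms n0 (Vs T N I (j + 1) Γ)).card) :
    ∃ (j : ℕ) (Γ : Finset (AddChar G ℂ)), j ≤ 20 * n ∧ Γ.card ≤ 1280 * p * 2 ^ h * n ∧
      (∃ β : G → ℝ, (∀ u, 0 ≤ β u) ∧ ∑ u, β u = 1 ∧
      (∀ u, β u ≠ 0 → u ∈ ms N (Vs T N I (j + 1) Γ)) ∧
      ∀ x, ∑ u with n * ν + 3 / 20 < ‖fs c (x + u) - ∑ γ ∈ Cap ν (Vs T N I j Γ), c γ * γ x‖, β u
        ≤ h * (8 * Real.exp (-p))) := by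
  by_contra hcon
  have hmass : ∀ W : Finset G, ∑ γ ∈ Cap ν W, ‖c γ‖ ≤ n := fun W =>
    (Finset.sum_le_sum_of_subset_of_nonneg (Finset.subset_univ _)
      (fun _ _ _ => norm_nonneg _)).trans hc
  have key : ∀ r ≤ 20 * n + 1, ∃ Γ : Finset (AddChar G ℂ),
      (Γ.card : ℝ) ≤ 1280 * p * 2 ^ h * ∑ γ ∈ Cap ν (Vs T N I r Γ), ‖c γ‖ ∧
      (r : ℝ) / 20 ≤ ∑ γ ∈ Cap ν (Vs T N I r Γ), ‖c γ‖ := by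
    intro r hr
    induction r with
    | zero =>
      have h0 : 0 ≤ ∑ γ ∈ Cap ν (Vs T N I 0 ∅), ‖c γ‖ := Finset.sum_nonneg fun _ _ => norm_nonneg _
      refine ⟨∅, ?_, by simpa using h0⟩
      simp only [Finset.card_empty, Nat.cast_zero]
      exact mul_nonneg (by positivity) h0
    | succ r ih =>
      obtain ⟨Γ, h1, h2⟩ := ih (by omega)
      have hΓ : Γ.card ≤ 1280 * p * 2 ^ h * n := by
        have : (Γ.card : ℝ) ≤ 1280 * p * 2 ^ h * n :=
          h1.trans (mul_le_mul_of_nonneg_left (hmass _) (by positivity))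
        exact_mod_cast this
      obtain ⟨n0, hn0, hgr0⟩ := hgr r Γ (by omega) hΓ
      rcases round c n hc T hT N I r hN (by omega) Γ κ ν hν n0 s h p hp hgr0 hs hnh hn0 hκν hκ0 with
        ⟨i, hi, Γ', h3, h4⟩ | hgood
      · have hp2 : (2 : ℝ) ^ (i + 1) ≤ 2 ^ h := pow_le_pow_right₀ (by norm_num) hi
        have hp3 : (1 : ℝ) / 20 ≤ 2 ^ h / (20 * 2 ^ (i + 1)) := by
          rw [div_le_div_iff₀ (by norm_num) (by positivity)]
          linarith
        have h5 : (Γ'.card : ℝ) ≤ Γ.card + 32 * p * 2 ^ (2 * h - i) := by exact_mod_cast h3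
        have h6 : 32 * (p : ℝ) * 2 ^ (2 * h - i) = 1280 * p * 2 ^ h * (2 ^ h / (20 * 2 ^ (i + 1))) := by
          have e : (2 : ℝ) ^ (2 * h - i) = 2 ^ h * 2 ^ h / 2 ^ i := by
            rw [eq_div_iff (by positivity), ← pow_add, ← pow_add]
            congr 1; omega
          rw [e, pow_succ (2 : ℝ) i]
          have : (2 : ℝ) ^ i ≠ 0 := by positivity
          field_simp
          norm_num
        refine ⟨Γ', ?_, ?_⟩
        · calc (Γ'.card : ℝ) ≤ 1280 * p * 2 ^ h * (∑ γ ∈ Cap ν (Vs T N I r Γ), ‖c γ‖ +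
                2 ^ h / (20 * 2 ^ (i + 1))) := by rw [mul_add]; linarith
            _ ≤ _ := mul_le_mul_of_nonneg_left h4 (by positivity)
        · push_cast
          linarith
      · exact absurd ⟨r, Γ, by omega, hΓ, hgood⟩ hcon
  obtain ⟨Γ, h1, h2⟩ := key (20 * n + 1) le_rfl
  have h3 := hmass (Vs T N I (20 * n + 1) Γ)
  push_cast at h2
  linarith

/-- Extracting the almost constant structure on cosets of a subgroup from the good case. -/
theorem good_end (c : AddChar G ℂ → ℂ) (n : ℕ) (hn : 1 ≤ n) (hc : ∑ γ, ‖c γ‖ ≤ n) (fZ : G → ℤ)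
    (ε : ℝ) (hε : ε ≤ 1 / 25) (hf : ∀ x, ‖fs c x - fZ x‖ ≤ ε)
    (X W V : Finset G) (hX : X.Nonempty) (hXf : ∀ x ∈ X, fZ x ≠ 0) (hW : Sym0 W)
    (hXW : ((X + W).card : ℝ) ≤ 5 * X.card) (cap : Finset (AddChar G ℂ)) (ν : ℝ)
    (hν : ν = 1 / (100 * n)) (hcap : ∀ γ ∈ cap, ∀ v ∈ V, ‖1 - γ v‖ ≤ ν)
    (β : G → ℝ) (hβ0 : ∀ u, 0 ≤ β u) (hβ1 : ∑ u, β u = 1) (hβW : ∀ u, β u ≠ 0 → u ∈ W)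
    (H : AddSubgroup G) (hH : H = AddSubgroup.closure (V : Set G)) (hβH : ∀ u, β u ≠ 0 → u ∈ H)
    (δ : ℝ) (hδ : δ < 1 / 5)
    (hgood : ∀ x, ∑ u with n * ν + 3 / 20 < ‖fs c (x + u) - ∑ γ ∈ cap, c γ * γ x‖, β u ≤ δ)
    (HF : Finset G) (hHF : ∀ x, x ∈ HF ↔ x ∈ H) :
    ∃ a : G → ℤ, (∀ x, ∀ t ∈ H, a (x + t) = a x) ∧ (∃ y, a y ≠ 0) ∧
      ∀ x, |∑ t ∈ HF, ((fZ (x + t) : ℝ) - a x)| ≤ (2 * n + 2) * δ * HF.card := by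
  classical
  have hn' : (1 : ℝ) ≤ n := by exact_mod_cast hn
  have hnν : n * ν = 1 / 100 := by
    rw [hν]; field_simp
  set cp : G → ℂ := fun x => ∑ γ ∈ cap, c γ * γ x with hcp
  set bad : G → Finset G := fun x =>
    Finset.univ.filter (fun u => n * ν + 3 / 20 < ‖fs c (x + u) - cp x‖) with hbad
  have hgood' : ∀ x, ∑ u ∈ bad x, β u ≤ δ := hgood
  -- if not bad then close
  have hclose : ∀ x u, u ∉ bad x → ‖(fZ (x + u) : ℂ) - cp x‖ ≤ 1 / 5 := by
    intro x u hu
    rw [hbad] at hu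
    simp only [Finset.mem_filter, Finset.mem_univ, true_and, not_lt] at hu
    have h1 := hf (x + u)
    rw [norm_sub_rev] at h1
    have h2 := norm_sub_le_norm_sub_add_norm_sub (fZ (x + u) : ℂ) (fs c (x + u)) (cp x)
    linarith
  have hex : ∀ x, ∃ u, u ∉ bad x := by
    intro x
    by_contra hcon
    push Not at hcon
    have h1 : bad x = Finset.univ := Finset.eq_univ_iff_forall.2 hcon
    have h2 := hgood' x
    rw [h1, hβ1] at h2
    linarith
  choose g hg using hex
  set a : G → ℤ := fun x => fZ (x + g x) with ha
  have hacp : ∀ x, ‖(a x : ℂ) - cp x‖ ≤ 1 / 5 := fun x => hclose x (g x) (hg x)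
  have heq : ∀ x u, u ∉ bad x → fZ (x + u) = a x := by
    intro x u hu
    apply int_eq_of_close
    have h1 := hclose x u hu
    have h2 := hacp x
    rw [norm_sub_rev] at h2
    have h3 := norm_sub_le_norm_sub_add_norm_sub (fZ (x + u) : ℂ) (cp x) (a x : ℂ)
    linarith
  have hinv1 : ∀ x, ∀ v ∈ V, a (x + v) = a x := by
    intro x v hv
    apply int_eq_of_close
    have h1 := hacp (x + v)
    have h2 := hacp x
    rw [norm_sub_rev] at h2
    have h3 : ‖cp (x + v) - cp x‖ ≤ 1 / 100 := by
      rw [hcp]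
      dsimp only
      rw [← Finset.sum_sub_distrib]
      refine (norm_sum_le _ _).trans ?_
      calc ∑ γ ∈ cap, ‖c γ * γ (x + v) - c γ * γ x‖ ≤ ∑ γ ∈ cap, ‖c γ‖ * ν := by
            apply Finset.sum_le_sum
            intro γ hγ
            rw [AddChar.map_add_eq_mul, show c γ * (γ x * γ v) - c γ * γ x = c γ * γ x * (γ v - 1) by ring,
              norm_mul, norm_mul, AddChar.norm_apply, mul_one, norm_sub_rev]
            exact mul_le_mul_of_nonneg_left (hcap γ hγ v hv) (norm_nonneg _)
        _ = (∑ γ ∈ cap, ‖c γ‖) * ν := by rw [Finset.sum_mul]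
        _ ≤ n * ν := by
            apply mul_le_mul_of_nonneg_right _ (by rw [hν]; positivity)
            refine le_trans ?_ hc
            exact Finset.sum_le_sum_of_subset_of_nonneg (Finset.subset_univ _)
              (fun _ _ _ => norm_nonneg _)
        _ = 1 / 100 := hnν
    have h4 := norm_sub_le_norm_sub_add_norm_sub (a (x + v) : ℂ) (cp (x + v)) (a x : ℂ)
    have h5 := norm_sub_le_norm_sub_add_norm_sub (cp (x + v)) (cp x) (a x : ℂ)
    linarith
  have hinv : ∀ t ∈ H, ∀ x, a (x + t) = a x := by
    intro t ht
    rw [hH] at ht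
    induction ht using AddSubgroup.closure_induction with
    | mem v hv => exact fun x => hinv1 x v hv
    | zero => intro x; rw [add_zero]
    | add u v _ _ hu hv => intro x; rw [← add_assoc, hv, hu]
    | neg u _ hu => intro x; rw [← hu (x + -u)]; congr 1; abel
  have hab : ∀ x, |(fZ x : ℝ)| ≤ n + 1 := by
    intro x
    have h1 := hf x
    rw [norm_sub_rev] at h1
    have h2 := fs_norm c n hc x
    have h3 : ‖(fZ x : ℂ)‖ ≤ ‖(fZ x : ℂ) - fs c x‖ + ‖fs c x‖ := by
      have := norm_add_le ((fZ x : ℂ) - fs c x) (fs c x)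
      rwa [sub_add_cancel] at this
    rw [Complex.norm_intCast] at h3
    linarith
  refine ⟨a, fun x t ht => hinv t ht x, ?_, ?_⟩
  · -- nonzero
    by_contra hcon
    push Not at hcon
    have h1 : ∀ y, ∑ u with y + u ∈ X, β u ≤ δ := by
      intro y
      refine le_trans ?_ (hgood' y)
      apply Finset.sum_le_sum_of_subset_of_nonneg _ (fun u _ _ => hβ0 u)
      intro u hu
      by_contra hub
      have h2 := heq y u hub
      rw [hcon y] at h2
      exact hXf _ (Finset.mem_filter.1 hu).2 h2
    have h2 : ∑ y ∈ X + W, ∑ u with y + u ∈ X, β u ≤ (X + W).card * δ := by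
      refine (Finset.sum_le_sum fun y _ => h1 y).trans ?_
      rw [Finset.sum_const, nsmul_eq_mul]
    have h3 : ∑ y ∈ X + W, ∑ u with y + u ∈ X, β u = X.card := by
      simp_rw [Finset.sum_filter]
      rw [Finset.sum_comm]
      have : ∀ u, ∑ y ∈ X + W, (if y + u ∈ X then β u else 0) = β u * X.card := by
        intro u
        by_cases hu : β u = 0
        · simp [hu]
        rw [← Finset.sum_filter, Finset.sum_const, nsmul_eq_mul, mul_comm]
        congr 2
        symm
        apply Finset.card_bij (fun x _ => x - u)
        · intro x hx
          rw [Finset.mem_filter, sub_add_cancel]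
          refine ⟨?_, hx⟩
          rw [sub_eq_add_neg]
          exact Finset.add_mem_add hx (hW.2 u (hβW u hu))
        · intro x _ y _ hxy
          exact sub_left_injective hxy
        · intro y hy
          exact ⟨y + u, (Finset.mem_filter.1 hy).2, add_sub_cancel_right _ _⟩
      rw [Finset.sum_congr rfl fun u _ => this u, ← Finset.sum_mul, hβ1, one_mul]
    rw [h3] at h2
    have hXc : (0 : ℝ) < X.card := by exact_mod_cast hX.card_pos
    have hδ0 : 0 ≤ δ := le_trans (Finset.sum_nonneg fun u _ => hβ0 u) (hgood' 0)
    have h4 : ((X + W).card : ℝ) * δ ≤ 5 * X.card * δ := mul_le_mul_of_nonneg_right hXW hδ0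
    have h5 : 5 * (X.card : ℝ) * δ < 5 * X.card * (1 / 5) :=
      mul_lt_mul_of_pos_left hδ (by linarith)
    linarith
  · intro x
    have e1 : ∑ t ∈ HF, ((fZ (x + t) : ℝ) - a x) =
        ∑ t ∈ HF, ∑ u, β u * ((fZ (x + t + u) : ℝ) - a (x + t)) := by
      rw [Finset.sum_comm]
      have : ∀ u, ∑ t ∈ HF, β u * ((fZ (x + t + u) : ℝ) - a (x + t)) =
          β u * ∑ t ∈ HF, ((fZ (x + t) : ℝ) - a x) := by
        intro u
        by_cases hu : β u = 0
        · simp [hu]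
        rw [← Finset.mul_sum]
        congr 1
        have huH := hβH u hu
        apply Finset.sum_bij (fun t _ => t + u)
        · intro t ht
          rw [hHF] at *
          exact H.add_mem ht huH
        · intro t _ t' _ h
          exact add_left_injective u h
        · intro t ht
          refine ⟨t - u, ?_, sub_add_cancel _ _⟩
          rw [hHF] at *
          exact H.sub_mem ht huH
        · intro t ht
          rw [hinv t ((hHF t).1 ht) x, add_assoc]
      rw [Finset.sum_congr rfl fun u _ => this u, ← Finset.sum_mul, hβ1, one_mul]
    rw [e1]
    refine (Finset.abs_sum_le_sum_abs _ _).trans ?_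
    have hb : ∀ t ∈ HF, |∑ u, β u * ((fZ (x + t + u) : ℝ) - a (x + t))| ≤ (2 * n + 2) * δ := by
      intro t _
      refine (Finset.abs_sum_le_sum_abs _ _).trans ?_
      calc ∑ u, |β u * ((fZ (x + t + u) : ℝ) - a (x + t))|
          ≤ ∑ u, (if u ∈ bad (x + t) then (2 * n + 2) * β u else 0) := by
            apply Finset.sum_le_sum
            intro u _
            split_ifs with hu
            · rw [abs_mul, abs_of_nonneg (hβ0 u), mul_comm]
              apply mul_le_mul_of_nonneg_right _ (hβ0 u)
              have h1 := hab (x + t + u)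
              have h2 := hab (x + t + g (x + t))
              refine (abs_sub _ _).trans ?_
              rw [ha]; dsimp only
              linarith
            · rw [heq _ _ hu]; simp
        _ = (2 * n + 2) * ∑ u ∈ bad (x + t), β u := by
            rw [Finset.sum_ite_mem, Finset.univ_inter, Finset.mul_sum]
        _ ≤ (2 * n + 2) * δ := mul_le_mul_of_nonneg_left (hgood' _) (by positivity)
    refine (Finset.sum_le_sum hb).trans ?_
    rw [Finset.sum_const, nsmul_eq_mul, mul_comm]

end Part13

section Part14

variable {G : Type} [AddCommGroup G] [DecidableEq G] [Fintype G]

theorem two_pow_le_exp (k : ℕ) : (2 : ℝ) ^ k ≤ Real.exp k := by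
  have h : (2 : ℝ) ≤ Real.exp 1 := by linarith [Real.exp_one_gt_d9]
  calc (2 : ℝ) ^ k ≤ (Real.exp 1) ^ k := pow_le_pow_left₀ (by norm_num) h k
    _ = Real.exp k := by rw [← Real.exp_nat_mul, mul_one]

theorem log_le_of_le_two_pow {x : ℝ} (k : ℕ) (hx : 0 < x) (h : x ≤ 2 ^ k) : Real.log x ≤ k := by
  rw [Real.log_le_iff_le_exp hx]
  exact h.trans (two_pow_le_exp k)

theorem log4K_le (n L : ℕ) (hn : 1 ≤ n) (hL : 1 ≤ L) (hnL : n ≤ 2 ^ L) (K1 K : ℝ)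
    (hK1 : K1 = 3 * (800 * n ^ 2 : ℝ) ^ (80 * n)) (hK : K = 2 ^ 48 * K1 ^ 18) :
    Real.log (4 * K) ≤ 2 ^ 15 * (n * L) := by
  have hnr : (1 : ℝ) ≤ n := by exact_mod_cast hn
  have hnL' : (n : ℝ) ≤ 2 ^ L := by exact_mod_cast hnL
  have hnl : 1 ≤ n * L := Nat.one_le_iff_ne_zero.2 (by positivity)
  have h1 : (800 * n ^ 2 : ℝ) ≤ 2 ^ (10 + 2 * L) := by
    calc (800 * n ^ 2 : ℝ) ≤ 2 ^ 10 * (2 ^ L) ^ 2 := by gcongr; norm_num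
      _ = _ := by rw [pow_add, ← pow_mul, mul_comm 2 L]
  have hnn : n ≤ n * L := Nat.le_mul_of_pos_right _ hL
  have h2 : K1 ≤ 2 ^ (962 * (n * L)) := by
    calc K1 ≤ 2 ^ 2 * (2 ^ (10 + 2 * L)) ^ (80 * n) := by rw [hK1]; gcongr; norm_num
      _ = 2 ^ (2 + (10 + 2 * L) * (80 * n)) := by rw [← pow_mul, ← pow_add]
      _ ≤ _ := by
        apply pow_le_pow_right₀ (by norm_num)
        have e : (10 + 2 * L) * (80 * n) = 800 * n + 160 * (n * L) := by ring
        rw [e]; omega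
  have hK1p : 0 < K1 := by rw [hK1]; positivity
  have h3 : 4 * K ≤ 2 ^ (17366 * (n * L)) := by
    calc 4 * K ≤ 2 ^ 50 * (2 ^ (962 * (n * L))) ^ 18 := by
          rw [hK]
          have : K1 ^ 18 ≤ (2 ^ (962 * (n * L))) ^ 18 := pow_le_pow_left₀ hK1p.le h2 18
          calc 4 * (2 ^ 48 * K1 ^ 18) = 2 ^ 50 * K1 ^ 18 := by ring
            _ ≤ _ := by gcongr
      _ = 2 ^ (50 + 962 * (n * L) * 18) := by rw [← pow_mul, ← pow_add]
      _ ≤ _ := pow_le_pow_right₀ (by norm_num) (by omega)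
  have h4 := log_le_of_le_two_pow _ (by rw [hK]; positivity) h3
  push_cast at h4
  have : (0 : ℝ) ≤ n * L := by positivity
  linarith

theorem Dlev_le (n L Lv : ℕ) (hn : 1 ≤ n) (hL : 1 ≤ L) (hnL : n ≤ 2 ^ L) (lK : ℝ)
    (hlK : lK ≤ 2 ^ 15 * (n * L)) (hlK0 : 0 ≤ lK) (hLv : Lv ≤ 3200 * (n * L)) :
    Dlev n lK Lv ≤ 2 ^ 53 * (n ^ 4 * L ^ 3) := by
  have hx : (1 : ℝ) ≤ n := by exact_mod_cast hn
  have hy : (1 : ℝ) ≤ L := by exact_mod_cast hL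
  have h81 : 81 * n ≤ 2 ^ (8 * L) := by
    calc 81 * n ≤ 2 ^ 7 * 2 ^ L := Nat.mul_le_mul (by norm_num) hnL
      _ = 2 ^ (7 + L) := by rw [pow_add]
      _ ≤ _ := Nat.pow_le_pow_right (by norm_num) (by omega)
  have h81r : (81 * n : ℝ) ≤ 2 ^ (8 * L) := by exact_mod_cast h81
  have l1 : Real.log (81 * n) ≤ 8 * L := by
    have := log_le_of_le_two_pow (8 * L) (by positivity) h81r
    push_cast at this; exact this
  have l10 : 0 ≤ Real.log (81 * n) := Real.log_nonneg (by linarith)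
  have hLvr : (Lv : ℝ) ≤ 3200 * (n * L) := by exact_mod_cast hLv
  have hLn : (L : ℝ) ≤ n * L := le_mul_of_one_le_left (by linarith) hx
  have l2 : Real.log (81 * n * 2 ^ Lv) ≤ 3208 * (n * L) := by
    have h : (81 * n * 2 ^ Lv : ℝ) ≤ 2 ^ (8 * L + Lv) := by
      rw [pow_add]; gcongr
    have := log_le_of_le_two_pow (8 * L + Lv) (by positivity) h
    push_cast at this
    linarith
  unfold Dlev
  have t1 : lK ≤ 2 ^ 15 * (n ^ 4 * L ^ 3 : ℝ) := by
    refine hlK.trans ?_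
    have a1 : (n : ℝ) ≤ n ^ 4 := le_self_pow₀ hx (by norm_num)
    have a2 : (L : ℝ) ≤ L ^ 3 := le_self_pow₀ hy (by norm_num)
    gcongr
  have t2 : 768000 * (n : ℝ) ^ 2 * lK ^ 2 * Real.log (81 * n) ≤
      768000 * 2 ^ 33 * (n ^ 4 * L ^ 3) := by
    calc 768000 * (n : ℝ) ^ 2 * lK ^ 2 * Real.log (81 * n)
        ≤ 768000 * (n : ℝ) ^ 2 * (2 ^ 15 * (n * L)) ^ 2 * (8 * L) := by gcongr
      _ = _ := by ring
  have t3 : 4000000 * (n : ℝ) ^ 2 * (Lv + lK) * Real.log (81 * n * 2 ^ Lv) ≤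
      4000000 * 35968 * 3208 * (n ^ 4 * L ^ 3) := by
    calc 4000000 * (n : ℝ) ^ 2 * (Lv + lK) * Real.log (81 * n * 2 ^ Lv)
        ≤ 4000000 * (n : ℝ) ^ 2 * (35968 * (n * L)) * (3208 * (n * L)) := by
          have : Lv + lK ≤ 35968 * (n * L : ℝ) := by linarith
          have l20 : 0 ≤ 4000000 * (n : ℝ) ^ 2 * (Lv + lK) := by positivity
          refine (mul_le_mul_of_nonneg_left l2 l20).trans ?_
          gcongr
      _ = 4000000 * 35968 * 3208 * ((n : ℝ) ^ 4 * (L : ℝ) ^ 2) := by ring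
      _ ≤ _ := by
          have : (L : ℝ) ^ 2 ≤ L ^ 3 := pow_le_pow_right₀ hy (by norm_num)
          gcongr
  have t0 : (0 : ℝ) ≤ n ^ 4 * L ^ 3 := by positivity
  have := add_le_add (add_le_add t1 t2) t3
  refine this.trans ?_
  linarith

/-- Structure of the support: many dilates of a large set with small growth. -/
theorem support_structure (c : AddChar G ℂ → ℂ) (n : ℕ) (hn : 1 ≤ n) (hc : ∑ γ, ‖c γ‖ ≤ n)
    (fZ : G → ℤ) (ε : ℝ) (hε : ε ≤ Real.exp (-(20 * n))) (hf : ∀ x, ‖fs c x - fZ x‖ ≤ ε)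
    (A : Finset G) (hA : ∀ x, x ∈ A ↔ fZ x ≠ 0) (hne : A.Nonempty) (L : ℕ) (hL : 1 ≤ L)
    (hnL : n ≤ 2 ^ L) (Lv : ℕ) (hLv1 : 1 ≤ Lv) (hLv : Lv ≤ 3200 * (n * L)) :
    ∃ (X' T : Finset G), X' ⊆ A ∧ X'.Nonempty ∧ Sym0 T ∧
      ((X' + ms (2 ^ Lv) T).card : ℝ) ≤ 5 * X'.card ∧
      (A.card : ℝ) ≤ Real.exp (2 ^ 53 * (n ^ 4 * L ^ 3)) * T.card := by
  obtain ⟨K1, hK1⟩ : ∃ K1 : ℝ, K1 = 3 * (800 * n ^ 2 : ℝ) ^ (80 * n) := ⟨_, rfl⟩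
  obtain ⟨X, hXA, hX, h1, h2⟩ := lemma_E c n hn hc fZ ε hε hf A hA hne K1 hK1
  obtain ⟨K, hK⟩ : ∃ K : ℝ, K = 2 ^ 48 * K1 ^ 18 := ⟨_, rfl⟩
  have hnr : (1 : ℝ) ≤ n := by exact_mod_cast hn
  have hK1' : 1 ≤ K1 := by
    rw [hK1]
    have h1 : (1 : ℝ) ≤ 800 * n ^ 2 := by
      have : (1 : ℝ) ≤ n ^ 2 := one_le_pow₀ hnr
      linarith
    have := one_le_pow₀ h1 (n := 80 * n)
    linarith
  have hK1le : K1 ≤ K1 ^ 18 := le_self_pow₀ hK1' (by norm_num)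
  have hXc : (0 : ℝ) < X.card := by exact_mod_cast hX.card_pos
  have hKge : 8 * K1 ≤ K := by rw [hK]; linarith
  have hKone : 1 ≤ K := by linarith
  have hAX : (A.card : ℝ) ≤ K * X.card :=
    h1.trans (mul_le_mul_of_nonneg_right hKge hXc.le)
  have hXQ : (X.card : ℝ) ≤ (X - X).card := by
    exact_mod_cast Finset.card_le_card_sub_right hX
  have hAQ : (A.card : ℝ) ≤ K * (X - X).card :=
    hAX.trans (mul_le_mul_of_nonneg_left hXQ (by linarith))
  have hKX : ((X + (X - X)).card : ℝ) ≤ K * X.card := by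
    have h3 := Finset.pluennecke_ruzsa_inequality_nsmul_sub_nsmul_sub hX X 2 1
    have h4 : (2 • X - 1 • X) = X + (X - X) := by
      rw [two_nsmul, one_nsmul, add_sub_assoc]
    rw [h4] at h3
    have h5 : (((X + (X - X)).card : ℚ≥0) : ℝ) ≤
        (((((X - X).card : ℚ≥0) / (X.card : ℚ≥0)) ^ (2 + 1) * (X.card : ℚ≥0) : ℚ≥0) : ℝ) := by
      exact_mod_cast h3
    push_cast at h5
    refine h5.trans ?_
    apply mul_le_mul_of_nonneg_right _ hXc.le
    have h6 : ((X - X).card : ℝ) / X.card ≤ 2 ^ 16 * K1 ^ 6 := by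
      rw [div_le_iff₀ hXc]; exact h2
    calc (((X - X).card : ℝ) / X.card) ^ (2 + 1) ≤ (2 ^ 16 * K1 ^ 6) ^ (2 + 1) :=
          pow_le_pow_left₀ (by positivity) h6 _
      _ = K := by rw [hK]; ring
  have hf' : ∀ x, ‖fs c x - fZ x‖ ≤ 1 / 10 := by
    intro x
    refine (hf x).trans (hε.trans ?_)
    rw [Real.exp_neg, one_div]
    apply inv_anti₀ (by norm_num)
    have := Real.add_one_le_exp (20 * (n : ℝ))
    linarith
  obtain ⟨X', T, a1, a2, a3, a4, a5⟩ := levels c n hn hc fZ hf' A hA X (X - X) hXA hX (sym0_sub hX) K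
    hKone hKX hAX hAQ Lv hLv1
  refine ⟨X', T, a1, a2, a3, a4, a5.trans ?_⟩
  apply mul_le_mul_of_nonneg_right _ (by positivity)
  apply Real.exp_le_exp.2
  exact Dlev_le n L Lv hn hL hnL _ (log4K_le n L hn hL hnL K1 K hK1 hK)
    (Real.log_nonneg (by linarith)) hLv

end Part14

section Part15

variable {G : Type} [AddCommGroup G] [DecidableEq G] [Fintype G]

theorem ms_subset_closure (V : Finset G) (k : ℕ) : ∀ u ∈ ms k V, u ∈ AddSubgroup.closure (V : Set G) := by
  induction k with
  | zero =>
    intro u hu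
    rw [ms_zero, Finset.mem_singleton] at hu
    rw [hu]; exact AddSubgroup.zero_mem _
  | succ k ih =>
    intro u hu
    rw [ms_succ] at hu
    obtain ⟨v, hv, w, hw, rfl⟩ := Finset.mem_add.1 hu
    exact AddSubgroup.add_mem _ (AddSubgroup.subset_closure (Finset.mem_coe.2 hv)) (ih w hw)

theorem cells_le (n L j h p g N I : ℕ) (hn : 1 ≤ n) (hL : 1 ≤ L) (hN : N = 2 ^ (128 * L))
    (hI : I = 20 * n + 5) (hj : j ≤ 20 * n) (hp : p = 40 * n) (hh : 2 ^ h ≤ 40 * n)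
    (hg : g ≤ 1280 * p * 2 ^ h * n) :
    (((4 * (N : ℝ) ^ (j + 1) + 1) ^ 2) ^ g) ≤ Real.exp (2 ^ 34 * (n ^ 4 * L ^ 3)) := by
  have hnl : n ≤ n * L := Nat.le_mul_of_pos_right _ hL
  have hll : L ≤ n * L := Nat.le_mul_of_pos_left _ hn
  have h1 : (N : ℝ) ^ (j + 1) ≤ 2 ^ (3200 * (n * L)) := by
    rw [hN]; push_cast
    rw [← pow_mul]
    apply pow_le_pow_right₀ (by norm_num)
    calc 128 * L * (j + 1) ≤ 128 * L * (25 * n) := Nat.mul_le_mul_left _ (by omega)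
      _ = 3200 * (n * L) := by ring
  have h2 : 4 * (N : ℝ) ^ (j + 1) + 1 ≤ 2 ^ (3203 * (n * L)) := by
    have h3 : (1 : ℝ) ≤ 2 ^ (3200 * (n * L)) := one_le_pow₀ (by norm_num)
    calc 4 * (N : ℝ) ^ (j + 1) + 1 ≤ 8 * 2 ^ (3200 * (n * L)) := by linarith
      _ = 2 ^ (3 + 3200 * (n * L)) := by rw [pow_add]; norm_num
      _ ≤ _ := pow_le_pow_right₀ (by norm_num) (by omega)
  have hg' : g ≤ 2 ^ 21 * n ^ 3 := by
    calc g ≤ 1280 * p * 2 ^ h * n := hg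
      _ ≤ 1280 * (40 * n) * (40 * n) * n := by rw [hp]; gcongr
      _ = 2048000 * n ^ 3 := by ring
      _ ≤ _ := Nat.mul_le_mul_right _ (by norm_num)
  have h4 : (((4 * (N : ℝ) ^ (j + 1) + 1) ^ 2) ^ g) ≤ 2 ^ (6406 * (n * L) * g) := by
    calc (((4 * (N : ℝ) ^ (j + 1) + 1) ^ 2) ^ g) ≤ ((2 ^ (3203 * (n * L))) ^ 2) ^ g := by gcongr
      _ = _ := by
        rw [← pow_mul, ← pow_mul]; congr 1; ring
  refine h4.trans ((two_pow_le_exp _).trans ?_)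
  apply Real.exp_le_exp.2
  have h5 : 6406 * (n * L) * g ≤ 2 ^ 34 * (n ^ 4 * L ^ 3) := by
    calc 6406 * (n * L) * g ≤ 6406 * (n * L) * (2 ^ 21 * n ^ 3) := Nat.mul_le_mul_left _ hg'
      _ = 6406 * 2 ^ 21 * (n ^ 4 * L) := by ring
      _ ≤ 2 ^ 34 * (n ^ 4 * L ^ 3) := by
        apply Nat.mul_le_mul (by norm_num)
        exact Nat.mul_le_mul_left _ (Nat.le_self_pow (by norm_num) L)
  exact_mod_cast h5

theorem N_bound (n L s N1 N : ℕ) (hn : 1 ≤ n) (hL : 1 ≤ L) (hnL : n ≤ 2 ^ L) (hN : N = 2 ^ (128 * L))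
    (hs : s ≤ 2 ^ 21 * n ^ 3) (hN1 : N1 = 1600 * n * (2 ^ 54 * (n ^ 4 * L ^ 3) + 2)) :
    (s + 1) * (N1 + 1) ≤ N ∧ 200 * n * s ≤ N := by
  have hL2 : L ≤ 2 ^ L := Nat.lt_two_pow_self.le
  have h1 : 1 ≤ n ^ 3 := Nat.one_le_pow _ _ hn
  have h2 : 1 ≤ n ^ 4 * L ^ 3 := Nat.one_le_iff_ne_zero.2 (by positivity)
  have h3 : s + 1 ≤ 2 ^ 22 * n ^ 3 := by omega
  have h4 : N1 + 1 ≤ 2 ^ 66 * n * (n ^ 4 * L ^ 3) := by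
    rw [hN1]
    calc 1600 * n * (2 ^ 54 * (n ^ 4 * L ^ 3) + 2) + 1
        ≤ 1600 * n * (2 ^ 55 * (n ^ 4 * L ^ 3)) + n * (n ^ 4 * L ^ 3) := by
          gcongr
          · omega
          · exact Nat.one_le_iff_ne_zero.2 (by positivity)
      _ = (1600 * 2 ^ 55 + 1) * n * (n ^ 4 * L ^ 3) := by ring
      _ ≤ _ := by gcongr; norm_num
  constructor
  · calc (s + 1) * (N1 + 1) ≤ (2 ^ 22 * n ^ 3) * (2 ^ 66 * n * (n ^ 4 * L ^ 3)) := Nat.mul_le_mul h3 h4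
      _ = 2 ^ 88 * (n ^ 8 * L ^ 3) := by ring
      _ ≤ 2 ^ 88 * ((2 ^ L) ^ 8 * (2 ^ L) ^ 3) := by gcongr
      _ = 2 ^ (88 + (L * 8 + L * 3)) := by rw [pow_add, pow_add, pow_mul, pow_mul]
      _ ≤ 2 ^ (128 * L) := Nat.pow_le_pow_right (by norm_num) (by omega)
      _ = N := hN.symm
  · calc 200 * n * s ≤ 2 ^ 8 * n * (2 ^ 21 * n ^ 3) := by gcongr; norm_num
      _ = 2 ^ 29 * n ^ 4 := by ring
      _ ≤ 2 ^ 29 * (2 ^ L) ^ 4 := by gcongr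
      _ = 2 ^ (29 + L * 4) := by rw [pow_add, pow_mul]
      _ ≤ 2 ^ (128 * L) := Nat.pow_le_pow_right (by norm_num) (by omega)
      _ = N := hN.symm

theorem growth_num (n N1 : ℕ) (hn : 1 ≤ n) (D κ : ℝ) (hκ : κ = 1 / (800 * n))
    (hN1 : (N1 : ℝ) = 1600 * n * (D + 2)) (hD : 0 ≤ D) : 5 * Real.exp D < (1 + κ) ^ N1 := by
  have hnr : (1 : ℝ) ≤ n := by exact_mod_cast hn
  have hκ0 : 0 < κ := by rw [hκ]; positivity
  have hκ1 : κ ≤ 1 := by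
    rw [hκ, div_le_one (by positivity)]; linarith
  have h1 : κ / 2 ≤ Real.log (1 + κ) := by
    refine le_trans ?_ (Real.one_sub_inv_le_log_of_pos (by linarith))
    have : 1 - (1 + κ)⁻¹ = κ / (1 + κ) := by field_simp; ring
    rw [this]
    apply div_le_div_of_nonneg_left hκ0.le (by linarith) (by linarith)
  have h2 : Real.exp (D + 2) ≤ (1 + κ) ^ N1 := by
    rw [← Real.exp_log (show 0 < 1 + κ by linarith), ← Real.exp_nat_mul]
    apply Real.exp_le_exp.2
    calc D + 2 = N1 * (κ / 2) := by
          rw [hN1, hκ]; field_simp; ring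
      _ ≤ _ := mul_le_mul_of_nonneg_left h1 (by positivity)
  refine lt_of_lt_of_le ?_ h2
  rw [Real.exp_add, mul_comm]
  apply mul_lt_mul_of_pos_left _ (Real.exp_pos D)
  have := Real.exp_one_gt_d9
  have e : Real.exp 2 = Real.exp 1 * Real.exp 1 := by rw [← Real.exp_add]; norm_num
  rw [e]
  nlinarith

theorem delta_num (n h : ℕ) (hn : 1 ≤ n) (hh : 2 ^ h ≤ 40 * n) (p : ℕ) (hp : p = 40 * n) :
    (2 * n + 2) * (h * (8 * Real.exp (-p))) ≤ Real.exp (-(24 * n)) := by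
  have hnr : (1 : ℝ) ≤ n := by exact_mod_cast hn
  have hh' : h ≤ 40 * n := (Nat.lt_two_pow_self (n := h)).le.trans hh
  have hhr : (h : ℝ) ≤ 40 * n := by exact_mod_cast hh'
  have h1 : (2 * n + 2 : ℝ) * (h * 8) ≤ Real.exp (16 * n) := by
    calc (2 * n + 2 : ℝ) * (h * 8) ≤ (4 * n) * (40 * n * 8) := by gcongr; linarith
      _ = 1280 * (n * n) := by ring
      _ ≤ Real.exp (14 * n) * (Real.exp n * Real.exp n) := by
        have a1 : (n : ℝ) ≤ Real.exp n := by linarith [Real.add_one_le_exp (n : ℝ)]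
        have a2 : (1280 : ℝ) ≤ Real.exp (14 * n) := by
          calc (1280 : ℝ) ≤ 2 ^ 14 := by norm_num
            _ ≤ Real.exp (14 : ℕ) := two_pow_le_exp 14
            _ ≤ _ := Real.exp_le_exp.2 (by push_cast; linarith)
        gcongr
      _ = Real.exp (16 * n) := by rw [← Real.exp_add, ← Real.exp_add]; congr 1; ring
  calc (2 * n + 2) * (h * (8 * Real.exp (-p))) = (2 * n + 2 : ℝ) * (h * 8) * Real.exp (-p) := by ring
    _ ≤ Real.exp (16 * n) * Real.exp (-p) := by gcongr
    _ = Real.exp (-(24 * n)) := by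
      rw [← Real.exp_add, hp]; congr 1; push_cast; ring

/-- The main structural step. -/
theorem step (c : AddChar G ℂ → ℂ) (n : ℕ) (hn : 1 ≤ n) (hc : ∑ γ, ‖c γ‖ ≤ n)
    (fZ : G → ℤ) (ε : ℝ) (hε : ε ≤ Real.exp (-(20 * n))) (hf : ∀ x, ‖fs c x - fZ x‖ ≤ ε)
    (A : Finset G) (hA : ∀ x, x ∈ A ↔ fZ x ≠ 0) (hne : A.Nonempty) (L : ℕ) (hL : 1 ≤ L)
    (hnL : n ≤ 2 ^ L) :
    ∃ (H : AddSubgroup G) (HF : Finset G), (∀ x, x ∈ HF ↔ x ∈ H) ∧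
      (A.card : ℝ) ≤ Real.exp (2 ^ 54 * (n ^ 4 * L ^ 3)) * HF.card ∧
      ∃ a : G → ℤ, (∀ x, ∀ t ∈ H, a (x + t) = a x) ∧ (∃ y, a y ≠ 0) ∧
        ∀ x, |∑ t ∈ HF, ((fZ (x + t) : ℝ) - a x)| ≤ Real.exp (-(24 * n)) * HF.card := by
  classical
  have hnr : (1 : ℝ) ≤ n := by exact_mod_cast hn
  obtain ⟨N, hN⟩ : ∃ N : ℕ, N = 2 ^ (128 * L) := ⟨_, rfl⟩
  obtain ⟨I, hI⟩ : ∃ I : ℕ, I = 20 * n + 5 := ⟨_, rfl⟩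
  obtain ⟨Lv, hLv⟩ : ∃ Lv : ℕ, Lv = 128 * L * I := ⟨_, rfl⟩
  obtain ⟨p, hp⟩ : ∃ p : ℕ, p = 40 * n := ⟨_, rfl⟩
  obtain ⟨h, hh1, hh2⟩ : ∃ h : ℕ, 20 * n ≤ 2 ^ h ∧ 2 ^ h ≤ 40 * n := by
    refine ⟨Nat.log 2 (20 * n) + 1, (Nat.lt_pow_succ_log_self (by norm_num) _).le, ?_⟩
    have := Nat.pow_log_le_self 2 (x := 20 * n) (by omega)
    rw [pow_succ]; omega
  obtain ⟨s, hs⟩ : ∃ s : ℕ, s = 32 * p * 4 ^ h := ⟨_, rfl⟩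
  have hs2 : s ≤ 2 ^ 21 * n ^ 3 := by
    have e4 : (4 : ℕ) ^ h = 2 ^ h * 2 ^ h := by rw [← mul_pow]; norm_num
    calc s = 32 * (40 * n) * (2 ^ h * 2 ^ h) := by rw [hs, hp, e4]
      _ ≤ 32 * (40 * n) * ((40 * n) * (40 * n)) := by gcongr
      _ = 2048000 * n ^ 3 := by ring
      _ ≤ _ := Nat.mul_le_mul_right _ (by norm_num)
  obtain ⟨N1, hN1⟩ : ∃ N1 : ℕ, N1 = 1600 * n * (2 ^ 54 * (n ^ 4 * L ^ 3) + 2) := ⟨_, rfl⟩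
  obtain ⟨hNb1, hNb2⟩ := N_bound n L s N1 N hn hL hnL hN hs2 hN1
  have hN2 : 2 ≤ N := by
    rw [hN]
    calc 2 = 2 ^ 1 := by norm_num
      _ ≤ _ := Nat.pow_le_pow_right (by norm_num) (by omega)
  have hLvle : Lv ≤ 3200 * (n * L) := by
    rw [hLv]
    calc 128 * L * I ≤ 128 * L * (25 * n) := Nat.mul_le_mul_left _ (by omega)
      _ = _ := by ring
  have hLv1 : 1 ≤ Lv := by
    rw [hLv]; exact Nat.one_le_iff_ne_zero.2 (by rw [hI]; positivity)
  obtain ⟨X, T, hXA, hX, hT, hXT, hAT⟩ := support_structure c n hn hc fZ ε hε hf A hA hne L hL hnL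
    Lv hLv1 hLvle
  have hNI : 2 ^ Lv = N ^ I := by rw [hLv, hN, ← pow_mul]
  rw [hNI] at hXT
  obtain ⟨κ, hκ⟩ : ∃ κ : ℝ, κ = 1 / (800 * n) := ⟨_, rfl⟩
  obtain ⟨ν, hν⟩ : ∃ ν : ℝ, ν = 1 / (100 * n) := ⟨_, rfl⟩
  have hκ0 : 0 ≤ κ := by rw [hκ]; positivity
  have hν0 : 0 ≤ ν := by rw [hν]; positivity
  have hNpos : (0 : ℝ) < N := by exact_mod_cast (show 0 < N by omega)
  have hκν : 4 * κ + s / N ≤ ν := by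
    have h1 : (s : ℝ) / N ≤ 1 / (200 * n) := by
      rw [div_le_div_iff₀ hNpos (by positivity)]
      have : (200 * n * s : ℝ) ≤ N := by exact_mod_cast hNb2
      linarith
    have h2 : 4 * κ + 1 / (200 * n) = ν := by
      rw [hκ, hν]; field_simp; norm_num
    linarith
  have hnh : (n : ℝ) ≤ 2 ^ h / 20 := by
    rw [le_div_iff₀ (by norm_num)]
    have : (20 * n : ℝ) ≤ 2 ^ h := by exact_mod_cast hh1
    linarith
  obtain ⟨D, hD⟩ : ∃ D : ℝ, D = 2 ^ 54 * ((n : ℝ) ^ 4 * (L : ℝ) ^ 3) := ⟨_, rfl⟩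
  have hD0 : 0 ≤ D := by rw [hD]; positivity
  -- size of the refined sets
  have hVcard : ∀ (j : ℕ) (Γ : Finset (AddChar G ℂ)), j ≤ 20 * n → Γ.card ≤ 1280 * p * 2 ^ h * n →
      (A.card : ℝ) ≤ Real.exp D * (Vs T N I (j + 1) Γ).card := by
    intro j Γ hj hΓ
    have h1 := Vs_card hT (N := N) (I := I) (j := j + 1) hN2 (by omega) Γ
    have h2 : (T.card : ℝ) ≤ ((4 * (N : ℝ) ^ (j + 1) + 1) ^ 2) ^ Γ.card * (Vs T N I (j + 1) Γ).card := by
      exact_mod_cast h1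
    have h3 := cells_le n L j h p Γ.card N I hn hL hN hI hj hp hh2 hΓ
    calc (A.card : ℝ) ≤ Real.exp (2 ^ 53 * (n ^ 4 * L ^ 3)) * T.card := hAT
      _ ≤ Real.exp (2 ^ 53 * (n ^ 4 * L ^ 3)) * (Real.exp (2 ^ 34 * (n ^ 4 * L ^ 3)) *
          (Vs T N I (j + 1) Γ).card) := by
          apply mul_le_mul_of_nonneg_left _ (Real.exp_pos _).le
          exact h2.trans (mul_le_mul_of_nonneg_right h3 (by positivity))
      _ = Real.exp (2 ^ 53 * (n ^ 4 * L ^ 3) + 2 ^ 34 * (n ^ 4 * L ^ 3)) *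
          (Vs T N I (j + 1) Γ).card := by rw [Real.exp_add]; ring
      _ ≤ _ := by
          apply mul_le_mul_of_nonneg_right _ (by positivity)
          apply Real.exp_le_exp.2
          rw [hD]
          have : (0 : ℝ) ≤ n ^ 4 * L ^ 3 := by positivity
          linarith
  have hms : ∀ (j : ℕ) (Γ : Finset (AddChar G ℂ)), j ≤ 20 * n →
      ms N (Vs T N I (j + 1) Γ) ⊆ ms (N ^ I) T := by
    intro j Γ hj
    refine (ms_Vs (by omega) (by omega) Γ).trans ?_
    intro x hx
    exact ms_mono_left hT.1 (Nat.pow_le_pow_right (by omega) (by omega)) (mem_Vs.1 hx).1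
  have hgr : ∀ (j : ℕ) (Γ : Finset (AddChar G ℂ)), j ≤ 20 * n → Γ.card ≤ 1280 * p * 2 ^ h * n →
      ∃ n0, (s + 1) * n0 ≤ N ∧ ((Vs T N I (j + 1) Γ + ms n0 (Vs T N I (j + 1) Γ)).card : ℝ) ≤
      (1 + κ) * (ms n0 (Vs T N I (j + 1) Γ)).card := by
    intro j Γ hj hΓ
    have hV := Vs_sym0 hT N I (j + 1) Γ
    have hN1N : N1 + 1 ≤ N := le_trans (Nat.le_mul_of_pos_left _ (by omega)) hNb1
    have hVpos : (0 : ℝ) < (Vs T N I (j + 1) Γ).card := by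
      exact_mod_cast Finset.card_pos.2 ⟨0, hV.1⟩
    obtain ⟨n0, hn0, hn0'⟩ := growth (Vs T N I (j + 1) Γ) (ms (N ^ I) T) N1 κ hκ0
      ((ms_mono_left hV.1 hN1N).trans (hms j Γ hj)) (by
        have h1 : ((ms (N ^ I) T).card : ℝ) ≤ (X + ms (N ^ I) T).card := by
          exact_mod_cast Finset.card_le_card_add_left hX
        have h2 : (X.card : ℝ) ≤ A.card := by exact_mod_cast Finset.card_le_card hXA
        have h3 := hVcard j Γ hj hΓ
        have h4 := growth_num n N1 hn D κ hκ (by rw [hN1, hD]; push_cast; ring) hD0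
        calc ((ms (N ^ I) T).card : ℝ) ≤ 5 * (Real.exp D * (Vs T N I (j + 1) Γ).card) := by linarith
          _ = (5 * Real.exp D) * (Vs T N I (j + 1) Γ).card := by ring
          _ < _ := mul_lt_mul_of_pos_right h4 hVpos)
    refine ⟨n0, le_trans (Nat.mul_le_mul_left _ (by omega)) hNb1, hn0'⟩
  obtain ⟨j, Γ, hj, hΓ, β, hβ0, hβ1, hβs, hgood⟩ := iterate c n hc T hT N I (by omega) hI κ ν hν0 s h p
    (by omega) hs hnh hκν hκ0 hgr
  obtain ⟨V, hV⟩ : ∃ V, V = Vs T N I (j + 1) Γ := ⟨_, rfl⟩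
  have hVs : Sym0 V := by rw [hV]; exact Vs_sym0 hT N I (j + 1) Γ
  have hVsub : V ⊆ Vs T N I j Γ := by rw [hV]; exact Vs_succ_subset hT (by omega) (by omega) Γ
  have hδ := delta_num n h hn hh2 p hp
  have hXW : ((X + ms N V).card : ℝ) ≤ 5 * X.card := by
    refine le_trans ?_ hXT
    have : X + ms N V ⊆ X + ms (N ^ I) T := Finset.add_subset_add_left (by rw [hV]; exact hms j Γ hj)
    exact_mod_cast Finset.card_le_card this
  rw [← hV] at hβs
  have hε25 : ε ≤ 1 / 25 := by
    refine hε.trans ?_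
    have h1 : Real.exp (-(20 * n)) ≤ Real.exp (-(20 : ℕ)) := by
      apply Real.exp_le_exp.2; push_cast; linarith
    refine h1.trans ?_
    rw [Real.exp_neg, one_div]
    apply inv_anti₀ (by norm_num)
    exact le_trans (by norm_num) (two_pow_le_exp 20)
  have hδ5 : (h : ℝ) * (8 * Real.exp (-p)) < 1 / 5 := by
    have h0 : 0 ≤ (h : ℝ) * (8 * Real.exp (-p)) := by positivity
    have h1 : (h : ℝ) * (8 * Real.exp (-p)) ≤ (2 * n + 2) * (h * (8 * Real.exp (-p))) :=
      le_mul_of_one_le_left h0 (by linarith)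
    have h2 : Real.exp (-(24 * n)) ≤ Real.exp (-(24 : ℕ)) := by
      apply Real.exp_le_exp.2; push_cast; linarith
    have h3 : Real.exp (-(24 : ℕ)) < 1 / 5 := by
      rw [Real.exp_neg, one_div]
      apply inv_strictAnti₀ (by norm_num)
      exact lt_of_lt_of_le (by norm_num) (two_pow_le_exp 24)
    exact lt_of_le_of_lt ((h1.trans hδ).trans h2) h3
  obtain ⟨HF, hHF⟩ : ∃ HF : Finset G, ∀ x, x ∈ HF ↔ x ∈ AddSubgroup.closure (V : Set G) :=
    ⟨Finset.univ.filter (fun x => x ∈ AddSubgroup.closure (V : Set G)), by simp⟩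
  obtain ⟨a, ha1, ha2, ha3⟩ := good_end c n hn hc fZ ε hε25 hf X (ms N V) V hX
    (fun x hx => (hA x).1 (hXA hx)) (Sym0.ms hVs N) hXW (Cap ν (Vs T N I j Γ)) ν hν
    (fun γ hγ v hv => mem_Cap.1 hγ v (hVsub hv)) β hβ0 hβ1 hβs _ rfl
    (fun u hu => ms_subset_closure V N u (hβs u hu)) _ hδ5 hgood HF hHF
  refine ⟨_, HF, hHF, ?_, a, ha1, ha2, ?_⟩
  · have h1 := hVcard j Γ hj hΓ
    rw [← hV, hD] at h1
    refine h1.trans ?_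
    apply mul_le_mul_of_nonneg_left _ (Real.exp_pos _).le
    have : V ⊆ HF := fun x hx => (hHF x).2 (AddSubgroup.subset_closure (Finset.mem_coe.2 hx))
    exact_mod_cast Finset.card_le_card this
  · intro x
    exact (ha3 x).trans (mul_le_mul_of_nonneg_right hδ (by positivity))

end Part15

section Part16

variable {G : Type} [AddCommGroup G] [DecidableEq G] [Fintype G]

theorem char_sum_subgroup (H : AddSubgroup G) (HF : Finset G) (hHF : ∀ x, x ∈ HF ↔ x ∈ H)
    (γ : AddChar G ℂ) (hγ : ¬ ∀ t ∈ H, γ t = 1) : ∑ t ∈ HF, γ t = 0 := by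
  push Not at hγ
  obtain ⟨t0, ht0, hne⟩ := hγ
  have h1 : γ t0 * ∑ t ∈ HF, γ t = ∑ t ∈ HF, γ t := by
    rw [Finset.mul_sum]
    apply Finset.sum_bij (fun t _ => t0 + t)
    · intro t ht
      rw [hHF] at *
      exact H.add_mem ht0 ht
    · intro t _ t' _ h
      exact add_right_injective t0 h
    · intro t ht
      refine ⟨t - t0, ?_, add_sub_cancel _ _⟩
      rw [hHF] at *
      exact H.sub_mem ht ht0
    · intro t _
      rw [AddChar.map_add_eq_mul]
  have h2 : (γ t0 - 1) * ∑ t ∈ HF, γ t = 0 := by rw [sub_mul, h1]; ring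
  rcases mul_eq_zero.1 h2 with h | h
  · exact absurd (sub_eq_zero.1 h) hne
  · exact h

open Classical in
theorem mean_fs (H : AddSubgroup G) (HF : Finset G) (hHF : ∀ x, x ∈ HF ↔ x ∈ H)
    (c : AddChar G ℂ → ℂ) (x : G) :
    ∑ t ∈ HF, fs c (x + t) = HF.card * ∑ γ with (∀ t ∈ H, γ t = 1), c γ * γ x := by
  unfold fs
  rw [Finset.sum_comm, Finset.mul_sum, Finset.sum_filter]
  apply Finset.sum_congr rfl
  intro γ _
  have e : ∑ t ∈ HF, c γ * γ (x + t) = c γ * γ x * ∑ t ∈ HF, γ t := by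
    rw [Finset.mul_sum]
    apply Finset.sum_congr rfl
    intro t _
    rw [AddChar.map_add_eq_mul]; ring
  rw [e]
  split_ifs with hγ
  · have : ∑ t ∈ HF, γ t = HF.card := by
      rw [Finset.sum_congr rfl fun t ht => hγ t ((hHF t).1 ht)]
      simp
    rw [this]; ring
  · rw [char_sum_subgroup H HF hHF γ hγ, mul_zero]

open Classical in
theorem coset_rep (H : AddSubgroup G) (HF : Finset G) (hHF : ∀ x, x ∈ HF ↔ x ∈ H)
    (a : G → ℤ) (ha : ∀ x, ∀ t ∈ H, a (x + t) = a x) :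
    ∃ z : Set G → ℤ, (∀ W, W ∉ cosets G → z W = 0) ∧
      (∀ x, (a x : ℝ) = ∑ W, (z W : ℝ) * W.indicator (1 : G → ℝ) x) ∧
      (∑ W, |(z W : ℝ)|) * HF.card = ∑ x, |(a x : ℝ)| := by
  set cs : G → Set G := fun x => (fun h => x + h) '' (H : Set G) with hcs
  have hmem : ∀ x y, y ∈ cs x ↔ y - x ∈ H := by
    intro x y
    rw [hcs]
    constructor
    · rintro ⟨h, hh, rfl⟩
      simpa using hh
    · intro h
      exact ⟨y - x, h, by simp⟩
  have hself : ∀ x, x ∈ cs x := fun x => by rw [hmem]; simp [H.zero_mem]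
  have heq : ∀ x y, y ∈ cs x → cs x = cs y := by
    intro x y hxy
    rw [hmem] at hxy
    ext w
    rw [hmem, hmem]
    constructor
    · intro h
      have := H.sub_mem h hxy
      rwa [sub_sub_sub_cancel_right] at this
    · intro h
      have := H.add_mem h hxy
      rwa [sub_add_sub_cancel] at this
  have haeq : ∀ x y, y ∈ cs x → a y = a x := by
    intro x y hxy
    rw [hmem] at hxy
    have := ha x _ hxy
    rwa [add_sub_cancel] at this
  set z : Set G → ℤ := fun W => if h : ∃ x, W = cs x then a h.choose else 0 with hz
  have hzc : ∀ x, z (cs x) = a x := by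
    intro x
    have h : ∃ y, cs x = cs y := ⟨x, rfl⟩
    rw [hz]
    dsimp only
    rw [dif_pos h]
    apply haeq
    exact (Set.ext_iff.1 h.choose_spec _).2 (hself _)
  have hz0 : ∀ W, (¬ ∃ x, W = cs x) → z W = 0 := by
    intro W h
    rw [hz]; dsimp only; rw [dif_neg h]
  have hsum : ∀ (g : ℤ → ℝ), g 0 = 0 → ∀ x, g (a x) = ∑ W, g (z W) * W.indicator (1 : G → ℝ) x := by
    intro g hg x
    rw [Finset.sum_eq_single (cs x)]
    · rw [hzc, Set.indicator_of_mem (hself x)]; simp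
    · intro W _ hW
      by_cases h : ∃ y, W = cs y
      · obtain ⟨y, rfl⟩ := h
        rw [Set.indicator_of_notMem, mul_zero]
        intro hx
        exact hW (heq y x hx)
      · rw [hz0 W h, hg, zero_mul]
    · intro h; exact absurd (Finset.mem_univ _) h
  refine ⟨z, ?_, hsum (fun i => (i : ℝ)) (by simp), ?_⟩
  · intro W hW
    apply hz0
    rintro ⟨x, rfl⟩
    exact hW ⟨H, x, rfl⟩
  · rw [Finset.sum_congr rfl fun x _ => hsum (fun i => |(i : ℝ)|) (by simp) x, Finset.sum_comm,
      Finset.sum_mul]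
    apply Finset.sum_congr rfl
    intro W _
    rw [← Finset.mul_sum]
    by_cases h : ∃ y, W = cs y
    · obtain ⟨y, rfl⟩ := h
      congr 1
      have e1 : ∑ x, (cs y).indicator (1 : G → ℝ) x = ∑ x, (if x - y ∈ HF then (1 : ℝ) else 0) := by
        apply Finset.sum_congr rfl
        intro x _
        by_cases hx : x - y ∈ H
        · rw [Set.indicator_of_mem ((hmem y x).2 hx), if_pos ((hHF _).2 hx)]
          rfl
        · rw [Set.indicator_of_notMem (fun h' => hx ((hmem y x).1 h')),
            if_neg (fun h' => hx ((hHF _).1 h'))]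
      have e2 := Equiv.sum_comp (Equiv.subRight y) (fun x => if x ∈ HF then (1 : ℝ) else 0)
      simp only [Equiv.subRight_apply] at e2
      rw [e1]
      exact (e2.trans (by simp)).symm
    · rw [hz0 W h]; simp

/-- One step of the outer induction. -/
theorem outer_step (c : AddChar G ℂ → ℂ) (n k : ℕ) (hn : 1 ≤ n) (hk : k + 1 ≤ 2 * n)
    (hc : ∑ γ, ‖c γ‖ ≤ (k + 1) / 2)
    (fZ : G → ℤ) (ε : ℝ) (hε : ε ≤ Real.exp (-(20 * n)) / 4 ^ (k + 1))
    (hf : ∀ x, ‖fs c x - fZ x‖ ≤ ε)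
    (hne : ∃ x, fZ x ≠ 0) (L : ℕ) (hL : 1 ≤ L) (hnL : n ≤ 2 ^ L) :
    ∃ (c' : AddChar G ℂ → ℂ) (H : AddSubgroup G) (HF : Finset G) (a : G → ℤ),
      (∀ x, x ∈ HF ↔ x ∈ H) ∧ (∀ x, ∀ t ∈ H, a (x + t) = a x) ∧ 0 < HF.card ∧
      ∑ x, |(a x : ℝ)| ≤ 2 * (n + 1) * Real.exp (2 ^ 54 * (n ^ 4 * L ^ 3)) * HF.card ∧
      ∑ γ, ‖c' γ‖ ≤ k / 2 ∧
      ∀ x, ‖fs c' x - ((fZ x - a x : ℤ) : ℂ)‖ ≤ Real.exp (-(20 * n)) / 4 ^ k := by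
  classical
  have hnr : (1 : ℝ) ≤ n := by exact_mod_cast hn
  have hkr : (k + 1 : ℝ) ≤ 2 * n := by exact_mod_cast hk
  have hcn : ∑ γ, ‖c γ‖ ≤ n := by linarith
  have he0 := Real.exp_pos (-(20 * (n : ℝ)))
  have hε1 : ε ≤ Real.exp (-(20 * n)) :=
    hε.trans (div_le_self he0.le (one_le_pow₀ (by norm_num)))
  obtain ⟨A, hA⟩ : ∃ A : Finset G, ∀ x, x ∈ A ↔ fZ x ≠ 0 :=
    ⟨Finset.univ.filter (fun x => fZ x ≠ 0), by simp⟩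
  have hAne : A.Nonempty := by
    obtain ⟨x, hx⟩ := hne
    exact ⟨x, (hA x).2 hx⟩
  obtain ⟨H, HF, hHF, hAH, a, ha1, ⟨y, hy⟩, ha3⟩ := step c n hn hcn fZ ε hε1 hf A hA hAne L hL hnL
  have hHpos : 0 < HF.card := Finset.card_pos.2 ⟨0, (hHF 0).2 H.zero_mem⟩
  have hHr : (0 : ℝ) < HF.card := by exact_mod_cast hHpos
  obtain ⟨δ, hδ⟩ : ∃ δ : ℝ, δ = Real.exp (-(24 * n)) := ⟨_, rfl⟩
  rw [← hδ] at ha3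
  have hδle : δ ≤ Real.exp (-(20 * n)) / 4 ^ k / 2 := by
    have e1 : δ = Real.exp (-(20 * n)) * Real.exp (-(4 * n)) := by
      rw [hδ, ← Real.exp_add]; congr 1; ring
    rw [e1, div_div, div_eq_mul_inv]
    apply mul_le_mul_of_nonneg_left _ he0.le
    rw [Real.exp_neg]
    apply inv_anti₀ (by positivity)
    have h4 : (4 : ℝ) ^ k * 2 ≤ 2 ^ (4 * n) := by
      have : (4 : ℝ) ^ k * 2 = 2 ^ (2 * k + 1) := by rw [pow_succ, pow_mul]; norm_num
      rw [this]
      exact pow_le_pow_right₀ (by norm_num) (by omega)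
    have := two_pow_le_exp (4 * n)
    push_cast at this
    exact h4.trans this
  have hε2 : ε ≤ Real.exp (-(20 * n)) / 4 ^ k / 4 := by
    rwa [div_div, ← pow_succ]
  have hsmall : Real.exp (-(20 * n)) / 4 ^ k ≤ 1 / 4 := by
    refine (div_le_self he0.le (one_le_pow₀ (by norm_num))).trans ?_
    rw [Real.exp_neg, one_div]
    apply inv_anti₀ (by norm_num)
    have := Real.add_one_le_exp (20 * (n : ℝ))
    linarith
  have hbase0 : 0 ≤ Real.exp (-(20 * n)) / 4 ^ k := by positivity
  have hε0 : 0 ≤ ε := (norm_nonneg _).trans (hf 0)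
  set Ann := Finset.univ.filter (fun γ : AddChar G ℂ => ∀ t ∈ H, γ t = 1) with hAnn
  set mn : G → ℂ := fun x => ∑ γ ∈ Ann, c γ * γ x with hmn
  have hmean : ∀ x, ‖mn x - a x‖ ≤ ε + δ := by
    intro x
    have e1 : (HF.card : ℂ) * (mn x - a x) = ∑ t ∈ HF, (fs c (x + t) - fZ (x + t)) +
        ∑ t ∈ HF, (((fZ (x + t) : ℝ) - a x : ℝ) : ℂ) := by
      rw [← Finset.sum_add_distrib]
      have h1 := mean_fs H HF hHF c x
      rw [mul_sub, hmn]
      dsimp only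
      rw [← h1, ← nsmul_eq_mul, ← Finset.sum_const, ← Finset.sum_sub_distrib]
      apply Finset.sum_congr rfl
      intro t _
      push_cast
      ring
    have e2 : (HF.card : ℝ) * ‖mn x - a x‖ ≤ HF.card * (ε + δ) := by
      calc (HF.card : ℝ) * ‖mn x - a x‖ = ‖(HF.card : ℂ) * (mn x - a x)‖ := by
            rw [norm_mul, Complex.norm_natCast]
        _ ≤ ‖∑ t ∈ HF, (fs c (x + t) - fZ (x + t))‖ +
            ‖∑ t ∈ HF, (((fZ (x + t) : ℝ) - a x : ℝ) : ℂ)‖ := by rw [e1]; exact norm_add_le _ _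
        _ ≤ HF.card * ε + δ * HF.card := by
            apply add_le_add
            · refine (norm_sum_le _ _).trans ?_
              refine (Finset.sum_le_sum fun t _ => hf (x + t)).trans ?_
              rw [Finset.sum_const, nsmul_eq_mul]
            · rw [← Complex.ofReal_sum, Complex.norm_real]
              exact ha3 x
        _ = _ := by ring
    exact le_of_mul_le_mul_left e2 hHr
  refine ⟨fun γ => if γ ∈ Ann then 0 else c γ, H, HF, a, hHF, ha1, hHpos, ?_, ?_, ?_⟩
  · -- total mass of `a`
    have hpt : ∀ x, |(a x : ℝ)| * HF.card ≤ 2 * ∑ t ∈ HF, |(fZ (x + t) : ℝ)| := by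
      intro x
      have hnn : 0 ≤ ∑ t ∈ HF, |(fZ (x + t) : ℝ)| := Finset.sum_nonneg fun _ _ => abs_nonneg _
      by_cases h0 : a x = 0
      · rw [h0]; simp only [Int.cast_zero, abs_zero, zero_mul]; linarith
      have h1 : (1 : ℝ) ≤ |(a x : ℝ)| := by exact_mod_cast Int.one_le_abs h0
      have h2 := ha3 x
      rw [Finset.sum_sub_distrib, Finset.sum_const, nsmul_eq_mul] at h2
      have h3 : |(HF.card : ℝ) * a x| ≤ |∑ t ∈ HF, (fZ (x + t) : ℝ)| + δ * HF.card := by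
        have := abs_sub_abs_le_abs_sub ((HF.card : ℝ) * a x) (∑ t ∈ HF, (fZ (x + t) : ℝ))
        rw [abs_sub_comm] at this
        linarith
      rw [abs_mul, abs_of_pos hHr] at h3
      have h4 := Finset.abs_sum_le_sum_abs (fun t => (fZ (x + t) : ℝ)) HF
      have h5 : δ * HF.card ≤ 1 / 2 * (|(a x : ℝ)| * HF.card) := by
        have : δ ≤ 1 / 2 * |(a x : ℝ)| := by linarith
        calc δ * HF.card ≤ 1 / 2 * |(a x : ℝ)| * HF.card := mul_le_mul_of_nonneg_right this hHr.le
          _ = _ := by ring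
      linarith
    have hfb : ∀ x, |(fZ x : ℝ)| ≤ (n + 1) * (if x ∈ A then 1 else 0) := by
      intro x
      split_ifs with hx
      · have h1 := hf x
        rw [norm_sub_rev] at h1
        have h2 := fs_norm c n hcn x
        have h3 : ‖(fZ x : ℂ)‖ ≤ ‖(fZ x : ℂ) - fs c x‖ + ‖fs c x‖ := by
          have := norm_add_le ((fZ x : ℂ) - fs c x) (fs c x)
          rwa [sub_add_cancel] at this
        rw [Complex.norm_intCast] at h3
        linarith
      · rw [hA] at hx; push Not at hx; rw [hx]; simp
    have hsumf : ∑ x, |(fZ x : ℝ)| ≤ (n + 1) * A.card := by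
      refine (Finset.sum_le_sum fun x _ => hfb x).trans ?_
      rw [← Finset.mul_sum]
      simp
    have h1 : (∑ x, |(a x : ℝ)|) * HF.card ≤ (2 * ∑ x, |(fZ x : ℝ)|) * HF.card := by
      rw [Finset.sum_mul]
      refine (Finset.sum_le_sum fun x _ => hpt x).trans (le_of_eq ?_)
      rw [← Finset.mul_sum, Finset.sum_comm]
      have : ∀ t ∈ HF, ∑ x, |(fZ (x + t) : ℝ)| = ∑ x, |(fZ x : ℝ)| := fun t _ =>
        Equiv.sum_comp (Equiv.addRight t) (fun x => |(fZ x : ℝ)|)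
      rw [Finset.sum_congr rfl this, Finset.sum_const, nsmul_eq_mul]
      ring
    have h2 := le_of_mul_le_mul_right h1 hHr
    calc ∑ x, |(a x : ℝ)| ≤ 2 * ((n + 1) * A.card) := h2.trans (by linarith)
      _ ≤ 2 * ((n + 1) * (Real.exp (2 ^ 54 * (n ^ 4 * L ^ 3)) * HF.card)) := by gcongr
      _ = _ := by ring
  · have h1 : ∑ γ, ‖(if γ ∈ Ann then 0 else c γ)‖ + ∑ γ ∈ Ann, ‖c γ‖ = ∑ γ, ‖c γ‖ := by
      have e5 : ∑ γ ∈ Ann, ‖c γ‖ = ∑ γ, (if γ ∈ Ann then ‖c γ‖ else 0) := by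
        rw [Finset.sum_ite_mem, Finset.univ_inter]
      rw [e5, ← Finset.sum_add_distrib]
      apply Finset.sum_congr rfl
      intro γ _
      split_ifs <;> simp
    have h2 : (1 : ℝ) / 2 ≤ ∑ γ ∈ Ann, ‖c γ‖ := by
      have h3 := hmean y
      have h4 : (1 : ℝ) ≤ ‖(a y : ℂ)‖ := by
        rw [Complex.norm_intCast]; exact_mod_cast Int.one_le_abs hy
      have h5 : ‖(a y : ℂ)‖ ≤ ‖(a y : ℂ) - mn y‖ + ‖mn y‖ := by
        have := norm_add_le ((a y : ℂ) - mn y) (mn y)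
        rwa [sub_add_cancel] at this
      rw [norm_sub_rev] at h5
      have h6 : ‖mn y‖ ≤ ∑ γ ∈ Ann, ‖c γ‖ := by
        refine (norm_sum_le _ _).trans (le_of_eq ?_)
        apply Finset.sum_congr rfl
        intro γ _
        rw [norm_mul, AddChar.norm_apply, mul_one]
      linarith
    linarith
  · intro x
    have e1 : fs (fun γ => if γ ∈ Ann then 0 else c γ) x = fs c x - mn x := by
      rw [eq_sub_iff_add_eq, hmn]
      unfold fs
      dsimp only
      have e5 : ∑ γ ∈ Ann, c γ * γ x = ∑ γ, (if γ ∈ Ann then c γ * γ x else 0) := by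
        rw [Finset.sum_ite_mem, Finset.univ_inter]
      rw [e5, ← Finset.sum_add_distrib]
      apply Finset.sum_congr rfl
      intro γ _
      split_ifs <;> simp
    rw [e1]
    have e2 : fs c x - mn x - ((fZ x - a x : ℤ) : ℂ) = (fs c x - fZ x) - (mn x - a x) := by
      push_cast; ring
    rw [e2]
    have h1 := norm_sub_le (fs c x - fZ x) (mn x - a x)
    have h2 := hmean x
    have h3 := hf x
    linarith

open Classical in
theorem outer (n L : ℕ) (hn : 1 ≤ n) (hL : 1 ≤ L) (hnL : n ≤ 2 ^ L) (B : ℝ)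
    (hB : B = 2 * (n + 1) * Real.exp (2 ^ 54 * (n ^ 4 * L ^ 3))) (k : ℕ) (hk : k ≤ 2 * n) :
    ∀ (c : AddChar G ℂ → ℂ) (fZ : G → ℤ), ∑ γ, ‖c γ‖ ≤ k / 2 →
      (∀ x, ‖fs c x - fZ x‖ ≤ Real.exp (-(20 * n)) / 4 ^ k) →
      ∃ z : Set G → ℤ, (∀ W, W ∉ cosets G → z W = 0) ∧
      (∀ x, (fZ x : ℝ) = ∑ W, (z W : ℝ) * W.indicator (1 : G → ℝ) x) ∧
      ∑ W, |(z W : ℝ)| ≤ k * B := by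
  have hB0 : 0 ≤ B := by rw [hB]; positivity
  have htriv : ∀ (fZ : G → ℤ) (k : ℕ), (∀ x, fZ x = 0) → ∃ z : Set G → ℤ, (∀ W, W ∉ cosets G → z W = 0) ∧
      (∀ x, (fZ x : ℝ) = ∑ W, (z W : ℝ) * W.indicator (1 : G → ℝ) x) ∧
      ∑ W, |(z W : ℝ)| ≤ k * B := by
    intro fZ k h
    refine ⟨fun _ => 0, fun _ _ => rfl, fun x => by simp [h x], ?_⟩
    simp only [Int.cast_zero, abs_zero, Finset.sum_const_zero]
    positivity
  induction k with
  | zero =>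
    intro c fZ hc hf
    apply htriv
    intro x
    apply int_eq_of_close
    have h1 := hf x
    have h2 : ‖fs c x‖ ≤ 0 := by
      refine le_trans ?_ (hc.trans (by simp))
      unfold fs
      refine (norm_sum_le _ _).trans (le_of_eq ?_)
      apply Finset.sum_congr rfl
      intro γ _
      rw [norm_mul, AddChar.norm_apply, mul_one]
    have h3 : fs c x = 0 := norm_le_zero_iff.1 h2
    rw [h3, zero_sub, norm_neg] at h1
    rw [Int.cast_zero, sub_zero]
    refine lt_of_le_of_lt h1 ?_
    rw [pow_zero, div_one, Real.exp_lt_one_iff]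
    have hnr : (1 : ℝ) ≤ n := by exact_mod_cast hn
    linarith
  | succ k ih =>
    intro c fZ hc hf
    by_cases hne : ∃ x, fZ x ≠ 0
    swap
    · push Not at hne
      exact htriv fZ (k + 1) hne
    obtain ⟨c', H, HF, a, hHF, ha, hHpos, hamass, hc', hf'⟩ := outer_step c n k hn hk
      (by push_cast at hc; exact hc) fZ _ le_rfl hf hne L hL hnL
    obtain ⟨z1, h1, h2, h3⟩ := ih (by omega) c' (fun x => fZ x - a x) hc' hf'
    obtain ⟨z2, g1, g2, g3⟩ := coset_rep H HF hHF a ha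
    have hHr : (0 : ℝ) < HF.card := by exact_mod_cast hHpos
    refine ⟨fun W => z1 W + z2 W, fun W hW => by show z1 W + z2 W = 0; rw [h1 W hW, g1 W hW]; rfl, ?_, ?_⟩
    · intro x
      have e1 := h2 x
      have e2 := g2 x
      push_cast at e1
      rw [sub_eq_iff_eq_add, e2, ← Finset.sum_add_distrib] at e1
      rw [e1]
      apply Finset.sum_congr rfl
      intro W _
      push_cast; ring
    · have e1 : ∑ W, |(z2 W : ℝ)| ≤ B := by
        rw [← g3, ← hB] at hamass
        exact le_of_mul_le_mul_right hamass hHr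
      calc ∑ W, |((z1 W + z2 W : ℤ) : ℝ)| ≤ ∑ W, (|(z1 W : ℝ)| + |(z2 W : ℝ)|) := by
            apply Finset.sum_le_sum
            intro W _
            push_cast
            exact abs_add_le _ _
        _ = ∑ W, |(z1 W : ℝ)| + ∑ W, |(z2 W : ℝ)| := Finset.sum_add_distrib
        _ ≤ _ := by push_cast; linarith

end Part16

section Part17

variable {G : Type} [AddCommGroup G] [DecidableEq G] [Fintype G]

/-- Fourier inversion. -/
theorem fs_fourierCoeff (f : G → ℂ) (x : G) : fs (fourierCoeff f) x = f x := by
  have hN : (Fintype.card G : ℂ) ≠ 0 := by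
    exact_mod_cast Fintype.card_ne_zero
  have key : ∀ y : G, ∑ γ : AddChar G ℂ, (starRingEnd ℂ) (γ y) * γ x =
      if x - y = 0 then (Fintype.card G : ℂ) else 0 := by
    intro y
    rw [← AddChar.sum_apply_eq_ite]
    apply Finset.sum_congr rfl
    intro γ _
    rw [sub_eq_add_neg, AddChar.map_add_eq_mul, AddChar.map_neg_eq_conj, mul_comm]
  have h1 : fs (fourierCoeff f) x =
      (Fintype.card G : ℂ)⁻¹ * ∑ y, f y * ∑ γ : AddChar G ℂ, (starRingEnd ℂ) (γ y) * γ x := by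
    unfold fs fourierCoeff
    simp only [Finset.mul_sum, Finset.sum_mul]
    rw [Finset.sum_comm]
    apply Finset.sum_congr rfl
    intro y _
    apply Finset.sum_congr rfl
    intro γ _
    ring
  rw [h1, Finset.sum_eq_single x]
  · rw [key, if_pos (sub_self x)]
    field_simp
  · intro y _ hy
    rw [key, if_neg (fun h => hy (sub_eq_zero.1 h).symm), mul_zero]
  · intro h; exact absurd (Finset.mem_univ _) h

/-- The numerical bound at the end. -/
theorem final_bound (M : ℝ) (hM : 1 ≤ M) (n L : ℕ) (hn : 1 ≤ n) (hnM : (n : ℝ) ≤ 2 * M)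
    (hL : 1 ≤ L) (hLn : 2 ^ (L - 1) ≤ n) :
    ((2 * n : ℕ) : ℝ) * (2 * (n + 1) * Real.exp (2 ^ 54 * (n ^ 4 * L ^ 3))) ≤
      Real.exp (2 ^ 70 * M ^ 4 * Real.log (2 * M) ^ 8) := by
  set l := Real.log (2 * M) with hl
  have hlog2 : (1 / 2 : ℝ) ≤ Real.log 2 := by linarith [Real.log_two_gt_d9]
  have hl2 : Real.log 2 ≤ l := Real.log_le_log (by norm_num) (by linarith)
  have hlh : (1 / 2 : ℝ) ≤ l := hlog2.trans hl2
  have hnr : (1 : ℝ) ≤ n := by exact_mod_cast hn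
  have hLr : (1 : ℝ) ≤ L := by exact_mod_cast hL
  have hL1 : ((L - 1 : ℕ) : ℝ) * Real.log 2 ≤ l := by
    rw [← Real.log_pow]
    apply Real.log_le_log (by positivity)
    have : ((2 ^ (L - 1) : ℕ) : ℝ) ≤ n := by exact_mod_cast hLn
    push_cast at this
    linarith
  have hLl : (L : ℝ) ≤ 4 * l := by
    rw [Nat.cast_sub hL] at hL1
    push_cast at hL1
    nlinarith
  have hn4 : (n : ℝ) ^ 4 ≤ 16 * M ^ 4 := by
    calc (n : ℝ) ^ 4 ≤ (2 * M) ^ 4 := pow_le_pow_left₀ (by linarith) hnM 4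
      _ = 16 * M ^ 4 := by ring
  have hL3 : (L : ℝ) ^ 3 ≤ 64 * l ^ 3 := by
    calc (L : ℝ) ^ 3 ≤ (4 * l) ^ 3 := pow_le_pow_left₀ (by linarith) hLl 3
      _ = 64 * l ^ 3 := by ring
  have hl5 : (1 : ℝ) ≤ 32 * l ^ 5 := by
    have : (1 / 2 : ℝ) ^ 5 ≤ l ^ 5 := pow_le_pow_left₀ (by norm_num) hlh 5
    norm_num at this
    linarith
  have hD : (n : ℝ) ^ 4 * L ^ 3 ≤ 2 ^ 10 * (M ^ 4 * l ^ 3) := by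
    calc (n : ℝ) ^ 4 * L ^ 3 ≤ (16 * M ^ 4) * (64 * l ^ 3) :=
          mul_le_mul hn4 hL3 (by positivity) (by positivity)
      _ = 2 ^ 10 * (M ^ 4 * l ^ 3) := by ring
  have hl8 : M ^ 4 * l ^ 3 ≤ 32 * (M ^ 4 * l ^ 8) := by
    have h0 : 0 ≤ M ^ 4 * l ^ 3 := by positivity
    calc M ^ 4 * l ^ 3 ≤ M ^ 4 * l ^ 3 * (32 * l ^ 5) := le_mul_of_one_le_right h0 hl5
      _ = 32 * (M ^ 4 * l ^ 8) := by ring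
  have hn2 : (n : ℝ) ^ 2 ≤ n ^ 4 * L ^ 3 := by
    have a1 : (n : ℝ) ^ 2 ≤ n ^ 4 := pow_le_pow_right₀ hnr (by norm_num)
    have a2 : (1 : ℝ) ≤ (L : ℝ) ^ 3 := one_le_pow₀ hLr
    exact a1.trans (le_mul_of_one_le_right (by positivity) a2)
  have hpre : ((2 * n : ℕ) : ℝ) * (2 * (n + 1)) ≤ Real.exp (8 * n ^ 2) := by
    have := Real.add_one_le_exp (8 * (n : ℝ) ^ 2)
    push_cast
    nlinarith
  calc ((2 * n : ℕ) : ℝ) * (2 * (n + 1) * Real.exp (2 ^ 54 * (n ^ 4 * L ^ 3)))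
      = (((2 * n : ℕ) : ℝ) * (2 * (n + 1))) * Real.exp (2 ^ 54 * (n ^ 4 * L ^ 3)) := by ring
    _ ≤ Real.exp (8 * n ^ 2) * Real.exp (2 ^ 54 * (n ^ 4 * L ^ 3)) :=
        mul_le_mul_of_nonneg_right hpre (Real.exp_pos _).le
    _ = Real.exp (8 * n ^ 2 + 2 ^ 54 * (n ^ 4 * L ^ 3)) := (Real.exp_add _ _).symm
    _ ≤ Real.exp (2 ^ 70 * M ^ 4 * l ^ 8) := by
        apply Real.exp_le_exp.2
        have hP : 0 ≤ (n : ℝ) ^ 4 * L ^ 3 := by positivity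
        linarith

end Part17


/-- Theorem 8.1.  There are absolute constants `C', C > 0` such that for
every finite abelian group `G`, every `M ≥ 1` and `ε ∈ [0,1]` with `ε ≤ exp(−C'·M)`, and
every `ε`-almost integer-valued `f : G → ℂ` (with integer part `fZ`) with `‖f‖_{A(G)} ≤ M`,
there is `z : 𝒲(G) → ℤ` with `f_ℤ = ∑_{W} z(W)·1_W` and
`∑_W |z(W)| ≤ exp(C·M⁴·log⁸(2M))`. -/
theorem statement1 :
    ∃ C' C : ℝ, 0 < C' ∧ 0 < C ∧
      ∀ (G : Type) [AddCommGroup G] [Fintype G], ∀ (M ε : ℝ) (f : G → ℂ) (fZ : G → ℤ),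
        1 ≤ M → 0 ≤ ε → ε ≤ 1 → ε ≤ Real.exp (-(C' * M)) →
        AlmostInt ε f fZ → wienerNorm f ≤ M →
        ∃ z : Set G → ℤ,
          (∀ x : G, (fZ x : ℝ) = ∑ᶠ W ∈ cosets G, (z W : ℝ) * W.indicator (1 : G → ℝ) x) ∧
          (∑ᶠ W ∈ cosets G, |(z W : ℝ)|) ≤ Real.exp (C * M ^ 4 * Real.log (2 * M) ^ 8) := by
  refine ⟨50, 2 ^ 70, by norm_num, by norm_num, ?_⟩
  intro G _ _ M ε f fZ hM hε0 hε1 hε hf hw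
  classical
  have hn : 1 ≤ ⌈M⌉₊ := Nat.one_le_ceil_iff.2 (by linarith)
  have hMn : M ≤ ⌈M⌉₊ := Nat.le_ceil M
  have hnM : (⌈M⌉₊ : ℝ) ≤ 2 * M := by
    have := Nat.ceil_lt_add_one (show 0 ≤ M by linarith)
    linarith
  generalize ⌈M⌉₊ = n at hn hMn hnM
  have hnL : n ≤ 2 ^ (Nat.log 2 n + 1) := (Nat.lt_pow_succ_log_self (by norm_num) n).le
  have hLn : 2 ^ (Nat.log 2 n + 1 - 1) ≤ n := by
    rw [Nat.add_sub_cancel]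
    exact Nat.pow_log_le_self 2 (by omega)
  have hL : 1 ≤ Nat.log 2 n + 1 := by omega
  generalize Nat.log 2 n + 1 = L at hnL hLn hL
  have hsum : ∑ γ, ‖fourierCoeff f γ‖ ≤ ((2 * n : ℕ) : ℝ) / 2 := by
    have h := hw
    unfold wienerNorm at h
    rw [finsum_eq_sum_of_fintype] at h
    push_cast
    linarith
  have hε2 : ε ≤ Real.exp (-(20 * n)) / 4 ^ (2 * n) := by
    rw [le_div_iff₀ (by positivity)]
    have h1 := two_pow_le_exp (4 * n)
    have h2 : (4 : ℝ) ^ (2 * n) = 2 ^ (4 * n) := by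
      rw [show (4 : ℝ) = 2 ^ 2 by norm_num, ← pow_mul]
      congr 1
      ring
    rw [h2]
    calc ε * 2 ^ (4 * n) ≤ Real.exp (-(50 * M)) * Real.exp ((4 * n : ℕ) : ℝ) :=
          mul_le_mul hε h1 (by positivity) (Real.exp_pos _).le
      _ = Real.exp (-(50 * M) + ((4 * n : ℕ) : ℝ)) := (Real.exp_add _ _).symm
      _ ≤ Real.exp (-(20 * n)) := by
          apply Real.exp_le_exp.2
          push_cast
          linarith
  have happ : ∀ x, ‖fs (fourierCoeff f) x - fZ x‖ ≤ Real.exp (-(20 * n)) / 4 ^ (2 * n) := by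
    intro x
    rw [fs_fourierCoeff]
    exact (hf x).trans hε2
  obtain ⟨z, hz0, hz1, hz2⟩ := outer n L hn hL hnL _ rfl (2 * n) le_rfl (fourierCoeff f) fZ hsum happ
  have hconv : ∀ g : Set G → ℝ, (∀ W, W ∉ cosets G → g W = 0) →
      ∑ᶠ W ∈ cosets G, g W = ∑ W, g W := by
    intro g hg
    rw [finsum_mem_def, finsum_eq_sum_of_fintype]
    apply Finset.sum_congr rfl
    intro W _
    by_cases hW : W ∈ cosets G
    · rw [Set.indicator_of_mem hW]
    · rw [Set.indicator_of_notMem hW, hg W hW]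
  refine ⟨z, ?_, ?_⟩
  · intro x
    rw [hconv _ (fun W hW => by rw [hz0 W hW]; simp), hz1 x]
  · rw [hconv _ (fun W hW => by rw [hz0 W hW]; simp)]
    exact hz2.trans (final_bound M hM n L hn hnM hL hLn)

end Paper
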